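/- Let ℓ, m be positive integers. For any set A ⊆ ℕ with positive upper Banach density, there exist an infinite set B ⊆ ℕ and a positive integer t such that ℓ·B ∪ {m·b₁ + ℓ·b₂ : b₁, b₂ ∈ B and b₁ < b₂} ⊆ A − t. -/

import Mathlib

open Filter MeasureTheory Topology

open scoped Classical in
/-- Upper Banach density: `limsup` over window length `N` of the maximal count of
elements of `A` in a window of length `N`, divided by `N`. -/
noncomputable def upperBanachDensity (A : Set ℕ) : ℝ :=
  Filter.limsup
    (fun N : ℕ => ⨆ M : ℕ, (((Finset.Ico M (M + N)).filter (· ∈ A)).card : ℝ) / N)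
    Filter.atTop

open scoped Classical in
/-- Natural upper density of a set of naturals. -/
noncomputable def upperDensity (A : Set ℕ) : ℝ :=
  Filter.limsup (fun N : ℕ => (((Finset.Icc 1 N).filter (· ∈ A)).card : ℝ) / N)
    Filter.atTop

open scoped Classical in
/-- Natural lower density of a set of naturals. -/
noncomputable def lowerDensity (A : Set ℕ) : ℝ :=
  Filter.liminf (fun N : ℕ => (((Finset.Icc 1 N).filter (· ∈ A)).card : ℝ) / N)
    Filter.atTop



/-! ### Bounded functions and means -/

/-- bounded real function on the integers -/
def Bdd (f : ℤ → ℝ) : Prop := ∃ C : ℝ, ∀ z, |f z| ≤ C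

lemma Bdd.const (c : ℝ) : Bdd (fun _ => c) := ⟨|c|, fun _ => le_rfl⟩

lemma Bdd.add {f g : ℤ → ℝ} (hf : Bdd f) (hg : Bdd g) : Bdd (fun z => f z + g z) := by
  obtain ⟨C, hC⟩ := hf
  obtain ⟨D, hD⟩ := hg
  exact ⟨C + D, fun z => (abs_add_le _ _).trans (add_le_add (hC z) (hD z))⟩

lemma Bdd.mul {f g : ℤ → ℝ} (hf : Bdd f) (hg : Bdd g) : Bdd (fun z => f z * g z) := by
  obtain ⟨C, hC⟩ := hf
  obtain ⟨D, hD⟩ := hg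
  refine ⟨C * D, fun z => ?_⟩
  rw [abs_mul]
  exact mul_le_mul (hC z) (hD z) (abs_nonneg _) ((abs_nonneg _).trans (hC z))

lemma Bdd.const_mul {f : ℤ → ℝ} (c : ℝ) (hf : Bdd f) : Bdd (fun z => c * f z) :=
  (Bdd.const c).mul hf

lemma Bdd.neg {f : ℤ → ℝ} (hf : Bdd f) : Bdd (fun z => - f z) := by
  obtain ⟨C, hC⟩ := hf
  exact ⟨C, fun z => by rw [abs_neg]; exact hC z⟩

lemma Bdd.sub {f g : ℤ → ℝ} (hf : Bdd f) (hg : Bdd g) : Bdd (fun z => f z - g z) := by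
  simpa [sub_eq_add_neg] using hf.add hg.neg

lemma Bdd.abs {f : ℤ → ℝ} (hf : Bdd f) : Bdd (fun z => |f z|) := by
  obtain ⟨C, hC⟩ := hf
  exact ⟨C, fun z => by rw [abs_abs]; exact hC z⟩

lemma Bdd.comp {f : ℤ → ℝ} (hf : Bdd f) (g : ℤ → ℤ) : Bdd (fun z => f (g z)) := by
  obtain ⟨C, hC⟩ := hf
  exact ⟨C, fun z => hC _⟩

lemma Bdd.sum {ι : Type*} (s : Finset ι) {f : ι → ℤ → ℝ} (hf : ∀ i, Bdd (f i)) :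
    Bdd (fun z => ∑ i ∈ s, f i z) := by
  classical
  induction s using Finset.induction_on with
  | empty => simpa using Bdd.const 0
  | insert a s ha ih => simpa [Finset.sum_insert ha] using (hf a).add ih

lemma Bdd.of_le {f : ℤ → ℝ} {C : ℝ} (h0 : ∀ z, 0 ≤ f z) (h1 : ∀ z, f z ≤ C) : Bdd f :=
  ⟨C, fun z => by rw [abs_of_nonneg (h0 z)]; exact h1 z⟩

/-- shift-invariant means on bounded functions concentrated at plus infinity -/
structure IsMean (L : (ℤ → ℝ) → ℝ) : Prop where
  add : ∀ {f g}, Bdd f → Bdd g → L (fun z => f z + g z) = L f + L g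
  smul : ∀ (c : ℝ) {f}, Bdd f → L (fun z => c * f z) = c * L f
  mono : ∀ {f g}, Bdd f → Bdd g → (∀ z, f z ≤ g z) → L f ≤ L g
  one : L (fun _ => 1) = 1
  shift : ∀ {f}, Bdd f → ∀ s, L (fun z => f (z + s)) = L f
  vanish : ∀ {f}, Bdd f → Tendsto f atTop (𝓝 0) → L f = 0

namespace IsMean

lemma const {L : (ℤ → ℝ) → ℝ} (hL : IsMean L) (c : ℝ) : L (fun _ => c) = c := by
  have := hL.smul c (Bdd.const 1)
  simpa [hL.one] using this

lemma neg {L : (ℤ → ℝ) → ℝ} (hL : IsMean L) {f : ℤ → ℝ} (hf : Bdd f) : L (fun z => - f z) = - L f := by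
  have := hL.smul (-1) hf
  simpa using this

lemma sub {L : (ℤ → ℝ) → ℝ} (hL : IsMean L) {f g : ℤ → ℝ} (hf : Bdd f) (hg : Bdd g) : L (fun z => f z - g z) = L f - L g := by
  have := hL.add hf hg.neg
  rw [hL.neg hg] at this
  simpa [sub_eq_add_neg] using this

lemma le_const {L : (ℤ → ℝ) → ℝ} (hL : IsMean L) {f : ℤ → ℝ} (hf : Bdd f) {c : ℝ} (h : ∀ z, f z ≤ c) : L f ≤ c := by
  have := hL.mono hf (Bdd.const c) h
  rwa [hL.const] at this

lemma const_le {L : (ℤ → ℝ) → ℝ} (hL : IsMean L) {f : ℤ → ℝ} (hf : Bdd f) {c : ℝ} (h : ∀ z, c ≤ f z) : c ≤ L f := by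
  have := hL.mono (Bdd.const c) hf h
  rwa [hL.const] at this

lemma nonneg {L : (ℤ → ℝ) → ℝ} (hL : IsMean L) {f : ℤ → ℝ} (hf : Bdd f) (h : ∀ z, 0 ≤ f z) : 0 ≤ L f := hL.const_le hf h

lemma abs_le {L : (ℤ → ℝ) → ℝ} (hL : IsMean L) {f : ℤ → ℝ} (hf : Bdd f) : |L f| ≤ L (fun z => |f z|) := by
  rw [abs_le']
  refine ⟨hL.mono hf hf.abs fun z => le_abs_self _, ?_⟩
  rw [← hL.neg hf]
  exact hL.mono hf.neg hf.abs fun z => neg_le_abs _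

lemma abs_le_const {L : (ℤ → ℝ) → ℝ} (hL : IsMean L) {f : ℤ → ℝ} {c : ℝ} (h : ∀ z, |f z| ≤ c) : |L f| ≤ c :=
  (hL.abs_le ⟨c, h⟩).trans (hL.le_const (Bdd.abs ⟨c, h⟩) h)

lemma sum {L : (ℤ → ℝ) → ℝ} (hL : IsMean L) {ι : Type*} (s : Finset ι) {f : ι → ℤ → ℝ} (hf : ∀ i, Bdd (f i)) :
    L (fun z => ∑ i ∈ s, f i z) = ∑ i ∈ s, L (f i) := by
  classical
  induction s using Finset.induction_on with
  | empty => simpa using hL.const 0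
  | insert a s ha ih =>
    simp only [Finset.sum_insert ha]
    rw [hL.add (hf a) (Bdd.sum s hf), ih]

lemma avg {L : (ℤ → ℝ) → ℝ} (hL : IsMean L) {f : ℤ → ℝ} (hf : Bdd f) {N : ℕ} (hN : 0 < N) (g : ℕ → ℤ) :
    L (fun z => (N : ℝ)⁻¹ * ∑ j ∈ Finset.range N, f (z + g j)) = L f := by
  rw [hL.smul _ (Bdd.sum _ fun j => hf.comp _), hL.sum _ (fun j => hf.comp _)]
  rw [Finset.sum_congr rfl fun j _ => hL.shift hf (g j)]
  simp
  field_simp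

lemma sq_le {L : (ℤ → ℝ) → ℝ} (hL : IsMean L) {f : ℤ → ℝ} (hf : Bdd f) (h : L (fun z => f z ^ 2) = 0) : L (fun z => |f z|) = 0 := by
  apply le_antisymm _ (hL.nonneg hf.abs fun z => abs_nonneg _)
  apply le_of_forall_pos_le_add
  intro ε hε
  have h2 : Bdd (fun z => f z ^ 2) := by simpa [sq] using hf.mul hf
  have h3 : L (fun z => |f z|) ≤ L (fun z => ε + ε⁻¹ * f z ^ 2) := by
    refine hL.mono hf.abs ((Bdd.const ε).add (h2.const_mul _)) fun z => ?_
    have : |f z| * ε ≤ ε * ε + f z ^ 2 := by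
      nlinarith [sq_abs (f z), sq_nonneg (|f z| - ε), sq_nonneg (|f z|), sq_nonneg ε]
    calc |f z| = (|f z| * ε) * ε⁻¹ := by field_simp
      _ ≤ (ε * ε + f z ^ 2) * ε⁻¹ := by gcongr
      _ = _ := by field_simp
  rw [hL.add (Bdd.const ε) (h2.const_mul _), hL.smul _ h2, h, hL.const] at h3
  linarith
end IsMean

/-! ### Total boundedness -/

/-- total boundedness of a family of closeness relations -/
def TB (R : ℝ → ℤ → ℤ → Prop) : Prop := ∀ ε > 0, ∃ F : Finset ℤ, ∀ s, ∃ i ∈ F, R ε s i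

/-- the triangle inequality -/
def PM (R : ℝ → ℤ → ℤ → Prop) : Prop :=
  ∀ ε ε' s j i, R ε s i → R ε' j i → R (ε + ε') s j

lemma PM.and {R₁ R₂ : ℝ → ℤ → ℤ → Prop} (h₁ : PM R₁) (h₂ : PM R₂) :
    PM (fun ε s i => R₁ ε s i ∧ R₂ ε s i) := fun ε ε' s j i h h' =>
  ⟨h₁ ε ε' s j i h.1 h'.1, h₂ ε ε' s j i h.2 h'.2⟩

lemma TB.and {R₁ R₂ : ℝ → ℤ → ℤ → Prop} (h₁ : TB R₁) (h₂ : TB R₂) (p₁ : PM R₁) (p₂ : PM R₂) :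
    TB (fun ε s i => R₁ ε s i ∧ R₂ ε s i) := by
  classical
  intro ε hε
  obtain ⟨F₁, hF₁⟩ := h₁ (ε / 2) (by positivity)
  obtain ⟨F₂, hF₂⟩ := h₂ (ε / 2) (by positivity)
  let c : ℤ × ℤ → ℤ := fun p =>
    if h : ∃ s, R₁ (ε / 2) s p.1 ∧ R₂ (ε / 2) s p.2 then h.choose else 0
  refine ⟨(F₁ ×ˢ F₂).image c, fun s => ?_⟩
  obtain ⟨i, hi, hi'⟩ := hF₁ s
  obtain ⟨j, hj, hj'⟩ := hF₂ s
  have hex : ∃ s, R₁ (ε / 2) s (i, j).1 ∧ R₂ (ε / 2) s (i, j).2 := ⟨s, hi', hj'⟩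
  refine ⟨c (i, j), Finset.mem_image_of_mem _ (Finset.mem_product.2 ⟨hi, hj⟩), ?_⟩
  have hc : c (i, j) = hex.choose := dif_pos hex
  have hs := hex.choose_spec
  rw [← hc] at hs
  have e : ε = ε / 2 + ε / 2 := by ring
  constructor
  · rw [e]; exact p₁ _ _ _ _ _ hi' hs.1
  · rw [e]; exact p₂ _ _ _ _ _ hj' hs.2

lemma TB.imp {R R' : ℝ → ℤ → ℤ → Prop} (h : TB R)
    (hi : ∀ ε > 0, ∃ δ > 0, ∀ s i, R δ s i → R' ε s i) : TB R' := by
  intro ε hε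
  obtain ⟨δ, hδ, hd⟩ := hi ε hε
  obtain ⟨F, hF⟩ := h δ hδ
  refine ⟨F, fun s => ?_⟩
  obtain ⟨i, hi, h'⟩ := hF s
  exact ⟨i, hi, hd _ _ h'⟩

/-- pulling back along a map of indices -/
lemma TB.comp {R : ℝ → ℤ → ℤ → Prop} (h : TB R) (p : PM R) (g : ℤ → ℤ) :
    TB (fun ε s i => R ε (g s) (g i)) := by
  classical
  intro ε hε
  obtain ⟨F, hF⟩ := h (ε / 2) (by positivity)
  let c : ℤ → ℤ := fun p => if h : ∃ s, R (ε / 2) (g s) p then h.choose else 0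
  refine ⟨F.image c, fun s => ?_⟩
  obtain ⟨i, hi, hi'⟩ := hF (g s)
  have hex : ∃ s, R (ε / 2) (g s) i := ⟨s, hi'⟩
  have hc : c i = hex.choose := dif_pos hex
  have hs := hex.choose_spec
  rw [← hc] at hs
  refine ⟨c i, Finset.mem_image_of_mem _ hi, ?_⟩
  have e : ε = ε / 2 + ε / 2 := by ring
  rw [e]
  exact p _ _ _ _ _ hi' hs

lemma TB.of_bdd {b : ℤ → ℝ} (hb : Bdd b) : TB (fun ε s i => |b s - b i| ≤ ε) := by
  classical
  obtain ⟨C, hC⟩ := hb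
  intro ε hε
  have htb : TotallyBounded (Set.range b) := by
    exact (ProperSpace.isCompact_closedBall 0 C).totallyBounded.subset (by
        rintro _ ⟨z, rfl⟩
        simpa using hC z)
  obtain ⟨t, ht, htf, hc⟩ := (totallyBounded_iff_subset.1 htb) _ (Metric.dist_mem_uniformity hε)
  lift t to Finset ℝ using htf
  have : ∀ y ∈ t, ∃ z, b z = y := fun y hy => ht hy
  choose! g hg using this
  refine ⟨t.image g, fun s => ?_⟩
  have := hc ⟨s, rfl⟩
  simp only [Set.mem_iUnion, Set.mem_ofPred_eq] at this
  obtain ⟨y, hy, hd⟩ := this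
  refine ⟨g y, Finset.mem_image_of_mem _ hy, ?_⟩
  show |b s - b (g y)| ≤ ε
  rw [hg y hy]
  exact hd.le

/-- Bohr almost periodic functions -/
def AP (a : ℤ → ℝ) : Prop := TB (fun ε s i => ∀ z, |a (z + s) - a (z + i)| ≤ ε)

lemma pm_abs (b : ℤ → ℝ) : PM (fun ε s i => |b s - b i| ≤ ε) := by
  intro ε ε' s j i h h'
  have := abs_sub_le (b s) (b i) (b j)
  rw [abs_sub_comm (b i)] at this
  linarith

lemma pm_norm {E : Type*} [SeminormedAddCommGroup E] (b : ℤ → E) :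
    PM (fun ε s i => ‖b s - b i‖ ≤ ε) := by
  intro ε ε' s j i h h'
  have := norm_sub_le_norm_sub_add_norm_sub (b s) (b i) (b j)
  rw [norm_sub_rev (b i)] at this
  linarith

lemma pm_forall (a : ℤ → ℝ) : PM (fun ε s i => ∀ z, |a (z + s) - a (z + i)| ≤ ε) := by
  intro ε ε' s j i h h' z
  have := abs_sub_le (a (z + s)) (a (z + i)) (a (z + j))
  have h1 := h z
  have h2 := h' z
  rw [abs_sub_comm] at h2
  linarith

lemma AP.bdd {a : ℤ → ℝ} (ha : AP a) : Bdd a := by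
  obtain ⟨F, hF⟩ := ha 1 one_pos
  refine ⟨1 + ∑ i ∈ F, |a i|, fun z => ?_⟩
  obtain ⟨i, hi, h⟩ := hF z
  have h1 := h 0
  simp only [zero_add] at h1
  have h2 := abs_sub_abs_le_abs_sub (a z) (a i)
  have h3 := Finset.single_le_sum (f := fun i => |a i|) (fun i _ => abs_nonneg _) hi
  linarith

lemma AP.const (c : ℝ) : AP (fun _ => c) := fun ε hε => ⟨{0}, fun s => ⟨0, by simp, by simp [hε.le]⟩⟩

lemma AP.add {a b : ℤ → ℝ} (ha : AP a) (hb : AP b) : AP (fun z => a z + b z) := by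
  refine (TB.and ha hb (pm_forall a) (pm_forall b)).imp fun ε hε => ⟨ε / 2, by positivity, ?_⟩
  rintro s i ⟨h1, h2⟩ z
  have := abs_add_le (a (z + s) - a (z + i)) (b (z + s) - b (z + i))
  have h1 := h1 z
  have h2 := h2 z
  rw [show a (z + s) + b (z + s) - (a (z + i) + b (z + i)) =
    (a (z + s) - a (z + i)) + (b (z + s) - b (z + i)) by ring]
  linarith

lemma AP.mul {a b : ℤ → ℝ} (ha : AP a) (hb : AP b) : AP (fun z => a z * b z) := by
  obtain ⟨C, hC⟩ := ha.bdd
  obtain ⟨D, hD⟩ := hb.bdd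
  have hC0 : 0 ≤ C := (abs_nonneg _).trans (hC 0)
  have hD0 : 0 ≤ D := (abs_nonneg _).trans (hD 0)
  refine (TB.and ha hb (pm_forall a) (pm_forall b)).imp fun ε hε =>
    ⟨ε / (C + D + 1), by positivity, ?_⟩
  rintro s i ⟨h1, h2⟩ z
  rw [show a (z + s) * b (z + s) - (a (z + i) * b (z + i)) =
    (a (z + s) - a (z + i)) * b (z + s) + a (z + i) * (b (z + s) - b (z + i)) by ring]
  refine (abs_add_le _ _).trans ?_
  rw [abs_mul, abs_mul]
  set δ := ε / (C + D + 1)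
  have hδ : 0 ≤ δ := by positivity
  have e : δ * (C + D + 1) = ε := by simp only [δ]; field_simp
  have := mul_le_mul (h1 z) (hD (z + s)) (abs_nonneg _) hδ
  have := mul_le_mul (hC (z + i)) (h2 z) (abs_nonneg _) hC0
  nlinarith

lemma AP.smul {a : ℤ → ℝ} (c : ℝ) (ha : AP a) : AP (fun z => c * a z) := (AP.const c).mul ha

lemma AP.posPart {a : ℤ → ℝ} (ha : AP a) : AP (fun z => max (a z) 0) := by
  refine TB.imp ha fun ε hε => ⟨ε, hε, fun s i h z => ?_⟩
  exact (abs_max_sub_max_le_abs _ _ _).trans (h z)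

/-- uniform means of almost periodic functions -/
lemma AP.unif {L : (ℤ → ℝ) → ℝ} (hL : IsMean L) {a : ℤ → ℝ} (ha : AP a) {ε : ℝ} (hε : 0 < ε) :
    ∃ N₀ : ℕ, ∀ N : ℕ, N₀ ≤ N → 0 < N → ∀ z : ℤ,
      |(N : ℝ)⁻¹ * ∑ j ∈ Finset.range N, a (z + j) - L a| ≤ ε := by
  obtain ⟨C, hC⟩ := ha.bdd
  have hC0 : 0 ≤ C := (abs_nonneg _).trans (hC 0)
  obtain ⟨F, hF⟩ := ha (ε / 4) (by positivity)
  obtain ⟨B, hB⟩ : ∃ B : ℕ, ∀ i ∈ F, |i| ≤ B := by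
    refine ⟨∑ i ∈ F, i.natAbs, fun i hi => ?_⟩
    have := Finset.single_le_sum (f := fun i : ℤ => i.natAbs) (fun i _ => Nat.zero_le _) hi
    rw [← Int.natCast_natAbs]
    exact_mod_cast this
  obtain ⟨N₀, hN₀⟩ := exists_nat_gt (8 * B * C / ε)
  refine ⟨N₀, fun N hN hNpos => ?_⟩
  set A : ℤ → ℝ := fun z => (N : ℝ)⁻¹ * ∑ j ∈ Finset.range N, a (z + j) with hA
  have hNr : (0 : ℝ) < N := by exact_mod_cast hNpos
  have step : ∀ z, |A (z + 1) - A z| ≤ 2 * C / N := by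
    intro z
    have : A (z + 1) - A z = (N : ℝ)⁻¹ * (a (z + N) - a z) := by
      simp only [hA]
      rw [← mul_sub, ← Finset.sum_sub_distrib]
      congr 1
      have := Finset.sum_range_sub (fun j : ℕ => a (z + j)) N
      simp only [Nat.cast_add, Nat.cast_one, Nat.cast_zero, add_zero] at this
      rw [← this]
      refine Finset.sum_congr rfl fun j _ => ?_
      congr 2; ring
    rw [this, abs_mul, abs_of_pos (inv_pos.2 hNr)]
    have h1 := hC (z + N)
    have h2 := hC z
    have h3 := abs_sub (a (z + N)) (a z)
    rw [inv_mul_eq_div]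
    gcongr
    linarith
  have step2 : ∀ k : ℕ, ∀ z, |A (z + k) - A z| ≤ k * (2 * C / N) := by
    intro k
    induction k with
    | zero => intro z; simp
    | succ k ih =>
      intro z
      have h1 := ih z
      have h2 := step (z + k)
      have h3 := abs_sub_le (A (z + (k + 1 : ℕ))) (A (z + k)) (A z)
      push_cast at h3 ⊢
      rw [← add_assoc] at h3 ⊢
      linarith
  have near : ∀ i ∈ F, |A i - A 0| ≤ ε / 4 := by
    intro i hi
    have hb : (i.natAbs : ℝ) * (2 * C / N) ≤ ε / 4 := by
      have h1 : (i.natAbs : ℝ) ≤ B := by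
        have := hB i hi
        rw [← Int.natCast_natAbs] at this
        exact_mod_cast this
      have h2 : 8 * B * C / ε < N := hN₀.trans_le (by exact_mod_cast hN)
      rw [div_lt_iff₀ hε] at h2
      calc (i.natAbs : ℝ) * (2 * C / N) ≤ B * (2 * C / N) := by gcongr
        _ = (2 * B * C) / N := by ring
        _ ≤ ε / 4 := by rw [div_le_iff₀ hNr]; linarith
    rcases Int.natAbs_eq i with h | h
    · have := step2 i.natAbs 0
      rw [zero_add, ← h] at this
      linarith
    · have := step2 i.natAbs i
      rw [show i + (i.natAbs : ℤ) = 0 by omega, abs_sub_comm] at this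
      linarith
  have near' : ∀ z, |A z - A 0| ≤ ε / 2 := by
    intro z
    obtain ⟨i, hi, h⟩ := hF z
    have h1 := near i hi
    have h2 : |A z - A i| ≤ ε / 4 := by
      simp only [hA]
      rw [← mul_sub, ← Finset.sum_sub_distrib, abs_mul, abs_of_pos (inv_pos.2 hNr),
        inv_mul_le_iff₀ hNr]
      refine (Finset.abs_sum_le_sum_abs _ _).trans ?_
      refine (Finset.sum_le_sum (g := fun _ => ε / 4) fun j _ => ?_).trans (by simp)
      have := h j
      rwa [add_comm z, add_comm i]
    have := abs_sub_le (A z) (A i) (A 0)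
    linarith
  have hmean : |L a - A 0| ≤ ε / 2 := by
    have h1 := hL.avg ha.bdd hNpos (fun j => (j : ℤ))
    rw [← h1, ← hL.const (A 0), ← hL.sub _ (Bdd.const _)]
    · exact hL.abs_le_const near'
    · exact Bdd.const_mul _ (Bdd.sum _ fun j => ha.bdd.comp _)
  intro z
  have := abs_sub_le (A z) (A 0) (L a)
  have := near' z
  rw [abs_sub_comm] at hmean
  linarith

lemma AP.mean_pos {L : (ℤ → ℝ) → ℝ} (hL : IsMean L) {a : ℤ → ℝ} (ha : AP a) (h0 : ∀ z, 0 ≤ a z)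
    (hp : 0 < a 0) : 0 < L a := by
  obtain ⟨F, hF⟩ := ha (a 0 / 2) (by positivity)
  have key : ∀ s, a 0 / 2 ≤ ∑ i ∈ F, a (s + i) := by
    intro s
    obtain ⟨i, hi, h⟩ := hF (-s)
    have h1 := h s
    rw [add_neg_cancel, abs_le] at h1
    have := Finset.single_le_sum (f := fun i => a (s + i)) (fun i _ => h0 _) hi
    linarith
  have h1 := hL.const_le (Bdd.sum F fun i => ha.bdd.comp (fun s => s + i)) key
  rw [hL.sum _ fun i => ha.bdd.comp (fun s => s + i),
    Finset.sum_congr rfl fun i _ => hL.shift ha.bdd i] at h1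
  simp only [Finset.sum_const, nsmul_eq_mul] at h1
  by_contra hneg
  push Not at hneg
  have : (F.card : ℝ) * L a ≤ 0 := mul_nonpos_of_nonneg_of_nonpos (by positivity) hneg
  linarith


/-! ### Weak mixing part -/

section WM
variable {H : Type*} [NormedAddCommGroup H] [InnerProductSpace ℝ H]

lemma bdd_inner (U : ℤ → H →ₗᵢ[ℝ] H) (h g : H) : Bdd (fun n => inner ℝ g (U n h)) :=
  ⟨‖g‖ * ‖h‖, fun n => by
    have := abs_real_inner_le_norm g (U n h)
    rwa [(U n).norm_map] at this⟩

/-- the correlation form -/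
noncomputable def corr (L : (ℤ → ℝ) → ℝ) (U : ℤ → H →ₗᵢ[ℝ] H) (h a b : H) : ℝ :=
  L (fun n => inner ℝ a (U n h) * inner ℝ b (U n h))

lemma corr_comm (L : (ℤ → ℝ) → ℝ) (U : ℤ → H →ₗᵢ[ℝ] H) (h a b : H) :
    corr L U h a b = corr L U h b a := by
  simp [corr, mul_comm]

lemma corr_add {L : (ℤ → ℝ) → ℝ} (hL : IsMean L) (U : ℤ → H →ₗᵢ[ℝ] H) (h a b c : H) :
    corr L U h a (b + c) = corr L U h a b + corr L U h a c := by
  unfold corr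
  rw [← hL.add ((bdd_inner U h a).mul (bdd_inner U h b)) ((bdd_inner U h a).mul (bdd_inner U h c))]
  congr 1; ext n
  rw [inner_add_left]; ring

lemma corr_smul {L : (ℤ → ℝ) → ℝ} (hL : IsMean L) (U : ℤ → H →ₗᵢ[ℝ] H) (h a b : H) (c : ℝ) :
    corr L U h a (c • b) = c * corr L U h a b := by
  unfold corr
  rw [← hL.smul c ((bdd_inner U h a).mul (bdd_inner U h b))]
  congr 1; ext n
  rw [real_inner_smul_left]; ring

lemma corr_sub {L : (ℤ → ℝ) → ℝ} (hL : IsMean L) (U : ℤ → H →ₗᵢ[ℝ] H) (h a b c : H) :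
    corr L U h a (b - c) = corr L U h a b - corr L U h a c := by
  have h1 := corr_smul hL U h a c (-1)
  rw [sub_eq_add_neg, corr_add hL, ← neg_one_smul ℝ c, h1]; ring

lemma corr_le {L : (ℤ → ℝ) → ℝ} (hL : IsMean L) (U : ℤ → H →ₗᵢ[ℝ] H) (h a b : H) :
    |corr L U h a b| ≤ ‖a‖ * ‖h‖ * (‖b‖ * ‖h‖) := by
  refine hL.abs_le_const fun n => ?_
  rw [abs_mul]
  have h1 := abs_real_inner_le_norm a (U n h)
  have h2 := abs_real_inner_le_norm b (U n h)
  rw [(U n).norm_map] at h1 h2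
  gcongr

lemma corr_self_nonneg {L : (ℤ → ℝ) → ℝ} (hL : IsMean L) (U : ℤ → H →ₗᵢ[ℝ] H) (h a : H) :
    0 ≤ corr L U h a a :=
  hL.nonneg ((bdd_inner U h a).mul (bdd_inner U h a)) fun _ => mul_self_nonneg _

lemma corr_add_self_le {L : (ℤ → ℝ) → ℝ} (hL : IsMean L) (U : ℤ → H →ₗᵢ[ℝ] H) (h a b : H) :
    corr L U h (a + b) (a + b) ≤ 2 * corr L U h a a + 2 * corr L U h b b := by
  have h0 := corr_self_nonneg hL U h (a - b)
  have e1 : corr L U h (a + b) (a + b) = corr L U h a a + 2 * corr L U h a b + corr L U h b b := by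
    rw [corr_add hL, corr_comm L U h (a + b) a, corr_comm L U h (a + b) b, corr_add hL, corr_add hL,
      corr_comm L U h b a]; ring
  have e2 : corr L U h (a - b) (a - b) = corr L U h a a - 2 * corr L U h a b + corr L U h b b := by
    rw [corr_sub hL, corr_comm L U h (a - b) a, corr_comm L U h (a - b) b, corr_sub hL, corr_sub hL,
      corr_comm L U h b a]; ring
  linarith

lemma corr_cs {L : (ℤ → ℝ) → ℝ} (hL : IsMean L) (U : ℤ → H →ₗᵢ[ℝ] H) (h a b : H) :
    corr L U h a b ^ 2 ≤ corr L U h a a * corr L U h b b := by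
  have key : ∀ x : ℝ, 0 ≤ corr L U h b b * (x * x) + (2 * corr L U h a b) * x + corr L U h a a := by
    intro x
    have h0 := corr_self_nonneg hL U h (a + x • b)
    have e1 : corr L U h (a + x • b) (a + x • b) =
        corr L U h b b * (x * x) + (2 * corr L U h a b) * x + corr L U h a a := by
      rw [corr_add hL, corr_comm L U h _ a, corr_comm L U h _ (x • b), corr_add hL, corr_add hL,
        corr_comm L U h (x • b) a, corr_smul hL, corr_smul hL, corr_comm L U h (x • b) b,
        corr_smul hL]; ring
    linarith
  have := discrim_le_zero key
  unfold discrim at this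
  nlinarith

lemma corr_shift {L : (ℤ → ℝ) → ℝ} (hL : IsMean L) (U : ℤ → H →ₗᵢ[ℝ] H)
    (hU : ∀ a b v, U (a + b) v = U a (U b v)) (h a b : H) (s : ℤ) :
    corr L U h (U s a) (U s b) = corr L U h a b := by
  unfold corr
  rw [← hL.shift ((bdd_inner U h (U s a)).mul (bdd_inner U h (U s b))) s]
  congr 1; ext n
  rw [add_comm n s, hU, LinearIsometry.inner_map_map, LinearIsometry.inner_map_map]

/-- trace bound -/
lemma corr_trace {L : (ℤ → ℝ) → ℝ} (hL : IsMean L) (U : ℤ → H →ₗᵢ[ℝ] H) (h : H) {r : ℕ}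
    (e : Fin r → H) (he : Orthonormal ℝ e) : ∑ i, corr L U h (e i) (e i) ≤ ‖h‖ ^ 2 := by
  unfold corr
  rw [← hL.sum _ fun i => (bdd_inner U h (e i)).mul (bdd_inner U h (e i))]
  refine hL.le_const (Bdd.sum _ fun i => (bdd_inner U h (e i)).mul (bdd_inner U h (e i))) fun n => ?_
  have := he.sum_inner_products_le (x := U n h) (s := Finset.univ)
  rw [(U n).norm_map] at this
  simpa [sq] using this

/-- finite-dimensional approximation -/
lemma corr_fin {L : (ℤ → ℝ) → ℝ} (hL : IsMean L) (U : ℤ → H →ₗᵢ[ℝ] H) (h : H) {ε : ℝ} (hε : 0 < ε) :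
    ∃ (r : ℕ) (e : Fin r → H), Orthonormal ℝ e ∧
      ∀ v, (∀ i, inner ℝ (e i) v = 0) → corr L U h v v ≤ ε * ‖v‖ ^ 2 := by
  classical
  let P : ℕ → Prop := fun r => ∃ e : Fin r → H, Orthonormal ℝ e ∧ ∀ i, ε < corr L U h (e i) (e i)
  have hP : ∀ r, P r → r ≤ ⌈‖h‖ ^ 2 / ε⌉₊ := by
    rintro r ⟨e, he, hc⟩
    have h1 := corr_trace hL U h e he
    have h2 : (r : ℝ) * ε ≤ ∑ i, corr L U h (e i) (e i) := by
      have := Finset.sum_le_sum (s := Finset.univ) fun i _ => (hc i).le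
      simpa using this
    have h3 : (r : ℝ) ≤ ‖h‖ ^ 2 / ε := by
      rw [le_div_iff₀ hε]; linarith
    exact_mod_cast h3.trans (Nat.le_ceil _)
  have hP0 : P 0 := ⟨fun i => i.elim0, ⟨fun i => i.elim0, fun i => i.elim0⟩, fun i => i.elim0⟩
  set r := Nat.findGreatest P ⌈‖h‖ ^ 2 / ε⌉₊ with hr
  have hPr : P r := Nat.findGreatest_spec (Nat.zero_le _) hP0
  obtain ⟨e, he, hc⟩ := hPr
  refine ⟨r, e, he, fun v hv => ?_⟩
  by_contra hlt
  push Not at hlt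
  have hv0 : v ≠ 0 := by
    rintro rfl
    have := corr_le hL U h (0 : H) 0
    simp at this
    simp [this] at hlt
  have hvn : 0 < ‖v‖ := norm_pos_iff.2 hv0
  set w := ‖v‖⁻¹ • v with hw
  have hwn : ‖w‖ = 1 := by rw [hw, norm_smul]; simp [hvn.ne']
  have hcw : ε < corr L U h w w := by
    rw [hw, corr_smul hL, corr_comm, corr_smul hL]
    rw [← mul_assoc, ← mul_inv, inv_mul_eq_div, lt_div_iff₀ (by positivity)]
    nlinarith
  have hPs : P (r + 1) := by
    refine ⟨Fin.cons w e, ⟨?_, ?_⟩, ?_⟩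
    · intro i
      refine Fin.cases ?_ (fun i => ?_) i
      · simpa using hwn
      · simpa using he.1 i
    · intro i j hij
      have hiw : ∀ i, inner ℝ (e i) w = 0 := fun i => by rw [hw, real_inner_smul_right, hv i, mul_zero]
      revert hij
      refine Fin.cases ?_ (fun i => ?_) i <;> refine Fin.cases ?_ (fun j => ?_) j
      · intro h; exact absurd rfl h
      · intro _; simp only [Fin.cons_zero, Fin.cons_succ]; rw [real_inner_comm]; exact hiw j
      · intro _; simp only [Fin.cons_zero, Fin.cons_succ]; exact hiw i
      · intro hij; simp only [Fin.cons_succ]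
        exact he.2 (fun h => hij (by rw [h]))
    · intro i
      refine Fin.cases ?_ (fun i => ?_) i
      · simpa using hcw
      · simpa using hc i
  have := Nat.le_findGreatest (hP _ hPs) hPs
  omega

lemma tb_coords (U : ℤ → H →ₗᵢ[ℝ] H) (g : H) {r : ℕ} (e : Fin r → H) :
    TB (fun ε s i => ∀ k, |inner ℝ (e k) (U s g) - inner ℝ (e k) (U i g)| ≤ ε) := by
  have : ∀ t : Finset (Fin r),
      TB (fun ε s i => ∀ k ∈ t, |inner ℝ (e k) (U s g) - inner ℝ (e k) (U i g)| ≤ ε) ∧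
      PM (fun ε s i => ∀ k ∈ t, |inner ℝ (e k) (U s g) - inner ℝ (e k) (U i g)| ≤ ε) := by
    classical
    intro t
    induction t using Finset.induction_on with
    | empty => exact ⟨fun ε hε => ⟨{0}, fun s => ⟨0, by simp, by simp⟩⟩, fun _ _ _ _ _ _ _ => by simp⟩
    | insert a t ha ih =>
      have h1 := TB.of_bdd (bdd_inner U g (e a))
      have h2 := pm_abs (fun n => inner ℝ (e a) (U n g))
      simp only [Finset.forall_mem_insert]
      exact ⟨h1.and ih.1 h2 ih.2, h2.and ih.2⟩
  simpa using (this Finset.univ).1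

lemma tb_corr {L : (ℤ → ℝ) → ℝ} (hL : IsMean L) (U : ℤ → H →ₗᵢ[ℝ] H) (h g : H) :
    TB (fun ε s i => corr L U h (U s g - U i g) (U s g - U i g) ≤ ε) := by
  intro ε hε
  set η := ε / (16 * (‖g‖ ^ 2 + 1)) with hη
  have hη0 : 0 < η := by positivity
  obtain ⟨r, e, he, hv⟩ := corr_fin hL U h hη0
  set δ := min 1 (ε / (4 * ((r + 1) * (‖h‖ ^ 2 + 1)))) with hδ
  have hδ0 : 0 < δ := by positivity
  obtain ⟨F, hF⟩ := tb_coords U g e δ hδ0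
  refine ⟨F, fun s => ?_⟩
  obtain ⟨i, hi, hk⟩ := hF s
  refine ⟨i, hi, ?_⟩
  set v := U s g - U i g with hvdef
  have hvn : ‖v‖ ≤ 2 * ‖g‖ := by
    have := norm_sub_le (U s g) (U i g)
    rw [(U s).norm_map, (U i).norm_map] at this
    linarith
  have hk' : ∀ k, |inner ℝ (e k) v| ≤ δ := by
    intro k
    rw [hvdef, inner_sub_right]; exact hk k
  set p := ∑ k, inner ℝ (e k) v • e k with hp
  have hpin : ∀ k, inner ℝ (e k) p = inner ℝ (e k) v := by
    intro k
    rw [hp]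
    exact he.inner_right_fintype _ k
  have hpn : ‖p‖ ^ 2 ≤ r * δ := by
    have : ‖p‖ ^ 2 = ∑ k, inner ℝ (e k) v ^ 2 := by
      rw [← real_inner_self_eq_norm_sq]
      nth_rewrite 1 [hp]
      rw [sum_inner]
      refine Finset.sum_congr rfl fun k _ => ?_
      rw [real_inner_smul_left, hpin, sq]
    rw [this]
    have : ∀ k ∈ Finset.univ, inner ℝ (e k) v ^ 2 ≤ δ := by
      intro k _
      rw [← sq_abs]
      have h1 := hk' k
      have h2 : δ ≤ 1 := min_le_left _ _
      nlinarith [abs_nonneg (inner ℝ (e k) v)]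
    simpa using Finset.sum_le_sum this
  have hq : ∀ k, inner ℝ (e k) (v - p) = 0 := by
    intro k; rw [inner_sub_right, hpin, sub_self]
  have hqn : ‖v - p‖ ^ 2 ≤ ‖v‖ ^ 2 := by
    have hpv : inner ℝ p (v - p) = 0 := by
      rw [hp, sum_inner]
      refine Finset.sum_eq_zero fun k _ => ?_
      rw [← hp, real_inner_smul_left, hq, mul_zero]
    have : ‖p + (v - p)‖ ^ 2 = ‖p‖ ^ 2 + ‖v - p‖ ^ 2 := by
      rw [norm_add_sq_real, hpv]; ring
    rw [add_sub_cancel] at this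
    nlinarith [sq_nonneg ‖p‖]
  have h1 := corr_add_self_le hL U h p (v - p)
  rw [add_sub_cancel] at h1
  have h2 := hv (v - p) hq
  have h3 := (le_abs_self _).trans (corr_le hL U h p p)
  have h4 : corr L U h p p ≤ ε / 4 := by
    have : ‖p‖ ^ 2 * ‖h‖ ^ 2 ≤ ε / 4 := by
      have h5 : δ ≤ ε / (4 * ((r + 1) * (‖h‖ ^ 2 + 1))) := min_le_right _ _
      rw [le_div_iff₀ (by positivity)] at h5
      calc ‖p‖ ^ 2 * ‖h‖ ^ 2 ≤ (r * δ) * ‖h‖ ^ 2 := by gcongr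
        _ ≤ ((r + 1) * δ) * (‖h‖ ^ 2 + 1) := by gcongr <;> linarith
        _ ≤ ε / 4 := by nlinarith
    nlinarith
  have h5 : corr L U h (v - p) (v - p) ≤ ε / 4 := by
    have e1 : η * (16 * (‖g‖ ^ 2 + 1)) = ε := by rw [hη]; field_simp
    have : ‖v‖ ^ 2 ≤ 4 * ‖g‖ ^ 2 := by nlinarith [norm_nonneg v]
    nlinarith
  linarith

lemma weak_mixing [CompleteSpace H] {L : (ℤ → ℝ) → ℝ} (hL : IsMean L) (U : ℤ → H →ₗᵢ[ℝ] H)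
    (hU : ∀ a b v, U (a + b) v = U a (U b v)) (h0 : ∀ v, U 0 v = v) (h : H)
    (hh : ∀ v, TB (fun ε s i => ‖U s v - U i v‖ ≤ ε) → inner ℝ v h = 0) (g : H) :
    L (fun n => inner ℝ g (U n h) ^ 2) = 0 := by
  have hK : ∀ a : H, ∃ k : H, ∀ b, inner ℝ k b = corr L U h a b := by
    intro a
    let φ : H →ₗ[ℝ] ℝ :=
      { toFun := fun b => corr L U h a b
        map_add' := fun b c => corr_add hL U h a b c
        map_smul' := fun c b => by simpa using corr_smul hL U h a b c }
    let ψ : H →L[ℝ] ℝ := φ.mkContinuous (‖a‖ * ‖h‖ * ‖h‖) (fun b => by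
      have := corr_le hL U h a b
      rw [Real.norm_eq_abs]
      calc |φ b| ≤ _ := this
        _ = _ := by ring)
    refine ⟨(InnerProductSpace.toDual ℝ H).symm ψ, fun b => ?_⟩
    rw [InnerProductSpace.toDual_symm_apply]
    rfl
  choose K hK using hK
  have hadj : ∀ s a b, inner ℝ (U s a) b = inner ℝ a (U (-s) b) := by
    intro s a b
    rw [← (U (-s)).inner_map_map (U s a) b, ← hU, neg_add_cancel, h0]
  have hKd : ∀ a b, ‖K a - K b‖ ^ 2 ≤ ‖h‖ ^ 2 * corr L U h (a - b) (a - b) := by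
    intro a b
    set d := K a - K b with hd
    have h1 : ‖d‖ ^ 2 = corr L U h (a - b) d := by
      rw [← real_inner_self_eq_norm_sq]
      nth_rewrite 1 [hd]
      rw [inner_sub_left, hK, hK, corr_comm L U h (a - b) d, corr_sub hL U h d a b, corr_comm L U h d a, corr_comm L U h d b]
    have h2 := corr_cs hL U h (a - b) d
    rw [← h1] at h2
    have h3 := (le_abs_self _).trans (corr_le hL U h d d)
    have h4 := corr_self_nonneg hL U h (a - b)
    by_cases hz : ‖d‖ = 0
    · rw [hz]; simp; positivity
    · have hp : 0 < ‖d‖ ^ 2 := by positivity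
      have : (‖d‖ ^ 2) ^ 2 ≤ (‖h‖ ^ 2 * corr L U h (a - b) (a - b)) * ‖d‖ ^ 2 := by
        calc (‖d‖ ^ 2) ^ 2 ≤ _ := h2
          _ ≤ corr L U h (a - b) (a - b) * (‖d‖ * ‖h‖ * (‖d‖ * ‖h‖)) := by gcongr
          _ = _ := by ring
      nlinarith
  have hKU : ∀ s a, U s (K a) = K (U s a) := by
    intro s a
    refine ext_inner_right ℝ fun b => ?_
    rw [hadj, hK, hK, ← corr_shift hL U hU h a _ s, ← hU, add_neg_cancel, h0]
  have hKc : TB (fun ε s i => ‖U s (K g) - U i (K g)‖ ≤ ε) := by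
    refine (tb_corr hL U h g).imp fun ε hε => ⟨ε ^ 2 / (‖h‖ ^ 2 + 1), by positivity, fun s i hsi => ?_⟩
    rw [hKU, hKU]
    have h1 := hKd (U s g) (U i g)
    rw [le_div_iff₀ (by positivity)] at hsi
    have h4 := corr_self_nonneg hL U h (U s g - U i g)
    refine abs_le_of_sq_le_sq' ?_ hε.le |>.2
    nlinarith
  have hKU0 : ∀ n, inner ℝ (K g) (U n h) = 0 := by
    intro n
    have : inner ℝ (U (-n) (K g)) h = 0 := by
      apply hh
      refine (hKc.comp (pm_norm _) (fun s => s + (-n))).imp fun ε hε => ⟨ε, hε, fun s i hsi => ?_⟩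
      rwa [← hU, ← hU]
    rw [hadj, neg_neg] at this
    exact this
  have hK0 : K g = 0 := by
    have : inner ℝ (K g) (K g) = 0 := by
      rw [hK]
      unfold corr
      simp only [hKU0, mul_zero]
      exact hL.const 0
    exact inner_self_eq_zero.1 this
  have := hK g g
  rw [hK0, inner_zero_left] at this
  rw [this]
  unfold corr
  simp [sq]

end WM


/-! ### A measure-theoretic model of a mean -/

/-- A model for the mean `M`: a probability space with a shift action on which bounded functions on
the integers are realised multiplicatively. -/
structure Sys (M : (ℤ → ℝ) → ℝ) {X : Type} [MeasurableSpace X] (μ : Measure X)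
    (J : (ℤ → ℝ) → X → ℝ) (σ : ℤ → X → X) : Prop where
  prob : IsProbabilityMeasure μ
  meas : ∀ {f}, Bdd f → Measurable (J f)
  const : ∀ c x, J (fun _ => c) x = c
  add : ∀ {f g}, Bdd f → Bdd g → ∀ x, J (fun z => f z + g z) x = J f x + J g x
  mul : ∀ {f g}, Bdd f → Bdd g → ∀ x, J (fun z => f z * g z) x = J f x * J g x
  mono : ∀ {f g}, Bdd f → Bdd g → (∀ z, f z ≤ g z) → ∀ x, J f x ≤ J g x
  pos : ∀ {f}, Bdd f → ∀ x, J (fun z => max (f z) 0) x = max (J f x) 0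
  int : ∀ {f}, Bdd f → ∫ x, J f x ∂μ = M f
  mp : ∀ k, MeasurePreserving (σ k) μ μ
  σ_zero : ∀ x, σ 0 x = x
  σ_add : ∀ a b x, σ (a + b) x = σ a (σ b x)
  Jσ : ∀ {f}, Bdd f → ∀ k x, J f (σ k x) = J (fun z => f (z + k)) x

namespace UltraModel

noncomputable def J (f : ℤ → ℝ) (p : Ultrafilter ℤ) : ℝ := limUnder (p : Filter ℤ) f

lemma tendsto_J {f : ℤ → ℝ} (hf : Bdd f) (p : Ultrafilter ℤ) :
    Tendsto f (p : Filter ℤ) (𝓝 (J f p)) := by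
  obtain ⟨C, hC⟩ := hf
  apply tendsto_nhds_limUnder
  obtain ⟨x, -, hx⟩ := (isCompact_Icc (a := -C) (b := C)).ultrafilter_le_nhds (p.map f) (by
    rw [le_principal_iff]
    exact Filter.mem_map.2 (Filter.univ_mem' fun z => abs_le.1 (hC z)))
  exact ⟨x, hx⟩

lemma J_eq {f : ℤ → ℝ} {p : Ultrafilter ℤ} {c : ℝ} (h : Tendsto f (p : Filter ℤ) (𝓝 c)) :
    J f p = c := h.limUnder_eq

lemma J_pure (f : ℤ → ℝ) (z : ℤ) : J f (pure z) = f z := by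
  apply J_eq
  rw [Ultrafilter.coe_pure]
  exact tendsto_pure_nhds f z

lemma continuous_J {f : ℤ → ℝ} (hf : Bdd f) : Continuous (J f) := by
  rw [continuous_iff_continuousAt]
  intro p
  rw [ContinuousAt, Metric.tendsto_nhds]
  intro ε hε
  have h1 : ∀ᶠ z in (p : Filter ℤ), dist (f z) (J f p) < ε / 2 :=
    (Metric.tendsto_nhds.1 (tendsto_J hf p)) _ (by positivity)
  have h2 : {q : Ultrafilter ℤ | {z | dist (f z) (J f p) < ε / 2} ∈ q} ∈ 𝓝 p :=
    (ultrafilter_isOpen_basic _).mem_nhds h1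
  filter_upwards [h2] with q hq
  have h3 : Tendsto (fun z => dist (f z) (J f p)) (q : Filter ℤ) (𝓝 (dist (J f q) (J f p))) :=
    (tendsto_J hf q).dist tendsto_const_nhds
  have h4 : dist (J f q) (J f p) ≤ ε / 2 := by
    refine le_of_tendsto h3 ?_
    have h5 : ∀ᶠ z in (q : Filter ℤ), dist (f z) (J f p) < ε / 2 := hq
    exact h5.mono fun z hz => le_of_lt hz
  linarith

/-- the shift homeomorphism -/
noncomputable def S (k : ℤ) (p : Ultrafilter ℤ) : Ultrafilter ℤ := p.map (fun z => z + k)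

lemma S_zero (p : Ultrafilter ℤ) : S 0 p = p := by
  simp [S]

lemma S_add (a b : ℤ) (p : Ultrafilter ℤ) : S (a + b) p = S a (S b p) := by
  simp only [S, Ultrafilter.map_map]
  congr 1
  ext z
  simp; ring

lemma continuous_S (k : ℤ) : Continuous (S k) := by
  rw [ultrafilterBasis_is_basis.continuous_iff]
  rintro _ ⟨s, rfl⟩
  exact ultrafilter_isOpen_basic ((fun z => z + k) ⁻¹' s)

noncomputable def Sh (k : ℤ) : Ultrafilter ℤ ≃ₜ Ultrafilter ℤ where
  toFun := S k
  invFun := S (-k)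
  left_inv p := by rw [← S_add]; simp [S_zero]
  right_inv p := by rw [← S_add]; simp [S_zero]
  continuous_toFun := continuous_S k
  continuous_invFun := continuous_S (-k)

lemma J_S {f : ℤ → ℝ} (hf : Bdd f) (k : ℤ) (p : Ultrafilter ℤ) :
    J f (S k p) = J (fun z => f (z + k)) p := by
  symm
  apply J_eq
  exact (tendsto_J hf (S k p)).comp tendsto_map

open scoped CompactlySupported in
lemma bdd_pure (F : C_c(Ultrafilter ℤ, ℝ)) : Bdd (fun z => F (pure z)) := by
  obtain ⟨C, hC⟩ := isCompact_univ.exists_bound_of_continuousOn (f := F) F.continuous.continuousOn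
  exact ⟨C, fun z => hC _ trivial⟩

open scoped CompactlySupported in
noncomputable def lam {M : (ℤ → ℝ) → ℝ} (hM : IsMean M) : C_c(Ultrafilter ℤ, ℝ) →ₚ[ℝ] ℝ :=
  PositiveLinearMap.mk₀
    { toFun := fun F => M (fun z => F (pure z))
      map_add' := fun F G => hM.add (bdd_pure F) (bdd_pure G)
      map_smul' := fun c F => hM.smul c (bdd_pure F) }
    (fun F hF => hM.nonneg (bdd_pure F) (fun _ => hF _))

local instance instMS : MeasurableSpace (Ultrafilter ℤ) := borel _
local instance instBS : BorelSpace (Ultrafilter ℤ) := ⟨rfl⟩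

open scoped CompactlySupported in
lemma sys {M : (ℤ → ℝ) → ℝ} (hM : IsMean M) : Sys M (RealRMK.rieszMeasure (lam hM)) J S := by
  have hintJ : ∀ {f}, Bdd f → ∫ x, J f x ∂(RealRMK.rieszMeasure (lam hM)) = M f := by
    intro f hf
    have := RealRMK.integral_rieszMeasure (lam hM)
      ⟨⟨J f, continuous_J hf⟩, HasCompactSupport.of_compactSpace _⟩
    refine (Eq.trans ?_ this).trans ?_
    · rfl
    · show M (fun z => J f (pure z)) = M f
      simp [J_pure]
  have hprob : IsProbabilityMeasure (RealRMK.rieszMeasure (lam hM)) := by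
    have h1 := hintJ (Bdd.const 1)
    rw [hM.one] at h1
    have h2 : ∀ x, J (fun _ => (1:ℝ)) x = 1 := fun x => J_eq tendsto_const_nhds
    simp only [h2] at h1
    simp at h1
    constructor
    rwa [measureReal_def, ENNReal.toReal_eq_one_iff] at h1
  refine ⟨hprob, fun hf => (continuous_J hf).measurable, fun c x => J_eq tendsto_const_nhds,
    fun hf hg x => J_eq ((tendsto_J hf x).add (tendsto_J hg x)),
    fun hf hg x => J_eq ((tendsto_J hf x).mul (tendsto_J hg x)),
    fun hf hg h x => le_of_tendsto_of_tendsto' (tendsto_J hf x) (tendsto_J hg x) h,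
    fun hf x => J_eq ((tendsto_J hf x).max tendsto_const_nhds), hintJ, fun k => ?_, S_zero, S_add,
    fun hf k x => J_S hf k x⟩
  refine ⟨(continuous_S k).measurable, ?_⟩
  have : (Measure.map (S k) (RealRMK.rieszMeasure (lam hM))).Regular :=
    Measure.Regular.map (Sh k)
  apply Measure.ext_of_integral_eq_on_compactlySupported
  intro F
  have hFm : AEStronglyMeasurable (fun x => F x)
      (Measure.map (S k) (RealRMK.rieszMeasure (lam hM))) :=
    (map_continuous F).measurable.aestronglyMeasurable
  rw [integral_map (continuous_S k).measurable.aemeasurable hFm, RealRMK.integral_rieszMeasure]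
  have := RealRMK.integral_rieszMeasure (lam hM)
      ⟨⟨fun x => F (S k x), F.continuous.comp (continuous_S k)⟩, HasCompactSupport.of_compactSpace _⟩
  refine (Eq.trans ?_ this).trans ?_
  · rfl
  · show M (fun z => F (S k (pure z))) = M (fun z => F (pure z))
    simp only [S, Ultrafilter.map_pure]
    exact hM.shift (bdd_pure F) k

end UltraModel

lemma exists_sys {M : (ℤ → ℝ) → ℝ} (hM : IsMean M) :
    ∃ (X : Type) (_ : MeasurableSpace X) (μ : Measure X) (J : (ℤ → ℝ) → X → ℝ) (σ : ℤ → X → X),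
      Sys M μ J σ :=
  ⟨_, _, _, _, _, UltraModel.sys hM⟩


/-! ### Existence of the mean -/

lemma exists_windows {D : ℕ → ℕ → ℝ} (hD0 : ∀ M N, 0 ≤ D M N)
    (hA : 0 < limsup (fun N : ℕ => ⨆ M : ℕ, D M N) atTop) :
    ∃ d > 0, ∀ i : ℕ, ∃ N ≥ i + 1, ∃ M, d < D M N := by
  refine ⟨_, half_pos hA, fun i => ?_⟩
  have h1 := frequently_lt_of_lt_limsup (f := atTop) (u := fun N : ℕ => ⨆ M : ℕ, D M N)
    (b := limsup (fun N : ℕ => ⨆ M : ℕ, D M N) atTop / 2) (by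
      apply Filter.isCoboundedUnder_le_of_le atTop (x := 0)
      intro N
      exact Real.iSup_nonneg fun M => hD0 M N) (half_lt_self hA)
  obtain ⟨N, hN, h2⟩ := (frequently_atTop.1 h1) (i + 1)
  obtain ⟨M, hM⟩ := exists_lt_of_lt_ciSup h2
  exact ⟨N, hN, M, hM⟩

/-- window averages -/
noncomputable def wavg (M N : ℕ → ℕ) (f : ℤ → ℝ) (i : ℕ) : ℝ :=
  (N i : ℝ)⁻¹ * ∑ j ∈ Finset.range (N i), f ((M i : ℤ) + j)

lemma wavg_abs_le (M N : ℕ → ℕ) {f : ℤ → ℝ} {C : ℝ} (hC : ∀ z, |f z| ≤ C) (hN : ∀ i, 0 < N i)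
    (i : ℕ) : |wavg M N f i| ≤ C := by
  unfold wavg
  rw [abs_mul, abs_inv, Nat.abs_cast]
  have hp : (0 : ℝ) < N i := by exact_mod_cast hN i
  rw [inv_mul_le_iff₀ hp]
  calc _ ≤ ∑ j ∈ Finset.range (N i), |f ((M i : ℤ) + j)| := Finset.abs_sum_le_sum_abs _ _
    _ ≤ ∑ j ∈ Finset.range (N i), C := Finset.sum_le_sum fun j _ => hC _
    _ = _ := by simp

/-- the limit mean -/
noncomputable def wmean (M N : ℕ → ℕ) (f : ℤ → ℝ) : ℝ :=
  limUnder (hyperfilter ℕ : Filter ℕ) (wavg M N f)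

lemma tendsto_wmean (M N : ℕ → ℕ) {f : ℤ → ℝ} (hf : Bdd f) (hN : ∀ i, 0 < N i) :
    Tendsto (wavg M N f) (hyperfilter ℕ : Filter ℕ) (𝓝 (wmean M N f)) := by
  obtain ⟨C, hC⟩ := hf
  apply tendsto_nhds_limUnder
  obtain ⟨x, -, hx⟩ := (isCompact_Icc (a := -C) (b := C)).ultrafilter_le_nhds
    ((hyperfilter ℕ).map (wavg M N f)) (by
    rw [le_principal_iff]
    exact Filter.mem_map.2 (Filter.univ_mem' fun i => abs_le.1 (wavg_abs_le M N hC hN i)))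
  exact ⟨x, hx⟩

lemma wmean_eq (M N : ℕ → ℕ) {f : ℤ → ℝ} {c : ℝ}
    (h : Tendsto (wavg M N f) (hyperfilter ℕ : Filter ℕ) (𝓝 c)) : wmean M N f = c := h.limUnder_eq

lemma isMean_wmean (M N : ℕ → ℕ) (hN : ∀ i, i + 1 ≤ N i) : IsMean (wmean M N) := by
  have hN0 : ∀ i, 0 < N i := fun i => by have := hN i; omega
  have hp : ∀ i, (0 : ℝ) < N i := fun i => by exact_mod_cast hN0 i
  have hle : (hyperfilter ℕ : Filter ℕ) ≤ atTop := by
    rw [← Nat.cofinite_eq_atTop]; exact hyperfilter_le_cofinite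
  have hinv : Tendsto (fun i => (N i : ℝ)⁻¹) atTop (𝓝 0) := by
    apply tendsto_inv_atTop_zero.comp
    apply tendsto_natCast_atTop_atTop.comp
    exact tendsto_atTop_mono (fun i => (Nat.le_succ i).trans (hN i)) tendsto_id
  have hsh : ∀ {f}, Bdd f → wmean M N (fun z => f (z + 1)) = wmean M N f := by
    intro f hf
    obtain ⟨C, hC⟩ := hf
    have h1 : ∀ i, wavg M N (fun z => f (z + 1)) i =
        wavg M N f i + (N i : ℝ)⁻¹ * (f ((M i : ℤ) + N i) - f (M i)) := by
      intro i
      unfold wavg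
      have := Finset.sum_range_sub (fun j : ℕ => f ((M i : ℤ) + j)) (N i)
      rw [Finset.sum_sub_distrib] at this
      simp only [Nat.cast_zero, add_zero, Nat.cast_add, Nat.cast_one, ← add_assoc] at this
      rw [← this]; ring
    apply wmean_eq
    rw [show wmean M N f = wmean M N f + 0 by ring]
    simp only [funext h1]
    refine (tendsto_wmean M N ⟨C, hC⟩ hN0).add ?_
    refine (hinv.zero_mul_isBoundedUnder_le (isBoundedUnder_of ⟨C + C, fun i => ?_⟩)).mono_left hle
    simp only [Function.comp, Real.norm_eq_abs]
    exact (abs_sub _ _).trans (add_le_add (hC _) (hC _))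
  refine ⟨?_, ?_, ?_, ?_, ?_, ?_⟩
  · intro f g hf hg
    apply wmean_eq
    refine ((tendsto_wmean M N hf hN0).add (tendsto_wmean M N hg hN0)).congr fun i => ?_
    simp [wavg, Finset.sum_add_distrib, mul_add]
  · intro c f hf
    apply wmean_eq
    refine ((tendsto_wmean M N hf hN0).const_mul c).congr fun i => ?_
    simp [wavg, ← Finset.mul_sum]; ring
  · intro f g hf hg h
    refine le_of_tendsto_of_tendsto' (tendsto_wmean M N hf hN0) (tendsto_wmean M N hg hN0) fun i => ?_
    unfold wavg
    gcongr
    exact h _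
  · apply wmean_eq
    refine tendsto_const_nhds.congr fun i => ?_
    have := (hp i).ne'
    simp [wavg]; field_simp
  · intro f hf s
    induction s using Int.induction_on with
    | zero => simp
    | succ n ih =>
      rw [← ih, ← hsh (hf.comp (fun z => z + (n:ℤ)))]
      congr 1; ext z; congr 1; ring
    | pred n ih =>
      rw [← ih, ← hsh (hf.comp (fun z => z + (-(n:ℤ) - 1)))]
      congr 1; ext z; congr 1; ring
  · intro f hf hv
    obtain ⟨C, hC⟩ := hf
    have hC0 : 0 ≤ C := (abs_nonneg _).trans (hC 0)
    apply wmean_eq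
    refine Tendsto.mono_left ?_ hle
    rw [Metric.tendsto_nhds]
    intro ε hε
    obtain ⟨Z, hZ⟩ := eventually_atTop.1 ((Metric.tendsto_nhds.1 hv) (ε / 2) (by positivity))
    have h2 : Tendsto (fun i => (N i : ℝ)⁻¹ * (C * Z.toNat)) atTop (𝓝 0) := by
      simpa using hinv.mul_const (C * (Z.toNat : ℝ))
    filter_upwards [(Metric.tendsto_nhds.1 h2) (ε / 2) (by positivity)] with i hi
    simp only [dist_zero_right, Real.norm_eq_abs] at hi hZ ⊢
    have h3 : ∀ j ∈ Finset.range (N i), |f ((M i : ℤ) + j)| ≤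
        ε / 2 + (if j < Z.toNat then C else 0) := by
      intro j _
      split_ifs with hj
      · have := hC ((M i : ℤ) + j); linarith
      · have := hZ ((M i : ℤ) + j) (by omega); linarith
    have h4 : ∑ j ∈ Finset.range (N i), (if j < Z.toNat then C else 0) ≤ C * Z.toNat := by
      rw [← Finset.sum_filter, Finset.sum_const, nsmul_eq_mul, mul_comm]
      gcongr
      calc _ ≤ (Finset.range Z.toNat).card := Finset.card_le_card (by
            intro j hj; simp at hj ⊢; omega)
        _ = _ := by simp
    have h5 : |wavg M N f i| ≤ (N i : ℝ)⁻¹ * ((N i) * (ε / 2) + C * Z.toNat) := by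
      unfold wavg
      rw [abs_mul, abs_inv, Nat.abs_cast]
      gcongr
      calc _ ≤ ∑ j ∈ Finset.range (N i), |f ((M i : ℤ) + j)| := Finset.abs_sum_le_sum_abs _ _
        _ ≤ _ := Finset.sum_le_sum h3
        _ ≤ _ := by rw [Finset.sum_add_distrib]; simp only [Finset.sum_const, Finset.card_range,
                      nsmul_eq_mul]; linarith
    have h6 := lt_of_abs_lt hi
    have h7 : (N i : ℝ)⁻¹ * ((N i) * (ε / 2) + C * Z.toNat) = ε / 2 + (N i : ℝ)⁻¹ * (C * Z.toNat) := by
      have := (hp i).ne'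
      field_simp
    linarith

open scoped Classical in
lemma exists_mean (A : Set ℕ) (hA : 0 < limsup
    (fun N : ℕ => ⨆ M : ℕ, (((Finset.Ico M (M + N)).filter (· ∈ A)).card : ℝ) / N) atTop) :
    ∃ M : (ℤ → ℝ) → ℝ, IsMean M ∧
      0 < M (fun z => if 0 ≤ z ∧ z.toNat ∈ A then 1 else 0) := by
  obtain ⟨d, hd, h⟩ := exists_windows
    (D := fun M N => (((Finset.Ico M (M + N)).filter (· ∈ A)).card : ℝ) / N)
    (fun M N => by positivity) hA
  choose N hN M hM using h
  refine ⟨wmean M N, isMean_wmean M N hN, hd.trans_le ?_⟩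
  have hN0 : ∀ i, 0 < N i := fun i => by have := hN i; omega
  refine ge_of_tendsto' (tendsto_wmean M N (Bdd.of_le (C := 1) (fun z => by split_ifs <;> simp)
    (fun z => by split_ifs <;> simp)) hN0) fun i => ?_
  refine (hM i).le.trans (le_of_eq ?_)
  unfold wavg
  rw [div_eq_inv_mul]
  congr 1
  rw [Finset.card_filter, Finset.sum_Ico_eq_sum_range]
  push_cast
  simp only [add_tsub_cancel_left]
  refine Finset.sum_congr rfl fun j _ => ?_
  have : ((M i : ℤ) + j).toNat = M i + j := by omega
  rw [this]
  have : (0:ℤ) ≤ (M i : ℤ) + j := by omega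
  simp [this]

/-- extension along multiples of `ℓ` -/
noncomputable def io (ℓ : ℕ) (a : ℤ → ℝ) (x : ℤ) : ℝ := if (ℓ : ℤ) ∣ x then a (x / ℓ) else 0

lemma io_mul {ℓ : ℕ} (hℓ : 0 < ℓ) (a : ℤ → ℝ) (n : ℤ) : io ℓ a (ℓ * n) = a n := by
  simp [io, hℓ.ne']

lemma io_of_not {ℓ : ℕ} (a : ℤ → ℝ) {x : ℤ} (h : ¬ (ℓ : ℤ) ∣ x) : io ℓ a x = 0 := by
  simp [io, h]

lemma io_add_mul {ℓ : ℕ} (hℓ : 0 < ℓ) (a : ℤ → ℝ) (x s : ℤ) :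
    io ℓ a (x + ℓ * s) = io ℓ (fun z => a (z + s)) x := by
  by_cases h : (ℓ : ℤ) ∣ x
  · obtain ⟨n, rfl⟩ := h
    rw [← mul_add, io_mul hℓ, io_mul hℓ]
  · rw [io_of_not _ h, io_of_not]
    rwa [dvd_add_left (dvd_mul_right _ _)]

lemma Bdd.io {ℓ : ℕ} {a : ℤ → ℝ} (ha : Bdd a) : Bdd (io ℓ a) := by
  obtain ⟨C, hC⟩ := ha
  refine ⟨C, fun z => ?_⟩
  unfold _root_.io
  split_ifs
  · exact hC _
  · simpa using (abs_nonneg _).trans (hC 0)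

lemma io_nonneg {ℓ : ℕ} {a : ℤ → ℝ} (ha : ∀ z, 0 ≤ a z) (z) : 0 ≤ io ℓ a z := by
  unfold io
  split_ifs
  · exact ha _
  · exact le_rfl

lemma io_pm {ℓ : ℕ} (hℓ : 0 < ℓ) {a : ℤ → ℝ} (ha : AP a) : AP (io ℓ a) := by
  classical
  intro ε hε
  obtain ⟨F, hF⟩ := ha ε hε
  refine ⟨(F ×ˢ Finset.range ℓ).image (fun p => ℓ * p.1 + p.2), fun s => ?_⟩
  obtain ⟨i, hi, h⟩ := hF (s / ℓ)
  have hl : (0:ℤ) < ℓ := by exact_mod_cast hℓ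
  have h1 : 0 ≤ s % ℓ := Int.emod_nonneg _ hl.ne'
  have h2 : s % ℓ < ℓ := Int.emod_lt_of_pos _ hl
  refine ⟨ℓ * i + (s % ℓ).toNat, ?_, fun z => ?_⟩
  · refine Finset.mem_image.2 ⟨(i, (s % ℓ).toNat), ?_, rfl⟩
    simp [hi]; omega
  · rw [Int.toNat_of_nonneg h1]
    have e1 : z + s = (z + s % ℓ) + ℓ * (s / ℓ) := by
      have := Int.emod_add_mul_ediv s ℓ; linarith
    have e2 : z + (ℓ * i + s % ℓ) = (z + s % ℓ) + ℓ * i := by ring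
    rw [e1, e2, io_add_mul hℓ, io_add_mul hℓ]
    unfold io
    split_ifs
    · exact h _
    · simpa using hε.le

lemma mean_dvd {M : (ℤ → ℝ) → ℝ} (hM : IsMean M) {ℓ : ℕ} (hℓ : 0 < ℓ) :
    ℓ * M (io ℓ (fun _ => 1)) = 1 := by
  have hl : (0:ℤ) < ℓ := by exact_mod_cast hℓ
  have hb : Bdd (io ℓ (fun _ => 1)) := (Bdd.const 1).io
  have h1 : M (fun z => ∑ r ∈ Finset.range ℓ, io ℓ (fun _ => 1) (z + (-(r:ℤ)))) = 1 := by
    refine Eq.trans ?_ hM.one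
    congr 1; ext z
    have h1 : 0 ≤ z % ℓ := Int.emod_nonneg _ hl.ne'
    have h2 : z % ℓ < ℓ := Int.emod_lt_of_pos _ hl
    rw [Finset.sum_eq_single (z % ℓ).toNat]
    · have : (ℓ : ℤ) ∣ z + -((z % ℓ).toNat : ℤ) := by
        rw [Int.toNat_of_nonneg h1]; exact Int.dvd_self_sub_emod
      rw [io, if_pos this]
    · intro r hr hne
      apply io_of_not
      intro hd
      have h3 : z % ℓ = r := by
        have h4 : (r : ℤ) ≡ z [ZMOD ℓ] := (Int.modEq_iff_dvd.2 (by simpa [sub_eq_add_neg] using hd))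
        rw [← h4.eq]
        exact Int.emod_eq_of_lt (by omega) (by simp at hr; omega)
      omega
    · intro h; simp at h; omega
  rw [hM.sum _ fun r => hb.comp _] at h1
  rw [Finset.sum_congr rfl fun (r : ℕ) _ => hM.shift hb (-(r:ℤ))] at h1
  simpa using h1

/-- the induced mean on multiples of `ℓ` -/
noncomputable def lamMean (M : (ℤ → ℝ) → ℝ) (ℓ : ℕ) (h : ℤ → ℝ) : ℝ := ℓ * M (io ℓ h)

lemma isMean_lamMean {M : (ℤ → ℝ) → ℝ} (hM : IsMean M) {ℓ : ℕ} (hℓ : 0 < ℓ) :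
    IsMean (lamMean M ℓ) := by
  have hl : (0:ℤ) < ℓ := by exact_mod_cast hℓ
  refine ⟨?_, ?_, ?_, mean_dvd hM hℓ, ?_, ?_⟩
  · intro f g hf hg
    unfold lamMean
    rw [← mul_add, ← hM.add hf.io hg.io]
    congr 2; ext z; unfold io; split_ifs <;> simp
  · intro c f hf
    unfold lamMean
    rw [mul_left_comm, ← hM.smul c hf.io]
    congr 2; ext z; unfold io; split_ifs <;> simp
  · intro f g hf hg h
    unfold lamMean
    gcongr
    refine hM.mono hf.io hg.io fun z => ?_
    unfold io; split_ifs
    · exact h _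
    · rfl
  · intro f hf s
    unfold lamMean
    rw [← hM.shift hf.io (ℓ * s)]
    congr 2; ext z; rw [io_add_mul hℓ]
  · intro f hf hv
    unfold lamMean
    rw [hM.vanish hf.io, mul_zero]
    rw [Metric.tendsto_nhds] at hv ⊢
    intro ε hε
    obtain ⟨Z, hZ⟩ := eventually_atTop.1 (hv ε hε)
    filter_upwards [eventually_ge_atTop (ℓ * Z)] with x hx
    unfold io; split_ifs
    · apply hZ
      rw [Int.le_ediv_iff_mul_le hl]; linarith
    · simpa using hε

lemma exists_residue {M : (ℤ → ℝ) → ℝ} (hM : IsMean M) {ℓ : ℕ} (hℓ : 0 < ℓ) {f : ℤ → ℝ}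
    (hf : Bdd f) (h : 0 < M f) :
    ∃ r : ℕ, 0 < M (fun z => f (z + r) * io ℓ (fun _ => 1) z) := by
  by_contra hcon
  push Not at hcon
  have hl : (0:ℤ) < ℓ := by exact_mod_cast hℓ
  have hb : Bdd (io ℓ (fun _ => 1)) := (Bdd.const 1).io
  have h1 : M (fun z => ∑ r ∈ Finset.range ℓ, f z * io ℓ (fun _ => 1) (z + (-(r:ℤ)))) = M f := by
    congr 1; ext z
    have h1 : 0 ≤ z % ℓ := Int.emod_nonneg _ hl.ne'
    have h2 : z % ℓ < ℓ := Int.emod_lt_of_pos _ hl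
    rw [Finset.sum_eq_single (z % ℓ).toNat]
    · have : (ℓ : ℤ) ∣ z + -((z % ℓ).toNat : ℤ) := by
        rw [Int.toNat_of_nonneg h1]; exact Int.dvd_self_sub_emod
      rw [io, if_pos this, mul_one]
    · intro r hr hne
      rw [io_of_not, mul_zero]
      intro hd
      have h3 : z % ℓ = r := by
        have h4 : (r : ℤ) ≡ z [ZMOD ℓ] := (Int.modEq_iff_dvd.2 (by simpa [sub_eq_add_neg] using hd))
        rw [← h4.eq]
        exact Int.emod_eq_of_lt (by omega) (by simp at hr; omega)
      omega
    · intro h; simp at h; omega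
  rw [hM.sum _ fun r => hf.mul (hb.comp _)] at h1
  have h2 : ∑ r ∈ Finset.range ℓ, M (fun z => f z * io ℓ (fun _ => 1) (z + (-(r:ℤ)))) ≤ 0 := by
    refine Finset.sum_nonpos fun r _ => ?_
    refine le_of_eq_of_le ?_ (hcon r)
    rw [← hM.shift (hf.mul (hb.comp _)) r]
    congr 1; ext z; simp
  linarith


/-! ### Bounded measurable functions and `L²` -/

section BMsec
variable {X : Type} [MeasurableSpace X]

/-- bounded measurable functions -/
def BM (g : X → ℝ) : Prop := Measurable g ∧ ∃ C : ℝ, ∀ x, |g x| ≤ C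

lemma BM.const (c : ℝ) : BM (fun _ : X => c) := ⟨measurable_const, |c|, fun _ => le_rfl⟩

lemma BM.add {f g : X → ℝ} (hf : BM f) (hg : BM g) : BM (fun x => f x + g x) := by
  obtain ⟨hf, C, hC⟩ := hf
  obtain ⟨hg, D, hD⟩ := hg
  exact ⟨hf.add hg, C + D, fun z => (abs_add_le _ _).trans (add_le_add (hC z) (hD z))⟩

lemma BM.mul {f g : X → ℝ} (hf : BM f) (hg : BM g) : BM (fun x => f x * g x) := by
  obtain ⟨hf, C, hC⟩ := hf
  obtain ⟨hg, D, hD⟩ := hg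
  refine ⟨hf.mul hg, C * D, fun z => ?_⟩
  rw [abs_mul]
  exact mul_le_mul (hC z) (hD z) (abs_nonneg _) ((abs_nonneg _).trans (hC z))

lemma BM.sub {f g : X → ℝ} (hf : BM f) (hg : BM g) : BM (fun x => f x - g x) := by
  simpa [sub_eq_add_neg] using hf.add ((BM.const (-1)).mul hg)

lemma BM.abs {f : X → ℝ} (hf : BM f) : BM (fun x => |f x|) := by
  obtain ⟨hf, C, hC⟩ := hf
  exact ⟨hf.abs, C, fun z => by rw [abs_abs]; exact hC z⟩

lemma BM.comp {f : X → ℝ} (hf : BM f) {s : X → X} (hs : Measurable s) : BM (fun x => f (s x)) := by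
  obtain ⟨hf, C, hC⟩ := hf
  exact ⟨hf.comp hs, C, fun z => hC _⟩

lemma BM.sum {ι : Type*} (s : Finset ι) {f : ι → X → ℝ} (hf : ∀ i, BM (f i)) :
    BM (fun x => ∑ i ∈ s, f i x) := by
  classical
  induction s using Finset.induction_on with
  | empty => simpa using BM.const 0
  | insert a s ha ih => simpa [Finset.sum_insert ha] using (hf a).add ih

lemma BM.of_le {f : X → ℝ} {C : ℝ} (hf : Measurable f) (h0 : ∀ x, 0 ≤ f x) (h1 : ∀ x, f x ≤ C) :
    BM f := ⟨hf, C, fun x => by rw [abs_of_nonneg (h0 x)]; exact h1 x⟩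

lemma BM.indicator {s : Set X} (hs : MeasurableSet s) : BM (s.indicator (fun _ => (1 : ℝ))) := by
  refine BM.of_le (C := 1) (measurable_const.indicator hs) (fun x => ?_) (fun x => ?_) <;>
  by_cases h : x ∈ s <;> simp [h]

variable {μ : Measure X}

lemma BM.memLp [IsFiniteMeasure μ] {f : X → ℝ} (hf : BM f) {p : ENNReal} : MemLp f p μ := by
  obtain ⟨hf, C, hC⟩ := hf
  exact MemLp.of_bound hf.aestronglyMeasurable C (ae_of_all _ hC)

lemma BM.int [IsFiniteMeasure μ] {f : X → ℝ} (hf : BM f) : Integrable f μ :=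
  memLp_one_iff_integrable.1 hf.memLp

open scoped Classical in
/-- the class in `L²` -/
noncomputable def tl (μ : Measure X) (f : X → ℝ) : Lp ℝ 2 μ :=
  if h : MemLp f 2 μ then h.toLp f else 0

lemma tl_eq [IsFiniteMeasure μ] {f : X → ℝ} (hf : BM f) : tl μ f = (hf.memLp (p := 2)).toLp f := by
  simp [tl, hf.memLp]

lemma tl_coe [IsFiniteMeasure μ] {f : X → ℝ} (hf : BM f) : tl μ f =ᵐ[μ] f := by
  rw [tl_eq hf]
  exact MemLp.coeFn_toLp _

lemma tl_congr [IsFiniteMeasure μ] {f : X → ℝ} (hf : BM f) {v : Lp ℝ 2 μ} (h : f =ᵐ[μ] v) :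
    tl μ f = v := by
  apply Lp.ext
  exact (tl_coe hf).trans h

lemma inner_right_tl [IsFiniteMeasure μ] {f : X → ℝ} (hf : BM f) (v : Lp ℝ 2 μ) :
    inner ℝ v (tl μ f) = ∫ x, v x * f x ∂μ := by
  rw [L2.inner_def]
  apply integral_congr_ae
  filter_upwards [tl_coe hf] with x hx
  rw [hx]; simp [mul_comm]

lemma inner_tl [IsFiniteMeasure μ] {f g : X → ℝ} (hf : BM f) (hg : BM g) :
    inner ℝ (tl μ f) (tl μ g) = ∫ x, f x * g x ∂μ := by
  rw [inner_right_tl hg]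
  apply integral_congr_ae
  filter_upwards [tl_coe hf] with x hx
  rw [hx]

lemma norm_sq_tl [IsFiniteMeasure μ] {f : X → ℝ} (hf : BM f) :
    ‖tl μ f‖ ^ 2 = ∫ x, f x ^ 2 ∂μ := by
  rw [← real_inner_self_eq_norm_sq, inner_tl hf hf]
  simp [sq]

lemma tl_sub [IsFiniteMeasure μ] {f g : X → ℝ} (hf : BM f) (hg : BM g) :
    tl μ (fun x => f x - g x) = tl μ f - tl μ g := by
  apply tl_congr (hf.sub hg)
  filter_upwards [tl_coe (μ := μ) hf, tl_coe (μ := μ) hg, Lp.coeFn_sub (tl μ f) (tl μ g)]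
    with x h1 h2 h3
  rw [h3, Pi.sub_apply, h1, h2]

lemma tl_add [IsFiniteMeasure μ] {f g : X → ℝ} (hf : BM f) (hg : BM g) :
    tl μ (fun x => f x + g x) = tl μ f + tl μ g := by
  apply tl_congr (hf.add hg)
  filter_upwards [tl_coe (μ := μ) hf, tl_coe (μ := μ) hg, Lp.coeFn_add (tl μ f) (tl μ g)]
    with x h1 h2 h3
  rw [h3, Pi.add_apply, h1, h2]

lemma tl_smul [IsFiniteMeasure μ] {f : X → ℝ} (c : ℝ) (hf : BM f) :
    tl μ (fun x => c * f x) = c • tl μ f := by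
  apply tl_congr ((BM.const c).mul hf)
  filter_upwards [tl_coe (μ := μ) hf, Lp.coeFn_smul c (tl μ f)]
    with x h1 h3
  rw [h3, Pi.smul_apply, h1, smul_eq_mul]

lemma BM.pos {f : X → ℝ} (hf : BM f) : BM (fun x => max (f x) 0) := by
  obtain ⟨hf, C, hC⟩ := hf
  refine ⟨hf.max measurable_const, C, fun x => ?_⟩
  have := abs_max_sub_max_le_abs (f x) 0 0
  simp at this
  exact (hC x).trans' this

lemma tl_pos [IsFiniteMeasure μ] {f : X → ℝ} (hf : BM f) :
    tl μ (fun x => max (f x) 0) = tl μ f ⊔ 0 := by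
  apply tl_congr hf.pos
  filter_upwards [tl_coe (μ := μ) hf, Lp.coeFn_sup (tl μ f) 0, Lp.coeFn_zero ℝ 2 μ]
    with x h1 h2 h3
  rw [h2, Pi.sup_apply, h1, h3]; rfl

lemma int_abs_le_norm [IsProbabilityMeasure μ] {f : X → ℝ} (hf : BM f) :
    ∫ x, |f x| ∂μ ≤ ‖tl μ f‖ := by
  have h1 := real_inner_le_norm (tl μ (fun x => |f x|)) (tl μ (fun _ => (1:ℝ)))
  rw [inner_tl hf.abs (BM.const 1)] at h1
  have h2 : ‖tl μ (fun _ => (1:ℝ))‖ = 1 := by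
    have := norm_sq_tl (μ := μ) (BM.const (X := X) 1)
    simp at this
    rcases this with h | h
    · exact h
    · have := norm_nonneg (tl μ (fun _ => (1:ℝ))); linarith
  have h3 : ‖tl μ (fun x => |f x|)‖ = ‖tl μ f‖ := by
    have e1 := norm_sq_tl (μ := μ) hf.abs
    have e2 := norm_sq_tl (μ := μ) hf
    simp only [sq_abs] at e1
    rw [← e2] at e1
    exact (sq_eq_sq₀ (norm_nonneg _) (norm_nonneg _)).1 e1
  rw [h2, h3] at h1
  simpa using h1

lemma inner_sup_zero (a : Lp ℝ 2 μ) : inner ℝ (a ⊔ 0) a = ‖a ⊔ 0‖ ^ 2 := by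
  rw [← real_inner_self_eq_norm_sq, L2.inner_def, L2.inner_def]
  apply integral_congr_ae
  filter_upwards [Lp.coeFn_sup a 0, Lp.coeFn_zero ℝ 2 μ] with x h2 h3
  rw [h2, Pi.sup_apply, h3]
  simp
  rcases le_total (a x) 0 with h | h <;> simp [h, sq]

lemma inner_nonneg_of {a b : Lp ℝ 2 μ} (ha : 0 ≤ a) (hb : 0 ≤ b) : 0 ≤ inner ℝ a b := by
  rw [L2.inner_def]
  apply integral_nonneg_of_ae
  rw [← Lp.coeFn_nonneg] at ha hb
  filter_upwards [ha, hb] with x h1 h2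
  simp at h1 h2 ⊢
  positivity

lemma lattice_projection [IsProbabilityMeasure μ] (V : Submodule ℝ (Lp ℝ 2 μ))
    (hcl : IsClosed (V : Set (Lp ℝ 2 μ))) (hsup : ∀ v ∈ V, v ⊔ 0 ∈ V)
    (hone : tl μ (fun _ => (1:ℝ)) ∈ V) {g : X → ℝ} (hg : BM g) (hg0 : ∀ x, 0 ≤ g x)
    (hg1 : ∀ x, g x ≤ 1) :
    ∃ u : X → ℝ, Measurable u ∧ (∀ x, 0 ≤ u x) ∧ (∀ x, u x ≤ 1) ∧ tl μ u ∈ V ∧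
      (∀ w ∈ V, inner ℝ w (tl μ g - tl μ u) = 0) ∧ ∀ᵐ x ∂μ, u x ≤ 0 → g x = 0 := by
  have : CompleteSpace V := hcl.completeSpace_coe
  obtain ⟨v, hv, hvo⟩ := Submodule.HasOrthogonalProjection.exists_orthogonal (K := V) (tl μ g)
  have ho : ∀ w ∈ V, inner ℝ w (tl μ g - v) = 0 := fun w hw => (Submodule.mem_orthogonal _ _).1 hvo w hw
  have hgl0 : 0 ≤ tl μ g := by
    rw [← Lp.coeFn_nonneg]
    filter_upwards [tl_coe (μ := μ) hg] with x hx
    rw [hx]; exact hg0 x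
  have hgl1 : 0 ≤ tl μ (fun _ => (1:ℝ)) - tl μ g := by
    rw [← tl_sub (BM.const 1) hg, ← Lp.coeFn_nonneg]
    filter_upwards [tl_coe (μ := μ) ((BM.const 1).sub hg)] with x hx
    rw [hx]; simpa using hg1 x
  have hv0 : 0 ≤ v := by
    have h1 := ho _ (hsup _ (V.neg_mem hv))
    have h2 := inner_sup_zero (-v)
    rw [inner_sub_right] at h1
    rw [inner_neg_right] at h2
    have h3 := inner_nonneg_of (le_sup_right : (0 : Lp ℝ 2 μ) ≤ (-v) ⊔ 0) hgl0
    have h4 : ‖(-v) ⊔ 0‖ = 0 := by nlinarith [norm_nonneg ((-v) ⊔ 0)]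
    have h5 : (-v) ⊔ 0 = 0 := norm_eq_zero.1 h4
    have h6 : -v ≤ 0 := sup_eq_right.1 h5
    exact neg_nonpos.1 h6
  have hv1 : v - tl μ (fun _ => (1:ℝ)) ≤ 0 := by
    set a := v - tl μ (fun _ => (1:ℝ)) with ha
    have h1 := ho _ (hsup _ (V.sub_mem hv hone))
    have h2 := inner_sup_zero a
    rw [show tl μ g - v = -(tl μ (fun _ => (1:ℝ)) - tl μ g) - a by rw [ha]; abel,
      inner_sub_right, inner_neg_right, ← ha] at h1
    have h3 := inner_nonneg_of (le_sup_right : (0 : Lp ℝ 2 μ) ≤ a ⊔ 0) hgl1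
    have h4 : ‖a ⊔ 0‖ = 0 := by nlinarith [norm_nonneg (a ⊔ 0)]
    exact sup_eq_right.1 (norm_eq_zero.1 h4)
  set u : X → ℝ := fun x => max 0 (min 1 (v x)) with hu
  have hum : Measurable u :=
    measurable_const.max (measurable_const.min (Lp.stronglyMeasurable v).measurable)
  have hu0 : ∀ x, 0 ≤ u x := fun x => le_max_left _ _
  have hu1 : ∀ x, u x ≤ 1 := fun x => max_le zero_le_one (min_le_left _ _)
  have huB : BM u := BM.of_le hum hu0 hu1
  have huv : tl μ u = v := by
    apply tl_congr huB
    rw [← Lp.coeFn_nonneg] at hv0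
    rw [← Lp.coeFn_le] at hv1
    filter_upwards [hv0, hv1, Lp.coeFn_sub v (tl μ (fun _ => (1:ℝ))), Lp.coeFn_zero ℝ 2 μ,
      tl_coe (μ := μ) (BM.const 1)] with x h1 h2 h3 h4 h5
    rw [h3, h4, Pi.sub_apply, h5] at h2
    simp at h1 h2
    simp [hu, h1, h2]
  refine ⟨u, hum, hu0, hu1, huv ▸ hv, by rwa [huv], ?_⟩
  have hms : MeasurableSet {x | u x ≤ 0} := measurableSet_le hum measurable_const
  set G : X → ℝ := fun x => {x | u x ≤ 0}.indicator (fun _ => (1:ℝ)) x * g x with hG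
  have hGB : BM G := (BM.indicator hms).mul hg
  have hG0 : ∀ x, 0 ≤ G x := fun x => mul_nonneg (Set.indicator_nonneg (fun _ _ => zero_le_one) _) (hg0 x)
  have key : ∀ n : ℕ, (∫ x, G x ∂μ) ≤ 1 / ((n : ℝ) + 1) := by
    intro n
    have hwB : BM (fun x => 1 - ((n:ℝ) + 1) * u x) := (BM.const 1).sub ((BM.const _).mul huB)
    have hw : tl μ (fun x => max (1 - ((n:ℝ) + 1) * u x) 0) ∈ V := by
      rw [tl_pos hwB, tl_sub (BM.const 1) ((BM.const _).mul huB), tl_smul _ huB, huv]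
      exact hsup _ (V.sub_mem hone (V.smul_mem _ hv))
    have h1 := ho _ hw
    rw [← huv, inner_sub_right, inner_tl hwB.pos hg, inner_tl hwB.pos huB, sub_eq_zero] at h1
    have h2 : ∫ x, max (1 - ((n:ℝ) + 1) * u x) 0 * u x ∂μ ≤ ∫ x, (1 / ((n:ℝ) + 1)) ∂μ := by
      refine integral_mono (hwB.pos.mul huB).int (BM.const _).int fun x => ?_
      have hp : (0:ℝ) < n + 1 := by positivity
      show max (1 - ((n:ℝ) + 1) * u x) 0 * u x ≤ 1 / ((n:ℝ) + 1)
      rw [le_div_iff₀ hp]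
      rcases le_total (1 - ((n:ℝ) + 1) * u x) 0 with h | h
      · rw [max_eq_right h]; simp
      · rw [max_eq_left h]
        nlinarith [mul_nonneg hp.le (hu0 x)]
    have h3 : ∫ x, G x ∂μ ≤ ∫ x, max (1 - ((n:ℝ) + 1) * u x) 0 * g x ∂μ := by
      refine integral_mono hGB.int (hwB.pos.mul hg).int fun x => ?_
      show G x ≤ max (1 - ((n:ℝ) + 1) * u x) 0 * g x
      simp only [hG]
      by_cases hx : u x ≤ 0
      · have : u x = 0 := le_antisymm hx (hu0 x)
        simp [this]
      · have : x ∉ {x | u x ≤ 0} := hx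
        simp only [this, not_false_eq_true, Set.indicator_of_notMem, zero_mul]
        exact mul_nonneg (le_max_right _ _) (hg0 x)
    rw [h1] at h3
    simpa using h3.trans h2
  have hz : ∫ x, G x ∂μ = 0 := by
    refine le_antisymm ?_ (integral_nonneg hG0)
    exact ge_of_tendsto' tendsto_one_div_add_atTop_nhds_zero_nat key
  rw [integral_eq_zero_iff_of_nonneg hG0 hGB.int] at hz
  filter_upwards [hz] with x hx hux
  have : x ∈ {x | u x ≤ 0} := hux
  simpa [hG, this] using hx

end BMsec


/-! ### The unitary action, and the three lattice subspaces -/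

section Usec
variable {X : Type} [MeasurableSpace X] {μ : Measure X} {M : (ℤ → ℝ) → ℝ}
  {J : (ℤ → ℝ) → X → ℝ} {σ : ℤ → X → X}

/-- the Koopman operators of the `m`-th power of the shift -/
noncomputable def Sys.U (hS : Sys M μ J σ) (m : ℕ) (n : ℤ) : Lp ℝ 2 μ →ₗᵢ[ℝ] Lp ℝ 2 μ :=
  Lp.compMeasurePreservingₗᵢ ℝ (σ (m * n)) (hS.mp _)

lemma Sys.U_coe (hS : Sys M μ J σ) (m : ℕ) (n : ℤ) (v : Lp ℝ 2 μ) :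
    hS.U m n v =ᵐ[μ] fun x => v (σ (m * n) x) :=
  Lp.coeFn_compMeasurePreserving v (hS.mp _)

lemma Sys.ae_comp (hS : Sys M μ J σ) (k : ℤ) {p : X → Prop} (h : ∀ᵐ x ∂μ, p x) :
    ∀ᵐ x ∂μ, p (σ k x) := (hS.mp k).quasiMeasurePreserving.ae h

lemma Sys.U_tl (hS : Sys M μ J σ) (m : ℕ) (n : ℤ) {f : X → ℝ} (hf : BM f) :
    hS.U m n (tl μ f) = tl μ (fun x => f (σ (m * n) x)) := by
  have := hS.prob
  symm
  apply tl_congr (hf.comp (hS.mp _).measurable)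
  filter_upwards [hS.U_coe m n (tl μ f), hS.ae_comp (m * n) (tl_coe (μ := μ) hf)] with x h1 h2
  rw [h1, h2]

lemma Sys.U_add (hS : Sys M μ J σ) (m : ℕ) (a b : ℤ) (v : Lp ℝ 2 μ) :
    hS.U m (a + b) v = hS.U m a (hS.U m b v) := by
  apply Lp.ext
  filter_upwards [hS.U_coe m (a + b) v, hS.U_coe m a (hS.U m b v),
    hS.ae_comp (m * a) (hS.U_coe m b v)] with x h1 h2 h3
  rw [h1, h2, h3, ← hS.σ_add]
  congr 2; ring

lemma Sys.U_zero (hS : Sys M μ J σ) (m : ℕ) (v : Lp ℝ 2 μ) : hS.U m 0 v = v := by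
  apply Lp.ext
  filter_upwards [hS.U_coe m 0 v] with x h1
  rw [h1, mul_zero, hS.σ_zero]

lemma Sys.U_sup (hS : Sys M μ J σ) (m : ℕ) (a : ℤ) (v : Lp ℝ 2 μ) :
    hS.U m a (v ⊔ 0) = hS.U m a v ⊔ 0 := by
  apply Lp.ext
  filter_upwards [hS.U_coe m a v, hS.U_coe m a (v ⊔ 0), Lp.coeFn_sup (hS.U m a v) 0,
    hS.ae_comp (m * a) (Lp.coeFn_sup v 0), hS.ae_comp (m * a) (Lp.coeFn_zero ℝ 2 μ),
    (Lp.coeFn_zero ℝ 2 μ)] with x h1 h2 h3 h4 h5 h6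
  rw [h2, h4, h3, Pi.sup_apply, Pi.sup_apply, h1, h5, h6]; rfl

lemma Sys.U_one (hS : Sys M μ J σ) (m : ℕ) (a : ℤ) :
    hS.U m a (tl μ (fun _ => (1:ℝ))) = tl μ (fun _ => (1:ℝ)) := hS.U_tl m a (BM.const 1)

/-- compact vectors -/
noncomputable def Sys.Hc (hS : Sys M μ J σ) (m : ℕ) : Submodule ℝ (Lp ℝ 2 μ) where
  carrier := {v | TB (fun ε s i => ‖hS.U m s v - hS.U m i v‖ ≤ ε)}
  zero_mem' := fun ε hε => ⟨{0}, fun s => ⟨0, by simp, by simpa using hε.le⟩⟩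
  add_mem' := by
    intro v w hv hw
    refine (TB.and hv hw (pm_norm _) (pm_norm _)).imp fun ε hε => ⟨ε / 2, by positivity, ?_⟩
    rintro s i ⟨h1, h2⟩
    rw [map_add, map_add, add_sub_add_comm]
    exact (norm_add_le _ _).trans (by linarith)
  smul_mem' := by
    intro c v hv
    refine TB.imp hv fun ε hε => ⟨ε / (|c| + 1), by positivity, fun s i h => ?_⟩
    rw [map_smul, map_smul, ← smul_sub, norm_smul, Real.norm_eq_abs]
    rw [le_div_iff₀ (by positivity)] at h
    nlinarith [norm_nonneg (hS.U m s v - hS.U m i v)]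

lemma Sys.mem_Hc (hS : Sys M μ J σ) (m : ℕ) (v : Lp ℝ 2 μ) :
    v ∈ hS.Hc m ↔ TB (fun ε s i => ‖hS.U m s v - hS.U m i v‖ ≤ ε) := Iff.rfl

lemma Sys.isClosed_Hc (hS : Sys M μ J σ) (m : ℕ) : IsClosed (hS.Hc m : Set (Lp ℝ 2 μ)) := by
  apply isClosed_of_closure_subset
  intro v hv
  rw [SetLike.mem_coe, hS.mem_Hc]
  intro ε hε
  obtain ⟨w, hw, hvw⟩ := Metric.mem_closure_iff.1 hv (ε / 3) (by positivity)
  obtain ⟨F, hF⟩ := (hS.mem_Hc m w).1 hw (ε / 3) (by positivity)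
  refine ⟨F, fun s => ?_⟩
  obtain ⟨i, hi, h⟩ := hF s
  refine ⟨i, hi, ?_⟩
  rw [dist_eq_norm] at hvw
  have h1 : ‖hS.U m s v - hS.U m s w‖ < ε / 3 := by rw [← map_sub, LinearIsometry.norm_map]; exact hvw
  have h2 : ‖hS.U m i v - hS.U m i w‖ < ε / 3 := by rw [← map_sub, LinearIsometry.norm_map]; exact hvw
  have e : hS.U m s v - hS.U m i v = (hS.U m s v - hS.U m s w) + (hS.U m s w - hS.U m i w) -
      (hS.U m i v - hS.U m i w) := by abel
  rw [e]
  have h3 := norm_sub_le ((hS.U m s v - hS.U m s w) + (hS.U m s w - hS.U m i w))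
    (hS.U m i v - hS.U m i w)
  have h4 := norm_add_le (hS.U m s v - hS.U m s w) (hS.U m s w - hS.U m i w)
  linarith

lemma Sys.exists_f (hS : Sys M μ J σ) (m : ℕ) {e : X → ℝ} (he : BM e) (he0 : ∀ x, 0 ≤ e x)
    (he1 : ∀ x, e x ≤ 1) : ∃ f : X → ℝ, Measurable f ∧ (∀ x, 0 ≤ f x) ∧ (∀ x, f x ≤ 1) ∧
      tl μ f ∈ hS.Hc m ∧ (∀ w ∈ hS.Hc m, inner ℝ w (tl μ e - tl μ f) = 0) := by
  have := hS.prob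
  obtain ⟨f, h1, h2, h3, h4, h5, -⟩ := lattice_projection (hS.Hc m) (hS.isClosed_Hc m) (by
      intro v hv
      refine TB.imp hv fun ε hε => ⟨ε, hε, fun s i h => ?_⟩
      rw [hS.U_sup, hS.U_sup]
      exact (norm_sup_sub_sup_le_norm _ _ _).trans h) (by
      rw [hS.mem_Hc]
      intro ε hε
      exact ⟨{0}, fun s => ⟨0, by simp, by beta_reduce; rw [hS.U_one, hS.U_one]; simpa using hε.le⟩⟩) he he0 he1
  exact ⟨f, h1, h2, h3, h4, h5⟩

lemma Sys.U_inv (hS : Sys M μ J σ) (m : ℕ) {v : Lp ℝ 2 μ} (h : hS.U m (-1) v = v) (n : ℤ) :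
    hS.U m n v = v := by
  have h1 : hS.U m 1 v = v := by
    conv_lhs => rw [← h]
    rw [← hS.U_add]; simp [hS.U_zero]
  induction n using Int.induction_on with
  | zero => exact hS.U_zero m v
  | succ n ih => rw [hS.U_add, h1, ih]
  | pred n ih => rw [sub_eq_add_neg, hS.U_add, h, ih]

lemma Sys.exists_fbar (hS : Sys M μ J σ) (m : ℕ) {e f : X → ℝ} (he : BM e) (he0 : ∀ x, 0 ≤ e x)
    (he1 : ∀ x, e x ≤ 1) (hf : BM f)
    (hef : ∀ w ∈ hS.Hc m, inner ℝ w (tl μ e - tl μ f) = 0) :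
    ∃ g : X → ℝ, Measurable g ∧ (∀ x, 0 ≤ g x) ∧ (∀ x, g x ≤ 1) ∧
      (∀ n : ℤ, ∀ᵐ x ∂μ, g (σ (m * n) x) = g x) ∧
      (∀ ε > 0, ∃ N : ℕ, 0 < N ∧ ∫ x, |(N:ℝ)⁻¹ * ∑ s ∈ Finset.range N, f (σ (m * (-(s + 1))) x) - g x| ∂μ ≤ ε) ∧
      ∀ᵐ x ∂μ, g x ≤ 0 → e x = 0 := by
  have := hS.prob
  set T : Lp ℝ 2 μ →L[ℝ] Lp ℝ 2 μ := (hS.U m (-1)).toContinuousLinearMap with hT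
  set V : Submodule ℝ (Lp ℝ 2 μ) := T.eqLocus (1 : Lp ℝ 2 μ →L[ℝ] Lp ℝ 2 μ) with hV
  have hmem : ∀ v, v ∈ V ↔ hS.U m (-1) v = v := fun v => Iff.rfl
  have hcl : IsClosed (V : Set (Lp ℝ 2 μ)) := by
    have : (V : Set (Lp ℝ 2 μ)) = {v | T v = v} := rfl
    rw [this]
    exact isClosed_eq T.continuous continuous_id
  obtain ⟨g, h1, h2, h3, h4, h5, h6⟩ := lattice_projection V hcl (by
      intro v hv
      rw [hmem] at hv ⊢
      rw [hS.U_sup, hv]) ((hmem _).2 (hS.U_one m _)) he he0 he1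
  have hgB : BM g := BM.of_le h1 h2 h3
  refine ⟨g, h1, h2, h3, fun n => ?_, ?_, h6⟩
  · have := hS.U_inv m ((hmem _).1 h4) n
    rw [hS.U_tl _ _ hgB] at this
    have h7 := tl_coe (μ := μ) (hgB.comp (hS.mp (m * n)).measurable)
    rw [this] at h7
    filter_upwards [h7, tl_coe (μ := μ) hgB] with x h8 h9
    rw [← h8, h9]
  · have hT1 : ‖T‖ ≤ 1 := LinearIsometry.norm_toContinuousLinearMap_le _
    have hlim := T.tendsto_birkhoffAverage_orthogonalProjection hT1 (hS.U m (-1) (tl μ f))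
    have hP : V.starProjection (hS.U m (-1) (tl μ f)) = tl μ g := by
      apply Submodule.eq_starProjection_of_mem_orthogonal h4
      rw [Submodule.mem_orthogonal]
      intro w hw
      have hw' := (hmem w).1 hw
      have e1 : inner ℝ w (hS.U m (-1) (tl μ f)) = inner ℝ w (tl μ f) := by
        conv_lhs => rw [← hw']
        exact (hS.U m (-1)).inner_map_map _ _
      have e2 := hef w (by
        rw [hS.mem_Hc]
        intro ε hε
        exact ⟨{0}, fun s => ⟨0, by simp, by beta_reduce; rw [hS.U_inv m hw', hS.U_inv m hw']; simpa using hε.le⟩⟩)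
      have e3 := h5 w hw
      rw [inner_sub_right] at e2 e3 ⊢
      linarith
    have hP' : ((V.orthogonalProjectionOnto (hS.U m (-1) (tl μ f)) : V) : Lp ℝ 2 μ) = tl μ g := hP
    rw [hP'] at hlim
    intro ε hε
    obtain ⟨N, hN, hN0⟩ := ((Metric.tendsto_nhds.1 hlim ε hε).and (eventually_gt_atTop 0)).exists
    refine ⟨N, hN0, ?_⟩
    have hsB : BM (fun x => (N:ℝ)⁻¹ * ∑ s ∈ Finset.range N, f (σ (m * (-(s + 1))) x)) :=
      (BM.const _).mul (BM.sum _ fun s => hf.comp (hS.mp _).measurable)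
    refine (int_abs_le_norm (hsB.sub hgB)).trans ?_
    rw [tl_sub hsB hgB, tl_smul _ (BM.sum _ fun s => hf.comp (hS.mp _).measurable)]
    rw [dist_eq_norm] at hN
    refine le_trans (le_of_eq ?_) hN.le
    congr 2
    rw [birkhoffAverage, birkhoffSum]
    congr 1
    have it : ∀ k : ℕ, T^[k] (hS.U m (-1) (tl μ f)) = tl μ (fun x => f (σ (m * (-(k + 1))) x)) := by
      intro k
      rw [← hS.U_tl m _ hf]
      induction k with
      | zero => simp
      | succ k ih =>
        rw [Function.iterate_succ_apply', ih]
        show hS.U m (-1) _ = _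
        rw [← hS.U_add]
        congr 1; push_cast; ring
    simp only [id, it]
    clear hN
    have tsum : ∀ s : Finset ℕ, tl μ (fun x => ∑ k ∈ s, f (σ (m * (-((k:ℤ) + 1))) x)) =
        ∑ k ∈ s, tl μ (fun x => f (σ (m * (-((k:ℤ) + 1))) x)) := by
      intro s
      induction s using Finset.induction_on with
      | empty =>
        simp only [Finset.sum_empty]
        apply tl_congr (BM.const 0)
        exact (Lp.coeFn_zero ℝ 2 μ).symm
      | insert a s ha ih =>
        rw [Finset.sum_insert ha, ← ih, ← tl_add (hf.comp (hS.mp _).measurable)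
          (BM.sum _ fun s => hf.comp (hS.mp _).measurable)]
        simp only [Finset.sum_insert ha]
    exact tsum _

lemma Sys.BM_J (hS : Sys M μ J σ) {w : ℤ → ℝ} (hw : Bdd w) : BM (J w) := by
  refine ⟨hS.meas hw, ?_⟩
  obtain ⟨C, hC⟩ := hw
  refine ⟨C, fun x => abs_le.2 ⟨?_, ?_⟩⟩
  · have := hS.mono (Bdd.const (-C)) ⟨C, hC⟩ (fun z => (abs_le.1 (hC z)).1) x
    rwa [hS.const] at this
  · have := hS.mono ⟨C, hC⟩ (Bdd.const C) (fun z => (abs_le.1 (hC z)).2) x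
    rwa [hS.const] at this

/-- classes of almost periodic functions -/
noncomputable def Sys.Al (hS : Sys M μ J σ) : Submodule ℝ (Lp ℝ 2 μ) where
  carrier := {v | ∃ w, AP w ∧ v = tl μ (J w)}
  zero_mem' := by
    have := hS.prob
    refine ⟨fun _ => 0, AP.const 0, ?_⟩
    symm
    apply tl_congr (hS.BM_J (Bdd.const 0))
    filter_upwards [Lp.coeFn_zero ℝ 2 μ] with x hx
    rw [hx, hS.const]; rfl
  add_mem' := by
    have := hS.prob
    rintro _ _ ⟨v, hv, rfl⟩ ⟨w, hw, rfl⟩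
    refine ⟨_, hv.add hw, ?_⟩
    rw [← tl_add (hS.BM_J hv.bdd) (hS.BM_J hw.bdd)]
    congr 1; ext x; rw [hS.add hv.bdd hw.bdd]
  smul_mem' := by
    have := hS.prob
    rintro c _ ⟨v, hv, rfl⟩
    refine ⟨_, hv.smul c, ?_⟩
    rw [← tl_smul c (hS.BM_J hv.bdd)]
    congr 1; ext x; rw [hS.mul (Bdd.const c) hv.bdd, hS.const]

lemma Sys.exists_u (hS : Sys M μ J σ) {g : X → ℝ} (hg : BM g) (hg0 : ∀ x, 0 ≤ g x)
    (hg1 : ∀ x, g x ≤ 1) : ∃ u : X → ℝ, Measurable u ∧ (∀ x, 0 ≤ u x) ∧ (∀ x, u x ≤ 1) ∧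
      (∀ ε > 0, ∃ w, AP w ∧ ∫ x, |J w x - u x| ∂μ ≤ ε) ∧
      (∀ w, AP w → ∫ x, J w x * g x ∂μ = ∫ x, J w x * u x ∂μ) ∧ ∀ᵐ x ∂μ, u x ≤ 0 → g x = 0 := by
  have := hS.prob
  have hsub : ∀ w, AP w → tl μ (J w) ∈ hS.Al.topologicalClosure := fun w hw =>
    hS.Al.le_topologicalClosure ⟨w, hw, rfl⟩
  obtain ⟨u, h1, h2, h3, h4, h5, h6⟩ := lattice_projection hS.Al.topologicalClosure
    (Submodule.isClosed_topologicalClosure _) (by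
      intro v hv
      have hc : Continuous (fun v : Lp ℝ 2 μ => v ⊔ 0) := (lipschitzWith_sup_right 0).continuous
      rw [← SetLike.mem_coe, Submodule.topologicalClosure_coe] at hv ⊢
      refine map_mem_closure (f := fun v : Lp ℝ 2 μ => v ⊔ 0) hc hv ?_
      rintro _ ⟨w, hw, rfl⟩
      refine ⟨_, hw.posPart, ?_⟩
      simp only
      rw [← tl_pos (hS.BM_J hw.bdd)]
      congr 1; ext x; rw [hS.pos hw.bdd]) (by
      have := hsub _ (AP.const 1)
      have e : J (fun _ => (1:ℝ)) = fun _ => (1:ℝ) := funext fun x => hS.const 1 x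
      rwa [e] at this) hg hg0 hg1
  have huB : BM u := BM.of_le h1 h2 h3
  refine ⟨u, h1, h2, h3, fun ε hε => ?_, fun w hw => ?_, h6⟩
  · rw [← SetLike.mem_coe, Submodule.topologicalClosure_coe] at h4
    obtain ⟨_, ⟨w, hw, rfl⟩, hd⟩ := Metric.mem_closure_iff.1 h4 ε hε
    refine ⟨w, hw, (int_abs_le_norm ((hS.BM_J hw.bdd).sub huB)).trans ?_⟩
    rw [tl_sub (hS.BM_J hw.bdd) huB, norm_sub_rev, ← dist_eq_norm]
    exact hd.le
  · have := h5 _ (hsub w hw)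
    rw [inner_sub_right, inner_tl (hS.BM_J hw.bdd) hg, inner_tl (hS.BM_J hw.bdd) huB] at this
    linarith

end Usec


/-! ### Averages along the system -/

section Avg
variable {X : Type} [MeasurableSpace X] {μ : Measure X} {M : (ℤ → ℝ) → ℝ}
  {J : (ℤ → ℝ) → X → ℝ} {σ : ℤ → X → X}

lemma Sys.smul (hS : Sys M μ J σ) (c : ℝ) {f : ℤ → ℝ} (hf : Bdd f) (x : X) :
    J (fun z => c * f z) x = c * J f x := by
  rw [hS.mul (Bdd.const c) hf, hS.const]

lemma Sys.sub (hS : Sys M μ J σ) {f g : ℤ → ℝ} (hf : Bdd f) (hg : Bdd g) (x : X) :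
    J (fun z => f z - g z) x = J f x - J g x := by
  have h := hS.add hf (hg.const_mul (-1)) x
  rw [hS.smul _ hg] at h
  have e : (fun z => f z - g z) = fun z => f z + -1 * g z := by ext z; ring
  rw [e, h]; ring

lemma Sys.sum (hS : Sys M μ J σ) {ι : Type*} (s : Finset ι) {f : ι → ℤ → ℝ} (hf : ∀ i, Bdd (f i))
    (x : X) : J (fun z => ∑ i ∈ s, f i z) x = ∑ i ∈ s, J (f i) x := by
  classical
  induction s using Finset.induction_on with
  | empty => simpa using hS.const 0 x
  | insert a s ha ih =>
    simp only [Finset.sum_insert ha]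
    rw [hS.add (hf a) (Bdd.sum s hf), ih]

lemma Sys.prod (hS : Sys M μ J σ) {ι : Type*} (s : Finset ι) {f : ι → ℤ → ℝ} (hf : ∀ i, Bdd (f i))
    (x : X) : Bdd (fun z => ∏ i ∈ s, f i z) ∧
      J (fun z => ∏ i ∈ s, f i z) x = ∏ i ∈ s, J (f i) x := by
  classical
  induction s using Finset.induction_on with
  | empty => exact ⟨by simpa using Bdd.const 1, by simpa using hS.const 1 x⟩
  | insert a s ha ih =>
    simp only [Finset.prod_insert ha]
    exact ⟨(hf a).mul ih.1, by rw [hS.mul (hf a) ih.1, ih.2]⟩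

lemma Sys.nonneg (hS : Sys M μ J σ) {f : ℤ → ℝ} (hf : Bdd f) (h : ∀ z, 0 ≤ f z) (x : X) :
    0 ≤ J f x := by
  have := hS.mono (Bdd.const 0) hf h x
  rwa [hS.const] at this

lemma Sys.le_const (hS : Sys M μ J σ) {f : ℤ → ℝ} (hf : Bdd f) {c : ℝ} (h : ∀ z, f z ≤ c) (x : X) :
    J f x ≤ c := by
  have := hS.mono hf (Bdd.const c) h x
  rwa [hS.const] at this

lemma Sys.abs_le (hS : Sys M μ J σ) {f g : ℤ → ℝ} (hf : Bdd f) (hg : Bdd g)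
    (h : ∀ z, |f z| ≤ g z) (x : X) : |J f x| ≤ J g x := by
  rw [abs_le']
  refine ⟨hS.mono hf hg (fun z => (le_abs_self _).trans (h z)) x, ?_⟩
  have h1 := hS.mono (hf.const_mul (-1)) hg (fun z => by
    have := (neg_le_abs (f z)).trans (h z); linarith) x
  rw [hS.smul _ hf] at h1
  linarith

lemma Sys.abs_le_const (hS : Sys M μ J σ) {f : ℤ → ℝ} {c : ℝ}
    (h : ∀ z, |f z| ≤ c) (x : X) : |J f x| ≤ c := by
  have := hS.abs_le ⟨c, h⟩ (Bdd.const c) h x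
  rwa [hS.const] at this

lemma Sys.int_comp (hS : Sys M μ J σ) (k : ℤ) {g : X → ℝ} (hg : BM g) :
    ∫ x, g (σ k x) ∂μ = ∫ x, g x ∂μ := by
  conv_rhs => rw [← (hS.mp k).map_eq]
  rw [integral_map (hS.mp k).measurable.aemeasurable hg.1.aestronglyMeasurable]

lemma int_abs_le_const [IsProbabilityMeasure μ] {f : X → ℝ} {C : ℝ} (h : ∀ x, |f x| ≤ C) :
    |∫ x, f x ∂μ| ≤ C := by
  have := norm_integral_le_of_norm_le_const (μ := μ) (f := f) (C := C)
    (ae_of_all _ fun x => by rw [Real.norm_eq_abs]; exact h x)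
  simpa using this

lemma int_abs_le [IsProbabilityMeasure μ] {f g : X → ℝ} (hg : BM g) (h : ∀ x, |f x| ≤ g x) :
    |∫ x, f x ∂μ| ≤ ∫ x, g x ∂μ := by
  rw [← Real.norm_eq_abs]
  exact norm_integral_le_of_norm_le hg.int
    (ae_of_all _ fun x => by rw [Real.norm_eq_abs]; exact h x)

lemma int_mono [IsProbabilityMeasure μ] {f g : X → ℝ} (hf : BM f) (hg : BM g)
    (h : ∀ x, f x ≤ g x) : ∫ x, f x ∂μ ≤ ∫ x, g x ∂μ := integral_mono hf.int hg.int h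

/-- `J` of a translated kernel supported on multiples of `ℓ` -/
noncomputable def kn (J : (ℤ → ℝ) → X → ℝ) (ℓ : ℕ) (K : ℤ → ℝ) (n : ℤ) : X → ℝ := J (io ℓ (fun z => K (z - n)))

lemma bdd_kn {ℓ : ℕ} {K : ℤ → ℝ} (hK : Bdd K) (n : ℤ) : Bdd (io ℓ (fun z => K (z - n))) :=
  Bdd.io (hK.comp _)

lemma Sys.kn_BM (hS : Sys M μ J σ) {ℓ : ℕ} {K : ℤ → ℝ} (hK : Bdd K) (n : ℤ) : BM (kn J ℓ K n) :=
  hS.BM_J (bdd_kn hK n)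

lemma io_abs_le {ℓ : ℕ} {a : ℤ → ℝ} {C : ℝ} (hC : ∀ z, |a z| ≤ C) (z) : |io ℓ a z| ≤ C := by
  unfold io
  split_ifs
  · exact hC _
  · simpa using (abs_nonneg _).trans (hC 0)

lemma io_sub {ℓ : ℕ} (a b : ℤ → ℝ) (z) : io ℓ (fun y => a y - b y) z = io ℓ a z - io ℓ b z := by
  unfold io
  split_ifs <;> simp

lemma io_smul {ℓ : ℕ} (c : ℝ) (b : ℤ → ℝ) (z) : io ℓ (fun y => c * b y) z = c * io ℓ b z := by
  unfold io
  split_ifs <;> simp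

lemma Sys.kn_bdd (hS : Sys M μ J σ) {ℓ : ℕ} {K : ℤ → ℝ} (hK : Bdd K) :
    ∃ C, 0 ≤ C ∧ ∀ n x, |kn J ℓ K n x| ≤ C := by
  obtain ⟨C, hC⟩ := hK
  exact ⟨C, (abs_nonneg _).trans (hC 0), fun n x => hS.abs_le_const (io_abs_le fun z => hC _) x⟩

lemma Sys.kn_nonneg (hS : Sys M μ J σ) {ℓ : ℕ} {K : ℤ → ℝ} (hK : Bdd K) (h0 : ∀ z, 0 ≤ K z) (n : ℤ)
    (x : X) : 0 ≤ kn J ℓ K n x :=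
  hS.nonneg (bdd_kn hK n) (io_nonneg fun z => h0 _) x

lemma Sys.kn_comp (hS : Sys M μ J σ) {ℓ : ℕ} (hℓ : 0 < ℓ) {K : ℤ → ℝ} (hK : Bdd K) (n s : ℤ) (x : X) :
    kn J ℓ K n (σ (-(ℓ * s)) x) = kn J ℓ K (n + s) x := by
  unfold kn
  rw [hS.Jσ (bdd_kn hK n)]
  congr 1; ext z
  have := io_add_mul hℓ (fun z => K (z - n)) z (-s)
  rw [mul_neg] at this
  rw [this]
  congr 1; ext y; congr 1; ring

lemma Sys.int_kn (hS : Sys M μ J σ) (hM : IsMean M) {ℓ : ℕ} (hℓ : 0 < ℓ) {K : ℤ → ℝ} (hK : Bdd K)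
    (n : ℤ) : ℓ * ∫ x, kn J ℓ K n x ∂μ = lamMean M ℓ K := by
  unfold kn
  rw [hS.int (bdd_kn hK n)]
  exact (isMean_lamMean hM hℓ).shift hK (-n)

lemma Sys.avg_int (hS : Sys M μ J σ) {g : X → ℝ} (hg : BM g) {k : ℕ → ℤ → ℝ} (hk : ∀ j, Bdd (k j))
    (N : ℕ) : (N : ℝ)⁻¹ * ∑ j ∈ Finset.range N, ∫ x, g x * J (k j) x ∂μ =
      ∫ x, g x * J (fun z => (N:ℝ)⁻¹ * ∑ j ∈ Finset.range N, k j z) x ∂μ := by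
  have := hS.prob
  rw [← integral_finsetSum _ fun j _ => (hg.mul (hS.BM_J (hk j))).int, ← integral_const_mul]
  congr 1; ext x
  rw [hS.smul _ (Bdd.sum _ hk), hS.sum _ hk, ← Finset.mul_sum]; ring

lemma bdd_int [IsProbabilityMeasure μ] {F : ℤ → X → ℝ} {C : ℝ} (h : ∀ n x, |F n x| ≤ C) :
    Bdd (fun n => ∫ x, F n x ∂μ) := ⟨C, fun n => int_abs_le_const (h n)⟩

/-- uniform distribution of the kernels -/
lemma Sys.um (hS : Sys M μ J σ) (hM : IsMean M) {ℓ : ℕ} (hℓ : 0 < ℓ) {K : ℤ → ℝ} (hK : AP K)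
    {g : X → ℝ} (hg : BM g) :
    lamMean M ℓ (fun n => ∫ x, g x * kn J ℓ K n x ∂μ) =
      lamMean M ℓ K * ∫ x, g x * J (io ℓ (fun _ => 1)) x ∂μ := by
  have := hS.prob
  have hΛ := isMean_lamMean hM hℓ
  obtain ⟨C, hC⟩ := hg.2
  obtain ⟨D, hD0, hD⟩ := hS.kn_bdd (ℓ := ℓ) hK.bdd
  have hF : Bdd (fun n => ∫ x, g x * kn J ℓ K n x ∂μ) := bdd_int (C := C * D) fun n x => by
    rw [abs_mul]; exact mul_le_mul (hC x) (hD n x) (abs_nonneg _) ((abs_nonneg _).trans (hC x))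
  rw [← sub_eq_zero, ← abs_nonpos_iff]
  apply le_of_forall_pos_le_add
  intro ε hε
  rw [zero_add]
  have hCp : 0 < |C| + 1 := by positivity
  obtain ⟨N₀, hN⟩ := AP.unif hΛ hK (show 0 < ε / (|C| + 1) by positivity)
  have hN' := hN (N₀ + 1) (by omega) (by omega)
  set N := N₀ + 1
  rw [← hΛ.avg hF (N := N) (by omega) (fun j => -(j:ℤ))]
  set c := lamMean M ℓ K * ∫ x, g x * J (io ℓ (fun _ => 1)) x ∂μ with hc
  rw [← hΛ.const c, ← hΛ.sub ((Bdd.sum _ fun j => hF.comp _).const_mul _) (Bdd.const c)]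
  apply hΛ.abs_le_const
  intro n
  unfold kn
  rw [hS.avg_int hg (fun j => bdd_kn hK.bdd _), hc, ← integral_const_mul, ← integral_sub]
  · refine int_abs_le_const fun x => ?_
    have b1 : Bdd (fun z => (N:ℝ)⁻¹ * ∑ j ∈ Finset.range N, io ℓ (fun z => K (z - (n + -(j:ℤ)))) z) :=
      (Bdd.sum _ fun j => bdd_kn hK.bdd _).const_mul _
    have b2 : Bdd (io ℓ (fun _ => 1)) := (Bdd.const 1).io
    have e : g x * J (fun z => (N:ℝ)⁻¹ * ∑ j ∈ Finset.range N, io ℓ (fun z => K (z - (n + -(j:ℤ)))) z) x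
        - lamMean M ℓ K * (g x * J (io ℓ (fun _ => 1)) x) =
        g x * J (fun z => (N:ℝ)⁻¹ * ∑ j ∈ Finset.range N, io ℓ (fun z => K (z - (n + -(j:ℤ)))) z
          - lamMean M ℓ K * io ℓ (fun _ => 1) z) x := by
      rw [hS.sub b1 (b2.const_mul _), hS.smul _ b2]; ring
    rw [e, abs_mul]
    have h1 : |J (fun z => (N:ℝ)⁻¹ * ∑ j ∈ Finset.range N, io ℓ (fun z => K (z - (n + -(j:ℤ)))) z
          - lamMean M ℓ K * io ℓ (fun _ => 1) z) x| ≤ ε / (|C| + 1) := by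
      apply hS.abs_le_const
      intro z
      by_cases h : (ℓ:ℤ) ∣ z
      · obtain ⟨y, rfl⟩ := h
        simp only [io_mul hℓ]
        have := hN' (y - n)
        convert this using 3
        · congr 1
          apply Finset.sum_congr rfl; intro j _; congr 1; ring
        · ring
      · simp only [io_of_not _ h]; simp; positivity
    calc |g x| * _ ≤ (|C| + 1) * (ε / (|C| + 1)) := by
          apply mul_le_mul _ h1 (abs_nonneg _) hCp.le
          have := le_abs_self C
          linarith [hC x]
      _ = ε := by field_simp
  · exact (hg.mul (hS.BM_J ((Bdd.sum _ fun j => bdd_kn hK.bdd _).const_mul _))).int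
  · exact ((BM.const _).mul (hg.mul (hS.BM_J (Bdd.const 1).io))).int

/-- admissible kernels -/
structure Good (M : (ℤ → ℝ) → ℝ) (ℓ : ℕ) (K : ℤ → ℝ) : Prop where
  ap : AP K
  nn : ∀ z, 0 ≤ K z
  mean : lamMean M ℓ K = 1

lemma Sys.L_le (hS : Sys M μ J σ) (ℓ : ℕ) (x : X) :
    0 ≤ J (io ℓ (fun _ => 1)) x ∧ J (io ℓ (fun _ => 1)) x ≤ 1 := by
  refine ⟨hS.nonneg (Bdd.const 1).io (io_nonneg fun _ => zero_le_one) x, ?_⟩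
  have : |J (io ℓ (fun _ => 1)) x| ≤ 1 := hS.abs_le_const (io_abs_le fun z => by simp) x
  exact (le_abs_self _).trans this

lemma Sys.um_le (hS : Sys M μ J σ) (hM : IsMean M) {ℓ : ℕ} (hℓ : 0 < ℓ) {K : ℤ → ℝ}
    (hK : Good M ℓ K) {g : X → ℝ} (hg : BM g) (hg0 : ∀ x, 0 ≤ g x) {F : ℤ → X → ℝ}
    (hF : ∀ n x, |F n x| ≤ g x * kn J ℓ K n x) :
    |lamMean M ℓ (fun n => ∫ x, F n x ∂μ)| ≤ ∫ x, g x ∂μ := by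
  have := hS.prob
  have hΛ := isMean_lamMean hM hℓ
  obtain ⟨C, hC⟩ := hg.2
  obtain ⟨D, hD0, hD⟩ := hS.kn_bdd (ℓ := ℓ) hK.ap.bdd
  have hb : ∀ n x, |g x * kn J ℓ K n x| ≤ C * D := fun n x => by
    rw [abs_mul]; exact mul_le_mul (hC x) (hD n x) (abs_nonneg _) ((abs_nonneg _).trans (hC x))
  have hFb : Bdd (fun n => ∫ x, F n x ∂μ) := bdd_int fun n x =>
    ((hF n x).trans (le_abs_self _)).trans (hb n x)
  refine (hΛ.abs_le hFb).trans ?_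
  have h1 := hS.um hM hℓ hK.ap hg
  rw [hK.mean, one_mul] at h1
  calc _ ≤ lamMean M ℓ (fun n => ∫ x, g x * kn J ℓ K n x ∂μ) :=
        hΛ.mono hFb.abs (bdd_int hb) fun n => int_abs_le (hg.mul (hS.kn_BM hK.ap.bdd n)) (hF n)
    _ = _ := h1
    _ ≤ _ := int_mono (hg.mul (hS.BM_J (Bdd.const 1).io)) hg fun x =>
        mul_le_of_le_one_right (hg0 x) (hS.L_le ℓ x).2

lemma AP.sparse {L : (ℤ → ℝ) → ℝ} (hL : IsMean L) {k : ℤ → ℝ} (hk : AP k) (h0 : ∀ z, 0 ≤ k z)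
    {p : ℕ} (hp : 0 < p) : ∃ N : ℕ, 0 < N ∧ ∀ z : ℤ,
      (N:ℝ)⁻¹ * ∑ j ∈ Finset.range N, k (z - p * j) ≤ p * (L k + 1) := by
  obtain ⟨N₀, hN⟩ := AP.unif hL hk one_pos
  refine ⟨N₀ + 1, by omega, fun z => ?_⟩
  set N := N₀ + 1 with hNd
  have h1 := hN (p * N) (by nlinarith) (by positivity) (z - p * N + 1)
  have hNp : (0:ℝ) < N := by positivity
  have hpp : (0:ℝ) < p := by positivity
  have h2 := (abs_le.1 h1).2
  have h3 : ∑ j ∈ Finset.range N, k (z - p * j) ≤ ∑ i ∈ Finset.range (p * N), k (z - p * N + 1 + i) := by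
    have hinj : Set.InjOn (fun j : ℕ => p * N - 1 - p * j) (Finset.range N : Set ℕ) := by
      intro a ha b hb hab
      simp only [Finset.coe_range, Set.mem_Iio] at ha hb hab
      have ha' : p * a + p ≤ p * N := by nlinarith
      have hb' : p * b + p ≤ p * N := by nlinarith
      have : p * a = p * b := by omega
      exact Nat.eq_of_mul_eq_mul_left hp this
    rw [show ∑ j ∈ Finset.range N, k (z - p * j) =
        ∑ i ∈ (Finset.range N).image (fun j : ℕ => p * N - 1 - p * j), k (z - p * N + 1 + i) from ?_]
    · apply Finset.sum_le_sum_of_subset_of_nonneg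
      · intro i hi
        simp only [Finset.mem_image, Finset.mem_range] at hi ⊢
        obtain ⟨j, hj, rfl⟩ := hi
        have : 0 < p * N := by positivity
        omega
      · intros; exact h0 _
    · rw [Finset.sum_image hinj]
      apply Finset.sum_congr rfl
      intro j hj
      rw [Finset.mem_range] at hj
      have ha' : p * j + p ≤ p * N := by nlinarith
      congr 1
      have : ((p * N - 1 - p * j : ℕ) : ℤ) = p * N - 1 - p * j := by
        rw [Nat.sub_sub, Nat.cast_sub (by omega)]; push_cast; ring
      rw [this]; ring
  calc (N:ℝ)⁻¹ * ∑ j ∈ Finset.range N, k (z - p * j)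
      ≤ (N:ℝ)⁻¹ * ∑ i ∈ Finset.range (p * N), k (z - p * N + 1 + i) := by gcongr
    _ = p * (((p * N : ℕ):ℝ)⁻¹ * ∑ i ∈ Finset.range (p * N), k (z - p * N + 1 + i)) := by
        push_cast; field_simp
    _ ≤ _ := by gcongr; linarith

/-- bound for the twisted averages -/
lemma Sys.bo (hS : Sys M μ J σ) (hM : IsMean M) {ℓ : ℕ} (hℓ : 0 < ℓ) (m : ℕ) {K : ℤ → ℝ}
    (hK : Good M ℓ K) {φ : X → ℝ} (hφ : BM φ) {F : ℤ → X → ℝ}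
    (hF : ∀ n x, |F n x| ≤ kn J ℓ K n x * |φ (σ (m * n) x)|) :
    |lamMean M ℓ (fun n => ∫ x, F n x ∂μ)| ≤ 2 * (ℓ + m) * ∫ x, |φ x| ∂μ := by
  have := hS.prob
  have hΛ := isMean_lamMean hM hℓ
  obtain ⟨C, hC⟩ := hφ.2
  obtain ⟨D, hD0, hD⟩ := hS.kn_bdd (ℓ := ℓ) hK.ap.bdd
  have hb : ∀ n x, |kn J ℓ K n x * (|φ (σ (m * n) x)|)| ≤ D * C := fun n x => by
    rw [abs_mul, abs_abs]; exact mul_le_mul (hD n x) (hC _) (abs_nonneg _) hD0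
  have hFb : Bdd (fun n => ∫ x, F n x ∂μ) := bdd_int fun n x =>
    ((hF n x).trans (le_abs_self _)).trans (hb n x)
  refine (hΛ.abs_le hFb).trans ?_
  have hle := hΛ.mono hFb.abs (bdd_int hb) fun n => int_abs_le
    ((hS.kn_BM hK.ap.bdd n).mul (hφ.abs.comp (hS.mp _).measurable)) (hF n)
  refine hle.trans ?_
  have hkb : Bdd (io ℓ K) := hK.ap.bdd.io
  have hkM : M (io ℓ K) ≤ 1 := by
    have h1 : (ℓ:ℝ) * M (io ℓ K) = 1 := hK.mean
    have h2 : (1:ℝ) ≤ ℓ := by exact_mod_cast hℓ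
    have h3 := hM.nonneg hkb (io_nonneg hK.nn)
    nlinarith
  have e : ∀ n : ℤ, ∫ x, kn J ℓ K n x * |φ (σ (m * n) x)| ∂μ =
      ∫ x, |φ x| * J (fun z => io ℓ K (z - (ℓ + m : ℕ) * n)) x ∂μ := by
    intro n
    rw [← hS.int_comp (-(m * n)) ((hS.kn_BM hK.ap.bdd n).mul (hφ.abs.comp (hS.mp _).measurable))]
    congr 1; ext x
    rw [← hS.σ_add, add_neg_cancel, hS.σ_zero, mul_comm]
    congr 1
    unfold kn
    rw [hS.Jσ (bdd_kn hK.ap.bdd n)]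
    congr 1; ext z
    have := io_add_mul hℓ K (z + -(m * n)) (-n)
    simp only [← sub_eq_add_neg] at this ⊢
    rw [← this]
    congr 1; push_cast; ring
  simp only [e]
  obtain ⟨N, hN0, hN⟩ := AP.sparse hM (io_pm hℓ hK.ap) (io_nonneg hK.nn) (p := ℓ + m) (by omega)
  have hGb : Bdd (fun n => ∫ x, |φ x| * J (fun z => io ℓ K (z - (ℓ + m : ℕ) * n)) x ∂μ) := by
    simp only [← e]; exact bdd_int hb
  rw [← hΛ.avg hGb hN0 (fun j => (j:ℤ))]
  apply hΛ.le_const ((Bdd.sum _ fun j => hGb.comp _).const_mul _)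
  intro n
  have kb : ∀ j : ℕ, Bdd (fun z => io ℓ K (z - (ℓ + m : ℕ) * (n + j))) := fun j => hkb.comp _
  rw [hS.avg_int hφ.abs kb, ← integral_const_mul]
  have sb := (Bdd.sum (Finset.range N) kb).const_mul (N:ℝ)⁻¹
  refine int_mono (hφ.abs.mul (hS.BM_J sb)) ((BM.const _).mul hφ.abs) fun x => ?_
  rw [mul_comm]
  refine mul_le_mul_of_nonneg_right ?_ (abs_nonneg _)
  refine hS.le_const sb (fun z => ?_) x
  have h1 := hN (z - (ℓ + m : ℕ) * n)
  have h2 : ((ℓ + m : ℕ):ℝ) * (M (io ℓ K) + 1) ≤ 2 * (ℓ + m) := by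
    push_cast; nlinarith [show (0:ℝ) ≤ ℓ + m by positivity]
  refine le_trans (le_of_eq ?_) (h1.trans h2)
  congr 1
  apply Finset.sum_congr rfl; intro j _; congr 1; ring

end Avg


/-! ### The lower bound -/

section Lower
variable {X : Type} [MeasurableSpace X] {μ : Measure X} {M : (ℤ → ℝ) → ℝ}
  {J : (ℤ → ℝ) → X → ℝ} {σ : ℤ → X → X}

/-- the twisted averages -/
noncomputable def qq (M : (ℤ → ℝ) → ℝ) (μ : Measure X) (J : (ℤ → ℝ) → X → ℝ) (σ : ℤ → X → X)
    (ℓ m : ℕ) (K : ℤ → ℝ) (f : X → ℝ) (t : ℤ) (v : X → ℝ) : ℝ :=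
  lamMean M ℓ (fun n => ∫ x, v x * kn J ℓ K n x * f (σ (t + m * n) x) ∂μ)

lemma Sys.L_inv (hS : Sys M μ J σ) {ℓ : ℕ} (hℓ : 0 < ℓ) (s : ℤ) (x : X) :
    J (io ℓ (fun _ => 1)) (σ (-(ℓ * s)) x) = J (io ℓ (fun _ => 1)) x :=
  hS.kn_comp (K := fun _ => 1) hℓ (Bdd.const 1) 0 s x

lemma Sys.L_sq (hS : Sys M μ J σ) {ℓ : ℕ} (x : X) :
    J (io ℓ (fun _ => 1)) x * J (io ℓ (fun _ => 1)) x = J (io ℓ (fun _ => 1)) x := by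
  rw [← hS.mul (Bdd.const 1).io (Bdd.const 1).io]
  congr 1; ext z
  unfold io
  split_ifs <;> simp

lemma Sys.lower (hS : Sys M μ J σ) (hM : IsMean M) {ℓ : ℕ} (hℓ : 0 < ℓ) (m : ℕ) {e f : X → ℝ}
    (he : BM e) (he0 : ∀ x, 0 ≤ e x) (he1 : ∀ x, e x ≤ 1) (hf : BM f)
    (hef : ∀ w ∈ hS.Hc m, inner ℝ w (tl μ e - tl μ f) = 0)
    (hpos : 0 < ∫ x, e x * J (io ℓ (fun _ => 1)) x ∂μ) :
    ∃ c > 0, ∃ N : ℕ, 0 < N ∧ ∀ K, Good M ℓ K → c ≤ (N:ℝ)⁻¹ * ∑ s ∈ Finset.range N,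
      qq M μ J σ ℓ m K f (ℓ * ((s:ℤ) + 1))
        (fun x => e (σ (ℓ * ((s:ℤ) + 1)) x) * J (io ℓ (fun _ => 1)) x) := by
  have := hS.prob
  have hΛ := isMean_lamMean hM hℓ
  obtain ⟨g, hgm, hg0, hg1, hginv, hglim, hgz⟩ := hS.exists_fbar m he he0 he1 hf hef
  have hg : BM g := BM.of_le hgm hg0 hg1
  set L : X → ℝ := J (io ℓ (fun _ => 1)) with hL
  have hLB : BM L := hS.BM_J (Bdd.const 1).io
  have hL0 : ∀ x, 0 ≤ L x := fun x => (hS.L_le ℓ x).1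
  have hL1 : ∀ x, L x ≤ 1 := fun x => (hS.L_le ℓ x).2
  have hc : 0 < ∫ x, e x * L x * g x ∂μ := by
    have hnn : ∀ x, 0 ≤ e x * L x * g x := fun x => mul_nonneg (mul_nonneg (he0 x) (hL0 x)) (hg0 x)
    rw [lt_iff_le_and_ne]
    refine ⟨integral_nonneg hnn, fun h => hpos.ne ?_⟩
    have h0 := (integral_eq_zero_iff_of_nonneg hnn ((he.mul hLB).mul hg).int).1 h.symm
    symm
    apply integral_eq_zero_of_ae
    filter_upwards [h0, hgz] with x h1 h2
    simp only [Pi.zero_apply] at h1 ⊢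
    rcases mul_eq_zero.1 h1 with h | h
    · exact h
    · rw [h2 h.le, zero_mul]
  set c := ∫ x, e x * L x * g x ∂μ with hcdef
  have hp : (0:ℝ) < 2 * (ℓ + m) := by positivity
  obtain ⟨N, hN, hNε⟩ := hglim (c / 2 / (2 * (ℓ + m))) (by positivity)
  refine ⟨c / 2, by positivity, N, hN, fun K hK => ?_⟩
  obtain ⟨D, hD0, hD⟩ := hS.kn_bdd (ℓ := ℓ) hK.ap.bdd
  obtain ⟨C, hC⟩ := hf.2
  have hC0 : 0 ≤ C := by
    have : Nonempty X := μ.nonempty_of_neZero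
    exact (abs_nonneg _).trans (hC (Classical.arbitrary X))
  have knB := fun n => hS.kn_BM (ℓ := ℓ) hK.ap.bdd n
  have eL1 : ∀ x, |e x * L x| ≤ 1 := fun x => by
    rw [abs_of_nonneg (mul_nonneg (he0 x) (hL0 x))]
    exact mul_le_one₀ (he1 x) (hL0 x) (hL1 x)
  set G : ℕ → ℤ → ℝ := fun s n => ∫ x, e x * L x * kn J ℓ K n x *
    f (σ (m * (-((s:ℤ) + 1))) (σ (m * n) x)) ∂μ with hG
  have hGB : ∀ s, Bdd (G s) := fun s => bdd_int (C := 1 * D * C) fun n x => by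
    rw [abs_mul, abs_mul]
    exact mul_le_mul (mul_le_mul (eL1 x) (hD n x) (abs_nonneg _) zero_le_one) (hC _)
      (abs_nonneg _) (by positivity)
  have h1 : ∀ s : ℕ, qq M μ J σ ℓ m K f (ℓ * ((s:ℤ) + 1))
        (fun x => e (σ (ℓ * ((s:ℤ) + 1)) x) * L x) = lamMean M ℓ (G s) := by
    intro s
    rw [← hΛ.shift (hGB s) ((s:ℤ) + 1)]
    unfold qq
    congr 1; ext n
    rw [← hS.int_comp (-(ℓ * ((s:ℤ) + 1)))
      ((((he.comp (hS.mp _).measurable).mul hLB).mul (knB n)).mul (hf.comp (hS.mp _).measurable))]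
    simp only [hG]
    congr 1; ext x
    rw [hS.kn_comp hℓ hK.ap.bdd, ← hS.σ_add, ← hS.σ_add, ← hS.σ_add, add_neg_cancel, hS.σ_zero, hL,
      hS.L_inv hℓ]
    congr 3
    ring
  simp only [h1]
  rw [← hΛ.sum _ hGB, ← hΛ.smul _ (Bdd.sum _ hGB)]
  have knf : ∀ s : ℕ, BM (fun x => f (σ (m * (-((s:ℤ) + 1))) x)) := fun s => hf.comp (hS.mp _).measurable
  set fN : X → ℝ := fun x => (N:ℝ)⁻¹ * ∑ s ∈ Finset.range N, f (σ (m * (-(s + 1))) x) with hfN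
  have hfNB : BM fN := (BM.const _).mul (BM.sum _ knf)
  have h2 : ∀ n, (N:ℝ)⁻¹ * ∑ s ∈ Finset.range N, G s n =
      ∫ x, e x * L x * kn J ℓ K n x * (fN (σ (m * n) x) - g (σ (m * n) x)) ∂μ
        + ∫ x, (e x * L x * g x) * kn J ℓ K n x ∂μ := by
    intro n
    have i1 : Integrable (fun x => e x * L x * kn J ℓ K n x * fN (σ (m * n) x)) μ :=
      (((he.mul hLB).mul (knB n)).mul (hfNB.comp (hS.mp _).measurable)).int
    have i2 : Integrable (fun x => e x * L x * kn J ℓ K n x * g (σ (m * n) x)) μ :=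
      (((he.mul hLB).mul (knB n)).mul (hg.comp (hS.mp _).measurable)).int
    have e1 : ∫ x, (e x * L x * g x) * kn J ℓ K n x ∂μ =
        ∫ x, e x * L x * kn J ℓ K n x * g (σ (m * n) x) ∂μ := by
      apply integral_congr_ae
      filter_upwards [hginv n] with x hx
      rw [hx]; ring
    simp only [mul_sub]
    rw [integral_sub i1 i2, e1, sub_add_cancel]
    simp only [hG]
    rw [← integral_finsetSum _ fun s _ =>
      (((he.mul hLB).mul (knB n)).mul ((knf s).comp (hS.mp _).measurable)).int, ← integral_const_mul]
    congr 1; ext x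
    simp only [hfN]
    rw [← Finset.mul_sum]; ring
  simp only [h2]
  have hd : BM (fun x => fN x - g x) := hfNB.sub hg
  have hknn := fun n x => hS.kn_nonneg (ℓ := ℓ) hK.ap.bdd hK.nn n x
  have h3 := hS.bo hM hℓ m hK hd (F := fun n x => e x * L x * kn J ℓ K n x *
    (fN (σ (m * n) x) - g (σ (m * n) x))) fun n x => by
      rw [abs_mul, abs_mul, abs_of_nonneg (hknn n x)]
      apply mul_le_mul_of_nonneg_right _ (abs_nonneg _)
      exact mul_le_of_le_one_left (hknn n x) (eL1 x)
  have h4 := hS.um hM hℓ hK.ap ((he.mul hLB).mul hg)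
  rw [hK.mean, one_mul] at h4
  have h5 : ∫ x, e x * L x * g x * J (io ℓ fun _ => 1) x ∂μ = c := by
    rw [hcdef]; congr 1; ext x
    have := hS.L_sq (ℓ := ℓ) x
    rw [← hL] at this ⊢
    linear_combination (e x * g x) * this
  obtain ⟨C', hC'⟩ := hd.2
  rw [hΛ.add (f := fun n => ∫ x, e x * L x * kn J ℓ K n x * (fN (σ (m * n) x) - g (σ (m * n) x)) ∂μ)
    (g := fun n => ∫ x, e x * L x * g x * kn J ℓ K n x ∂μ), h4, h5]
  · have h6 : 2 * (ℓ + m) * ∫ x, |fN x - g x| ∂μ ≤ c / 2 := by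
      rw [← le_div_iff₀' hp]; exact hNε
    have := (_root_.abs_le.1 (h3.trans h6)).1
    linarith
  · refine bdd_int (C := 1 * D * C') fun n x => ?_
    rw [abs_mul, abs_mul]
    exact mul_le_mul (mul_le_mul (eL1 x) (hD n x) (abs_nonneg _) zero_le_one) (hC' _)
      (abs_nonneg _) (by positivity)
  · refine bdd_int (C := 1 * 1 * D) fun n x => ?_
    rw [abs_mul, abs_mul]
    refine mul_le_mul (mul_le_mul (eL1 x) ?_ (abs_nonneg _) zero_le_one) (hD n x)
      (abs_nonneg _) (by positivity)
    rw [abs_of_nonneg (hg0 x)]; exact hg1 x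

end Lower


/-! ### The upper bound -/

section Upper
variable {X : Type} [MeasurableSpace X] {μ : Measure X} {M : (ℤ → ℝ) → ℝ}
  {J : (ℤ → ℝ) → X → ℝ} {σ : ℤ → X → X}

lemma Sys.wm (hS : Sys M μ J σ) (hM : IsMean M) {ℓ : ℕ} (hℓ : 0 < ℓ) (m : ℕ) {e f : X → ℝ}
    (he : BM e) (hf : BM f)
    (hef : ∀ w ∈ hS.Hc m, inner ℝ w (tl μ e - tl μ f) = 0) {G : X → ℝ} (hG : BM G) (t : ℤ) :
    lamMean M ℓ (fun n => |∫ x, G x * (e (σ (t + m * n) x) - f (σ (t + m * n) x)) ∂μ|) = 0 := by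
  have := hS.prob
  have hΛ := isMean_lamMean hM hℓ
  have hG' : BM (fun x => G (σ (-t) x)) := hG.comp (hS.mp _).measurable
  have h1 := weak_mixing hΛ (hS.U m) (hS.U_add m) (hS.U_zero m) (tl μ e - tl μ f)
    (fun v hv => hef v hv) (tl μ (fun x => G (σ (-t) x)))
  have h2 := hΛ.sq_le (bdd_inner (hS.U m) _ _) h1
  rw [← h2]
  congr 1; ext n
  congr 1
  rw [← tl_sub he hf, hS.U_tl m n (he.sub hf),
    inner_tl hG' ((he.sub hf).comp (hS.mp _).measurable),
    ← hS.int_comp t (hG'.mul ((he.sub hf).comp (hS.mp _).measurable))]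
  congr 1; ext x
  rw [← hS.σ_add, ← hS.σ_add, neg_add_cancel, hS.σ_zero, add_comm t]

lemma Sys.kn_TB (hS : Sys M μ J σ) (ℓ : ℕ) {K : ℤ → ℝ} (hK : AP K) :
    TB (fun ε s i => ∀ z x, |kn J ℓ K (z + s) x - kn J ℓ K (z + i) x| ≤ ε) := by
  refine (TB.comp hK (pm_forall K) (fun s => -s)).imp fun ε hε => ⟨ε, hε, fun s i h z x => ?_⟩
  unfold kn
  rw [← hS.sub (bdd_kn hK.bdd _) (bdd_kn hK.bdd _)]
  apply hS.abs_le_const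
  intro y
  rw [← io_sub]
  apply io_abs_le
  intro y
  have := h (y - z)
  rwa [show y - z + -s = y - (z + s) by ring, show y - z + -i = y - (z + i) by ring] at this

lemma Sys.wmK (hS : Sys M μ J σ) (hM : IsMean M) {ℓ : ℕ} (hℓ : 0 < ℓ) (m : ℕ) {e f : X → ℝ}
    (he : BM e) (he0 : ∀ x, 0 ≤ e x) (he1 : ∀ x, e x ≤ 1)
    (hf : BM f) (hf0 : ∀ x, 0 ≤ f x) (hf1 : ∀ x, f x ≤ 1)
    (hef : ∀ w ∈ hS.Hc m, inner ℝ w (tl μ e - tl μ f) = 0) {v : X → ℝ} (hv : BM v)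
    (hv0 : ∀ x, 0 ≤ v x) (hv1 : ∀ x, v x ≤ 1) {K : ℤ → ℝ} (hK : AP K) (t : ℤ) :
    lamMean M ℓ (fun n => |∫ x, v x * kn J ℓ K n x *
      (e (σ (t + m * n) x) - f (σ (t + m * n) x)) ∂μ|) = 0 := by
  have := hS.prob
  have hΛ := isMean_lamMean hM hℓ
  have hd : ∀ x, |e x - f x| ≤ 1 := fun x => by
    rw [abs_le']; constructor <;> linarith [he0 x, he1 x, hf0 x, hf1 x]
  have hva : ∀ x, |v x| ≤ 1 := fun x => by rw [abs_of_nonneg (hv0 x)]; exact hv1 x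
  obtain ⟨D, hD0, hD⟩ := hS.kn_bdd (ℓ := ℓ) hK.bdd
  have hb : ∀ i n x, |v x * kn J ℓ K i x * (e (σ (t + m * n) x) - f (σ (t + m * n) x))| ≤ 1 * D * 1 := by
    intro i n x
    rw [abs_mul, abs_mul]
    exact mul_le_mul (mul_le_mul (hva x) (hD i x) (abs_nonneg _) zero_le_one) (hd _)
      (abs_nonneg _) (by positivity)
  have hIb : Bdd (fun n => |∫ x, v x * kn J ℓ K n x *
      (e (σ (t + m * n) x) - f (σ (t + m * n) x)) ∂μ|) := (bdd_int fun n x => hb n n x).abs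
  apply le_antisymm _ (hΛ.nonneg hIb fun n => abs_nonneg _)
  apply le_of_forall_pos_le_add
  intro ε hε
  obtain ⟨F, hF⟩ := hS.kn_TB ℓ hK ε hε
  have knB := fun n => hS.kn_BM (ℓ := ℓ) hK.bdd n
  have hsB : ∀ i, Bdd (fun n => |∫ x, v x * kn J ℓ K i x *
      (e (σ (t + m * n) x) - f (σ (t + m * n) x)) ∂μ|) := fun i => (bdd_int fun n x => hb i n x).abs
  calc _ ≤ lamMean M ℓ (fun n => (∑ i ∈ F, |∫ x, v x * kn J ℓ K i x *
      (e (σ (t + m * n) x) - f (σ (t + m * n) x)) ∂μ|) + ε) := by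
        refine hΛ.mono hIb ((Bdd.sum _ hsB).add (Bdd.const ε)) fun n => ?_
        obtain ⟨i, hi, h⟩ := hF n
        have h1 : ∫ x, v x * kn J ℓ K n x * (e (σ (t + m * n) x) - f (σ (t + m * n) x)) ∂μ =
          ∫ x, v x * kn J ℓ K i x * (e (σ (t + m * n) x) - f (σ (t + m * n) x)) ∂μ +
          ∫ x, v x * (kn J ℓ K n x - kn J ℓ K i x) * (e (σ (t + m * n) x) - f (σ (t + m * n) x)) ∂μ := by
          have hdB : BM (fun x => e (σ (t + m * n) x) - f (σ (t + m * n) x)) :=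
            (he.sub hf).comp (hS.mp _).measurable
          rw [← integral_add ((hv.mul (knB i)).mul hdB).int
            ((hv.mul ((knB n).sub (knB i))).mul hdB).int]
          congr 1; ext x; ring
        rw [h1]
        refine (abs_add_le _ _).trans (add_le_add ?_ ?_)
        · exact Finset.single_le_sum (f := fun i => |∫ x, v x * kn J ℓ K i x *
            (e (σ (t + m * n) x) - f (σ (t + m * n) x)) ∂μ|) (fun i _ => abs_nonneg _) hi
        · refine int_abs_le_const fun x => ?_
          rw [abs_mul, abs_mul]
          have h2 := h 0 x
          rw [zero_add, zero_add] at h2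
          calc _ ≤ 1 * ε * 1 := mul_le_mul (mul_le_mul (hva x) h2 (abs_nonneg _) zero_le_one) (hd _)
                (abs_nonneg _) (by positivity)
            _ = ε := by ring
    _ = 0 + ε := by
        rw [hΛ.add (Bdd.sum _ hsB) (Bdd.const ε), hΛ.const, hΛ.sum _ hsB]
        rw [Finset.sum_eq_zero fun i _ => hS.wm hM hℓ m he hf hef (hv.mul (knB i)) t]

lemma Sys.a_AP (hS : Sys M μ J σ) {ℓ : ℕ} (m : ℕ) {f : X → ℝ}
    (hf : BM f) (hf0 : ∀ x, 0 ≤ f x) (hf1 : ∀ x, f x ≤ 1)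
    (hfc : tl μ f ∈ hS.Hc m) {v : X → ℝ} (hv : BM v)
    (hv0 : ∀ x, 0 ≤ v x) (hv1 : ∀ x, v x ≤ 1) {K : ℤ → ℝ} (hK : AP K) (t : ℤ) :
    AP (fun n => ∫ x, v x * kn J ℓ K n x * f (σ (t + m * n) x) ∂μ) := by
  have := hS.prob
  have hva : ∀ x, |v x| ≤ 1 := fun x => by rw [abs_of_nonneg (hv0 x)]; exact hv1 x
  have hfa : ∀ x, |f x| ≤ 1 := fun x => by rw [abs_of_nonneg (hf0 x)]; exact hf1 x
  obtain ⟨D, hD0, hD⟩ := hS.kn_bdd (ℓ := ℓ) hK.bdd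
  have knB := fun n => hS.kn_BM (ℓ := ℓ) hK.bdd n
  have hpm : PM (fun ε s i => ∀ z x, |kn J ℓ K (z + s) x - kn J ℓ K (z + i) x| ≤ ε) := by
    intro ε ε' s j i h h' z x
    exact pm_abs (fun s => kn J ℓ K (z + s) x) ε ε' s j i (h z x) (h' z x)
  refine (TB.and (hS.kn_TB ℓ hK) ((hS.mem_Hc m _).1 hfc) hpm (pm_norm _)).imp fun ε hε =>
    ⟨ε / (1 + D), by positivity, ?_⟩
  rintro s i ⟨h1, h2⟩ z
  have fB : ∀ k, BM (fun x => f (σ k x)) := fun k => hf.comp (hS.mp _).measurable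
  rw [← integral_sub ((hv.mul (knB _)).mul (fB _)).int ((hv.mul (knB _)).mul (fB _)).int]
  have h3 : ∫ x, |f (σ (t + m * (z + s)) x) - f (σ (t + m * (z + i)) x)| ∂μ ≤ ε / (1 + D) := by
    refine le_trans ?_ h2
    rw [hS.U_tl m s hf, hS.U_tl m i hf, ← tl_sub (fB _) (fB _)]
    refine le_trans (le_of_eq ?_) (int_abs_le_norm ((fB _).sub (fB _)))
    rw [← hS.int_comp (t + m * z) ((fB (m * s)).sub (fB (m * i))).abs]
    congr 1; ext x
    rw [← hS.σ_add, ← hS.σ_add, show t + m * (z + s) = m * s + (t + m * z) by ring,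
      show t + m * (z + i) = m * i + (t + m * z) by ring]
  have hdB : BM (fun x => |f (σ (t + m * (z + s)) x) - f (σ (t + m * (z + i)) x)|) :=
    ((fB _).sub (fB _)).abs
  refine (int_abs_le (g := fun x => ε / (1 + D) +
    D * |f (σ (t + m * (z + s)) x) - f (σ (t + m * (z + i)) x)|)
    ((BM.const _).add ((BM.const _).mul hdB)) fun x => ?_).trans ?_
  · have e : v x * kn J ℓ K (z + s) x * f (σ (t + m * (z + s)) x) -
        v x * kn J ℓ K (z + i) x * f (σ (t + m * (z + i)) x) =
        v x * ((kn J ℓ K (z + s) x - kn J ℓ K (z + i) x) * f (σ (t + m * (z + s)) x)) +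
        v x * (kn J ℓ K (z + i) x * (f (σ (t + m * (z + s)) x) - f (σ (t + m * (z + i)) x))) := by ring
    rw [e]
    refine (abs_add_le _ _).trans (add_le_add ?_ ?_)
    · rw [abs_mul, abs_mul]
      calc _ ≤ 1 * (ε / (1 + D) * 1) := mul_le_mul (hva x)
            (mul_le_mul (h1 z x) (hfa _) (abs_nonneg _) (by positivity)) (by positivity) zero_le_one
        _ = _ := by ring
    · rw [abs_mul, abs_mul]
      calc _ ≤ 1 * (D * |f (σ (t + m * (z + s)) x) - f (σ (t + m * (z + i)) x)|) := mul_le_mul (hva x)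
            (mul_le_mul_of_nonneg_right (hD _ x) (abs_nonneg _)) (by positivity) zero_le_one
        _ = _ := by ring
  · rw [integral_add (BM.const _).int ((BM.const _).mul hdB).int, integral_const_mul]
    simp only [integral_const, probReal_univ, one_smul]
    calc _ ≤ ε / (1 + D) + D * (ε / (1 + D)) := by gcongr
      _ = ε := by field_simp

end Upper


section Upper2
variable {X : Type} [MeasurableSpace X] {μ : Measure X} {M : (ℤ → ℝ) → ℝ}
  {J : (ℤ → ℝ) → X → ℝ} {σ : ℤ → X → X}

/-- the kernel lives on almost periods of `w` -/
def Compat (ℓ : ℕ) (w : ℤ → ℝ) (δ : ℝ) (K : ℤ → ℝ) : Prop :=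
  ∀ p, K p ≠ 0 → ∀ z, |w (z + ℓ * p) - w z| ≤ δ

lemma Sys.lam_mul (hS : Sys M μ J σ) {ℓ : ℕ} (hℓ : 0 < ℓ) {c a : ℤ → ℝ} (hc : Bdd c) (ha : Bdd a) :
    lamMean M ℓ (fun n => c (ℓ * n) * a n) = ℓ * ∫ x, J c x * J (io ℓ a) x ∂μ := by
  unfold lamMean
  congr 1
  have : (fun x => J c x * J (io ℓ a) x) = J (fun z => c z * io ℓ a z) := by
    ext x; rw [hS.mul hc ha.io]
  rw [this, hS.int (hc.mul ha.io)]
  congr 1; ext z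
  by_cases h : (ℓ:ℤ) ∣ z
  · obtain ⟨y, rfl⟩ := h
    simp only [io_mul hℓ]
  · simp only [io_of_not _ h, mul_zero]

lemma Sys.compat_le (hS : Sys M μ J σ) {ℓ : ℕ} (hℓ : 0 < ℓ) {w K : ℤ → ℝ} {δ : ℝ} (hw : Bdd w)
    (hK : Bdd K) (hK0 : ∀ z, 0 ≤ K z) (h : Compat ℓ w δ K) (n : ℤ) (x : X) :
    |J w x - w (ℓ * n)| * kn J ℓ K n x ≤ δ * kn J ℓ K n x := by
  have b1 : Bdd (fun z => w z - w (ℓ * n)) := hw.sub (Bdd.const _)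
  have h1 := hS.abs_le (b1.mul (bdd_kn (ℓ := ℓ) hK n)) ((bdd_kn (ℓ := ℓ) hK n).const_mul δ) (fun z => by
    by_cases hz : (ℓ:ℤ) ∣ z
    · obtain ⟨y, rfl⟩ := hz
      simp only [io_mul hℓ]
      rw [abs_mul, abs_of_nonneg (hK0 _)]
      by_cases h0 : K (y - n) = 0
      · simp [h0]
      · apply mul_le_mul_of_nonneg_right _ (hK0 _)
        have := h _ h0 (ℓ * n)
        rwa [show (ℓ:ℤ) * n + ℓ * (y - n) = ℓ * y by ring] at this
    · simp [io_of_not _ hz]) x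
  rw [hS.mul b1 (bdd_kn hK n), hS.sub hw (Bdd.const _), hS.const, hS.smul _ (bdd_kn hK n), abs_mul] at h1
  have h2 := hS.kn_nonneg (ℓ := ℓ) hK hK0 n x
  unfold kn at h2 ⊢
  rwa [abs_of_nonneg h2] at h1

lemma Sys.upper (hS : Sys M μ J σ) (hM : IsMean M) {ℓ : ℕ} (hℓ : 0 < ℓ) (m : ℕ) {e f : X → ℝ}
    (he : BM e) (he0 : ∀ x, 0 ≤ e x) (he1 : ∀ x, e x ≤ 1)
    (hf : BM f) (hf0 : ∀ x, 0 ≤ f x) (hf1 : ∀ x, f x ≤ 1) (hfc : tl μ f ∈ hS.Hc m)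
    (hef : ∀ w ∈ hS.Hc m, inner ℝ w (tl μ e - tl μ f) = 0) {v : X → ℝ} (hv : BM v)
    (hv0 : ∀ x, 0 ≤ v x) (hv1 : ∀ x, v x ≤ 1) (t : ℤ) {b : ℤ → ℝ} (hb0 : ∀ z, 0 ≤ b z)
    (hb1 : ∀ z, b z ≤ 1) (hvb : ∀ x, J b x = 0 → v x = 0)
    (hnull : ∀ K, Good M ℓ K → lamMean M ℓ (fun n => b (ℓ * n) *
      ∫ x, v x * kn J ℓ K n x * e (σ (t + m * n) x) ∂μ) = 0) {ε : ℝ} (hε : 0 < ε) :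
    ∃ w δ, AP w ∧ 0 < δ ∧ ∀ K, Good M ℓ K → Compat ℓ w δ K → qq M μ J σ ℓ m K f t v ≤ ε := by
  have := hS.prob
  have hΛ := isMean_lamMean hM hℓ
  have hbB : Bdd b := Bdd.of_le hb0 hb1
  obtain ⟨u, hum, hu0, hu1, hulim, huo, huz⟩ := hS.exists_u (hS.BM_J hbB)
    (hS.nonneg hbB hb0) (hS.le_const hbB hb1)
  have huB : BM u := BM.of_le hum hu0 hu1
  have hva : ∀ x, |v x| ≤ 1 := fun x => by rw [abs_of_nonneg (hv0 x)]; exact hv1 x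
  have hfa : ∀ x, |f x| ≤ 1 := fun x => by rw [abs_of_nonneg (hf0 x)]; exact hf1 x
  have fB : ∀ k, BM (fun x => f (σ k x)) := fun k => hf.comp (hS.mp _).measurable
  have eB : ∀ k, BM (fun x => e (σ k x)) := fun k => he.comp (hS.mp _).measurable
  -- the cutoff
  have hcutB : ∀ η : ℝ, 0 < η → (BM (fun x => v x * (η / (u x + η))) ∧
      ∀ x, 0 ≤ v x * (η / (u x + η)) ∧ v x * (η / (u x + η)) ≤ 1) := by
    intro η hη
    have h01 : ∀ x, 0 ≤ v x * (η / (u x + η)) ∧ v x * (η / (u x + η)) ≤ 1 := fun x => by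
      have hp : 0 < u x + η := by linarith [hu0 x]
      refine ⟨mul_nonneg (hv0 x) (by positivity), mul_le_one₀ (hv1 x) (by positivity) ?_⟩
      rw [div_le_one hp]; linarith [hu0 x]
    exact ⟨BM.of_le (hv.1.mul (measurable_const.div (hum.add_const η))) (fun x => (h01 x).1)
      (fun x => (h01 x).2), h01⟩
  have hcut : ∃ η : ℝ, 0 < η ∧ ∫ x, v x * (η / (u x + η)) ∂μ ≤ ε / 2 := by
    have hlim : Tendsto (fun k : ℕ => ∫ x, v x * ((1 / ((k:ℝ) + 1)) / (u x + 1 / ((k:ℝ) + 1))) ∂μ) atTop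
        (𝓝 (∫ x, (0:ℝ) ∂μ)) := by
      refine tendsto_integral_of_dominated_convergence (fun _ => (1:ℝ))
        (fun k => (hcutB _ (by positivity)).1.1.aestronglyMeasurable) (BM.const 1).int (fun k => ?_) ?_
      · refine ae_of_all _ fun x => ?_
        have := (hcutB (1 / ((k:ℝ) + 1)) (by positivity)).2 x
        rw [Real.norm_eq_abs, abs_of_nonneg this.1]; exact this.2
      · filter_upwards [huz] with x hx
        by_cases h : u x ≤ 0
        · rw [hvb x (hx h)]; simp
        · push Not at h
          have h1 : Tendsto (fun k : ℕ => 1 / ((k:ℝ) + 1)) atTop (𝓝 0) :=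
            tendsto_one_div_add_atTop_nhds_zero_nat
          have h2 := (h1.div (h1.const_add (u x)) (by simpa using h.ne')).const_mul (v x)
          simpa using h2
    rw [integral_zero] at hlim
    obtain ⟨k, hk⟩ := (hlim.eventually (ge_mem_nhds (show (0:ℝ) < ε / 2 by positivity))).exists
    exact ⟨_, by positivity, hk⟩
  obtain ⟨η, hη, hηε⟩ := hcut
  set ε' := η * ε / 6 with hε'
  have hε'0 : 0 < ε' := by positivity
  obtain ⟨w, hw, hwu⟩ := hulim ε' hε'0
  refine ⟨w, ε', hw, hε'0, fun K hK hc => ?_⟩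
  have hKb := hK.ap.bdd
  obtain ⟨D, hD0, hD⟩ := hS.kn_bdd (ℓ := ℓ) hKb
  obtain ⟨Cw, hCw⟩ := hw.bdd
  have hCw0 : 0 ≤ Cw := (abs_nonneg _).trans (hCw 0)
  have knB := fun n => hS.kn_BM (ℓ := ℓ) hKb n
  have hknn := fun n x => hS.kn_nonneg (ℓ := ℓ) hKb hK.nn n x
  have hJw := hS.BM_J hw.bdd
  set a : ℤ → ℝ := fun n => ∫ x, v x * kn J ℓ K n x * f (σ (t + m * n) x) ∂μ with ha
  have haAP : AP a := hS.a_AP m hf hf0 hf1 hfc hv hv0 hv1 hK.ap t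
  have hl : (0:ℝ) < ℓ := by exact_mod_cast hℓ
  have ha1 : ∀ n, |a n| ≤ (ℓ:ℝ)⁻¹ := fun n => by
    have h1 := hS.int_kn hM hℓ hKb n
    rw [hK.mean] at h1
    have h2 : ∫ x, kn J ℓ K n x ∂μ = (ℓ:ℝ)⁻¹ := by field_simp; linarith
    rw [← h2]
    refine int_abs_le (knB n) fun x => ?_
    rw [abs_mul, abs_mul, abs_of_nonneg (hknn n x)]
    calc _ ≤ 1 * kn J ℓ K n x * 1 := mul_le_mul (mul_le_mul_of_nonneg_right (hva x) (hknn n x)) (hfa _)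
          (abs_nonneg _) (by have := hknn n x; linarith)
      _ = _ := by ring
  have hgen : ∀ {h : X → ℝ}, BM h → Bdd (fun n => ∫ x, h x * kn J ℓ K n x * f (σ (t + m * n) x) ∂μ) := by
    intro h hh
    obtain ⟨C, hC⟩ := hh.2
    refine bdd_int (C := |C| * D * 1) fun n x => ?_
    rw [abs_mul, abs_mul]
    exact mul_le_mul (mul_le_mul ((hC x).trans (le_abs_self C)) (hD n x) (abs_nonneg _) (abs_nonneg _))
      (hfa _) (abs_nonneg _) (by positivity)
  -- step three
  have s3 : lamMean M ℓ (fun n => b (ℓ * n) * a n) = 0 := by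
    have h1 := hS.wmK hM hℓ m he he0 he1 hf hf0 hf1 hef hv hv0 hv1 hK.ap t
    have hd : ∀ x, |e x - f x| ≤ 1 := fun x => by
      rw [abs_le']; constructor <;> linarith [he0 x, he1 x, hf0 x, hf1 x]
    have hbd : ∀ {g : X → ℝ}, (∀ x, |g x| ≤ 1) →
        Bdd (fun n => ∫ x, v x * kn J ℓ K n x * g (σ (t + m * n) x) ∂μ) := by
      intro g hg
      refine bdd_int (C := 1 * D * 1) fun n x => ?_
      rw [abs_mul, abs_mul]
      exact mul_le_mul (mul_le_mul (hva x) (hD n x) (abs_nonneg _) zero_le_one)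
        (hg _) (abs_nonneg _) (by positivity)
    have hea : ∀ x, |e x| ≤ 1 := fun x => by rw [abs_of_nonneg (he0 x)]; exact he1 x
    have bb : Bdd (fun n : ℤ => b (ℓ * n)) := hbB.comp _
    have h2 := hΛ.sub (bb.mul (hbd hea)) (bb.mul haAP.bdd)
    rw [hnull K hK] at h2
    have h3 : |lamMean M ℓ (fun n => b (ℓ * n) * (∫ x, v x * kn J ℓ K n x * e (σ (t + m * n) x) ∂μ)
        - b (ℓ * n) * a n)| ≤ 0 := by
      rw [← h1]
      have hd' := hbd (g := fun x => e x - f x) hd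
      refine (hΛ.abs_le ((bb.mul (hbd hea)).sub (bb.mul haAP.bdd))).trans ?_
      refine hΛ.mono ((bb.mul (hbd hea)).sub (bb.mul haAP.bdd)).abs hd'.abs fun n => ?_
      rw [← mul_sub, abs_mul, abs_of_nonneg (hb0 _)]
      simp only [ha]
      rw [← integral_sub ((hv.mul (knB _)).mul (eB _)).int ((hv.mul (knB _)).mul (fB _)).int]
      simp only [← mul_sub]
      exact mul_le_of_le_one_left (abs_nonneg _) (hb1 _)
    rw [h2, zero_sub, abs_neg, abs_nonpos_iff] at h3
    exact h3
  have t3 : |lamMean M ℓ (fun n => w (ℓ * n) * a n)| ≤ ε' := by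
    rw [hS.lam_mul hℓ hbB haAP.bdd] at s3
    have h1 := huo _ (io_pm hℓ haAP)
    have h2 : ∫ x, J b x * J (io ℓ a) x ∂μ = ∫ x, u x * J (io ℓ a) x ∂μ := by
      simp only [mul_comm (J b _), mul_comm (u _)]; exact h1
    have hJa := hS.BM_J (haAP.bdd.io (ℓ := ℓ))
    have h3 : ℓ * ∫ x, J w x * J (io ℓ a) x ∂μ = ∫ x, ℓ * ((J w x - u x) * J (io ℓ a) x) ∂μ := by
      rw [integral_const_mul]
      simp only [sub_mul]
      rw [integral_sub (hJw.mul hJa).int (huB.mul hJa).int, mul_sub, ← h2, s3, sub_zero]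
    rw [hS.lam_mul hℓ hw.bdd haAP.bdd, h3]
    refine (int_abs_le (hJw.sub huB).abs fun x => ?_).trans hwu
    have h4 : |J (io ℓ a) x| ≤ (ℓ:ℝ)⁻¹ := hS.abs_le_const (io_abs_le ha1) x
    rw [abs_mul, abs_mul, abs_of_pos hl]
    calc (ℓ:ℝ) * (|J w x - u x| * |J (io ℓ a) x|) ≤ ℓ * (|J w x - u x| * (ℓ:ℝ)⁻¹) := by gcongr
      _ = _ := by field_simp
  have t1 : |lamMean M ℓ (fun n => ∫ x, v x * (u x - J w x) * kn J ℓ K n x * f (σ (t + m * n) x) ∂μ)|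
      ≤ ε' := by
    refine (hS.um_le hM hℓ hK (hJw.sub huB).abs (fun x => abs_nonneg _) fun n x => ?_).trans hwu
    rw [abs_mul, abs_mul, abs_mul, abs_of_nonneg (hknn n x), abs_sub_comm (u x)]
    calc _ ≤ 1 * |J w x - u x| * kn J ℓ K n x * 1 := by
          have := hknn n x
          have h1 := hva x
          have h2 := hfa (σ (t + m * n) x)
          gcongr
      _ = _ := by ring
  have t2 : |lamMean M ℓ (fun n => ∫ x, v x * (J w x - w (ℓ * n)) * kn J ℓ K n x * f (σ (t + m * n) x) ∂μ)|
      ≤ ε' := by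
    refine (hS.um_le hM hℓ hK (BM.const ε') (fun x => hε'0.le) fun n x => ?_).trans (by simp)
    rw [abs_mul, abs_mul, abs_mul, abs_of_nonneg (hknn n x)]
    have h3 := hS.compat_le hℓ hw.bdd hKb hK.nn hc n x
    have h4 := hknn n x
    calc _ ≤ 1 * |J w x - w (ℓ * n)| * kn J ℓ K n x * 1 := by
          have h1 := hva x
          have h2 := hfa (σ (t + m * n) x)
          gcongr
      _ ≤ _ := by linarith
  have t2b : Bdd (fun n => ∫ x, v x * (J w x - w (ℓ * n)) * kn J ℓ K n x * f (σ (t + m * n) x) ∂μ) := by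
    refine bdd_int (C := 1 * (Cw + Cw) * D * 1) fun n x => ?_
    rw [abs_mul, abs_mul, abs_mul]
    have h1 := hva x
    have h2 := hfa (σ (t + m * n) x)
    have h3 := hD n x
    have h4 : |J w x - w (ℓ * n)| ≤ Cw + Cw :=
      (abs_sub _ _).trans (add_le_add (hS.abs_le_const hCw x) (hCw _))
    gcongr
  have t0 : lamMean M ℓ (fun n => ∫ x, v x * u x * kn J ℓ K n x * f (σ (t + m * n) x) ∂μ) ≤ 3 * ε' := by
    have hsplit : (fun n => ∫ x, v x * u x * kn J ℓ K n x * f (σ (t + m * n) x) ∂μ) = fun n =>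
        (∫ x, v x * (u x - J w x) * kn J ℓ K n x * f (σ (t + m * n) x) ∂μ +
        ∫ x, v x * (J w x - w (ℓ * n)) * kn J ℓ K n x * f (σ (t + m * n) x) ∂μ) + w (ℓ * n) * a n := by
      ext n
      simp only [ha]
      rw [← integral_const_mul, ← integral_add
        (((hv.mul (huB.sub hJw)).mul (knB n)).mul (fB _)).int
        (((hv.mul (hJw.sub (BM.const _))).mul (knB n)).mul (fB _)).int, ← integral_add
        ((((hv.mul (huB.sub hJw)).mul (knB n)).mul (fB _)).add
        (((hv.mul (hJw.sub (BM.const _))).mul (knB n)).mul (fB _))).int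
        ((BM.const _).mul ((hv.mul (knB n)).mul (fB _))).int]
      congr 1; ext x; ring
    rw [hsplit, hΛ.add ((hgen (hv.mul (huB.sub hJw))).add t2b) ((hw.bdd.comp _).mul haAP.bdd),
      hΛ.add (hgen (hv.mul (huB.sub hJw))) t2b]
    linarith [le_abs_self (lamMean M ℓ (fun n => w (ℓ * n) * a n)),
      le_abs_self (lamMean M ℓ (fun n => ∫ x, v x * (u x - J w x) * kn J ℓ K n x * f (σ (t + m * n) x) ∂μ)),
      le_abs_self (lamMean M ℓ (fun n => ∫ x, v x * (J w x - w (ℓ * n)) * kn J ℓ K n x * f (σ (t + m * n) x) ∂μ))]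
  obtain ⟨hcB, hc01⟩ := hcutB η hη
  have tc : |lamMean M ℓ (fun n => ∫ x, v x * (η / (u x + η)) * kn J ℓ K n x * f (σ (t + m * n) x) ∂μ)|
      ≤ ε / 2 := by
    refine (hS.um_le hM hℓ hK hcB (fun x => (hc01 x).1) fun n x => ?_).trans hηε
    rw [abs_mul, abs_mul, abs_of_nonneg (hknn n x), abs_of_nonneg (hc01 x).1]
    exact mul_le_of_le_one_right (mul_nonneg (hc01 x).1 (hknn n x)) (hfa _)
  have hfin : qq M μ J σ ℓ m K f t v ≤ lamMean M ℓ (fun n =>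
      (∫ x, v x * (η / (u x + η)) * kn J ℓ K n x * f (σ (t + m * n) x) ∂μ) +
      η⁻¹ * ∫ x, v x * u x * kn J ℓ K n x * f (σ (t + m * n) x) ∂μ) := by
    refine hΛ.mono haAP.bdd ((hgen hcB).add ((hgen (hv.mul huB)).const_mul _)) fun n => ?_
    rw [← integral_const_mul, ← integral_add ((hcB.mul (knB n)).mul (fB _)).int
      ((BM.const _).mul (((hv.mul huB).mul (knB n)).mul (fB _))).int]
    refine int_mono ((hv.mul (knB n)).mul (fB _)) (((hcB.mul (knB n)).mul (fB _)).add
      ((BM.const _).mul (((hv.mul huB).mul (knB n)).mul (fB _)))) fun x => ?_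
    have h1 : v x ≤ v x * (η / (u x + η)) + η⁻¹ * (v x * u x) := by
      have hp : 0 < u x + η := by linarith [hu0 x]
      have h2 : 1 ≤ η / (u x + η) + η⁻¹ * u x := by
        rw [div_add' _ _ _ hp.ne', le_div_iff₀ hp]
        have : η⁻¹ * u x * (u x + η) = η⁻¹ * u x ^ 2 + u x := by field_simp
        rw [this]
        have : 0 ≤ η⁻¹ * u x ^ 2 := by positivity
        linarith
      nlinarith [hv0 x]
    have h2 : 0 ≤ kn J ℓ K n x * f (σ (t + m * n) x) := mul_nonneg (hknn n x) (hf0 _)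
    nlinarith [mul_le_mul_of_nonneg_right h1 h2]
  rw [hΛ.add (hgen hcB) ((hgen (hv.mul huB)).const_mul _), hΛ.smul _ (hgen (hv.mul huB))] at hfin
  have h5 : η⁻¹ * lamMean M ℓ (fun n => ∫ x, v x * u x * kn J ℓ K n x * f (σ (t + m * n) x) ∂μ) ≤ ε / 2 := by
    calc _ ≤ η⁻¹ * (3 * ε') := by gcongr
      _ = ε / 2 := by rw [hε']; field_simp; norm_num
  linarith [le_abs_self (lamMean M ℓ (fun n => ∫ x, v x * (η / (u x + η)) * kn J ℓ K n x * f (σ (t + m * n) x) ∂μ))]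

end Upper2


/-! ### Existence of kernels and the final contradiction -/

lemma AP.bumps {ℓ : ℕ} {w : ℤ → ℝ} {δ : ℝ} (hw : AP w) (hδ : 0 < δ) :
    ∃ V : ℤ → ℝ, AP V ∧ (∀ z, 0 ≤ V z) ∧ 0 < V 0 ∧ Compat ℓ w δ V := by
  obtain ⟨C, hC⟩ := hw.bdd
  have hbd : ∀ p : ℤ, BddAbove (Set.range fun z => |w (z + ℓ * p) - w z|) := fun p =>
    ⟨C + C, by rintro _ ⟨z, rfl⟩; exact (abs_sub _ _).trans (add_le_add (hC _) (hC _))⟩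
  refine ⟨fun p => max (δ - ⨆ z, |w (z + ℓ * p) - w z|) 0, ?_, fun z => le_max_right _ _, ?_, ?_⟩
  · refine (TB.comp hw (pm_forall w) (fun s => ℓ * s)).imp fun ε hε => ⟨ε, hε, fun s i h z => ?_⟩
    refine (abs_max_sub_max_le_abs _ _ _).trans ?_
    have key : ∀ s i : ℤ, (∀ z, |w (z + ℓ * s) - w (z + ℓ * i)| ≤ ε) →
        (⨆ y, |w (y + ℓ * (z + s)) - w y|) ≤ (⨆ y, |w (y + ℓ * (z + i)) - w y|) + ε := by
      intro s i h
      apply ciSup_le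
      intro y
      have h1 := le_ciSup (hbd (z + i)) y
      have h2 := h (y + ℓ * z)
      have h3 := abs_sub_le (w (y + ℓ * (z + s))) (w (y + ℓ * (z + i))) (w y)
      rw [show y + ℓ * z + ℓ * s = y + ℓ * (z + s) by ring,
        show y + ℓ * z + ℓ * i = y + ℓ * (z + i) by ring] at h2
      linarith
    have h1 := key s i h
    have h2 := key i s (fun z => by rw [abs_sub_comm]; exact h z)
    rw [abs_le']
    constructor <;> linarith
  · simpa using hδ
  · intro p hp z
    by_contra hcon
    push Not at hcon
    apply hp
    apply max_eq_right
    have := le_ciSup (hbd p) z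
    linarith

lemma exists_good {M : (ℤ → ℝ) → ℝ} (hM : IsMean M) {ℓ : ℕ} (hℓ : 0 < ℓ)
    (C : List ((ℤ → ℝ) × ℝ)) (hC : ∀ p ∈ C, AP p.1 ∧ 0 < p.2) :
    ∃ K, Good M ℓ K ∧ ∀ p ∈ C, Compat ℓ p.1 p.2 K := by
  have hV : ∃ V : ℤ → ℝ, AP V ∧ (∀ z, 0 ≤ V z) ∧ 0 < V 0 ∧ ∀ p ∈ C, Compat ℓ p.1 p.2 V := by
    induction C with
    | nil => exact ⟨fun _ => 1, AP.const 1, fun _ => zero_le_one, one_pos, by simp⟩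
    | cons q C ih =>
      obtain ⟨V, h1, h2, h3, h4⟩ := ih fun p hp => hC p (List.mem_cons_of_mem _ hp)
      obtain ⟨hq1, hq2⟩ := hC q List.mem_cons_self
      obtain ⟨V', h1', h2', h3', h4'⟩ := AP.bumps (ℓ := ℓ) hq1 hq2
      refine ⟨fun z => V' z * V z, h1'.mul h1, fun z => mul_nonneg (h2' z) (h2 z), mul_pos h3' h3, ?_⟩
      intro p hp
      rcases List.mem_cons.1 hp with rfl | hp
      · exact fun y hy => h4' y (left_ne_zero_of_mul hy)
      · exact fun y hy => h4 p hp y (right_ne_zero_of_mul hy)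
  obtain ⟨V, h1, h2, h3, h4⟩ := hV
  have hΛ := isMean_lamMean hM hℓ
  have hp := AP.mean_pos hΛ h1 h2 h3
  refine ⟨fun z => (lamMean M ℓ V)⁻¹ * V z, ⟨h1.smul _, fun z => mul_nonneg (by positivity) (h2 z), ?_⟩, ?_⟩
  · rw [hΛ.smul _ h1.bdd, inv_mul_cancel₀ hp.ne']
  · exact fun p hp y hy => h4 p hp y (right_ne_zero_of_mul hy)

/-- functionals of kernels which can be made small by restricting to almost periods -/
def SmallK (M : (ℤ → ℝ) → ℝ) (ℓ : ℕ) (Φ : (ℤ → ℝ) → ℝ) : Prop :=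
  ∀ ε > 0, ∃ C : List ((ℤ → ℝ) × ℝ), (∀ p ∈ C, AP p.1 ∧ 0 < p.2) ∧
    ∀ K, Good M ℓ K → (∀ p ∈ C, Compat ℓ p.1 p.2 K) → Φ K ≤ ε

lemma SmallK.add {M : (ℤ → ℝ) → ℝ} {ℓ : ℕ} {Φ Ψ : (ℤ → ℝ) → ℝ} (h : SmallK M ℓ Φ) (h' : SmallK M ℓ Ψ) :
    SmallK M ℓ (fun K => Φ K + Ψ K) := by
  intro ε hε
  obtain ⟨C, h1, h2⟩ := h (ε / 2) (by positivity)
  obtain ⟨C', h1', h2'⟩ := h' (ε / 2) (by positivity)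
  refine ⟨C ++ C', fun p hp => ?_, fun K hK hp => ?_⟩
  · rcases List.mem_append.1 hp with h | h
    · exact h1 p h
    · exact h1' p h
  · have := h2 K hK fun p h => hp p (List.mem_append_left _ h)
    have := h2' K hK fun p h => hp p (List.mem_append_right _ h)
    linarith

lemma SmallK.sum {M : (ℤ → ℝ) → ℝ} {ℓ : ℕ} {Φ : ℕ → (ℤ → ℝ) → ℝ} (h : ∀ i, SmallK M ℓ (Φ i)) (N : ℕ) :
    SmallK M ℓ (fun K => ∑ i ∈ Finset.range N, Φ i K) := by
  induction N with
  | zero => exact fun ε hε => ⟨[], by simp, fun K _ _ => by simpa using hε.le⟩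
  | succ N ih =>
    simp only [Finset.sum_range_succ]
    exact ih.add (h N)

section Final
variable {X : Type} [MeasurableSpace X] {μ : Measure X} {M : (ℤ → ℝ) → ℝ}
  {J : (ℤ → ℝ) → X → ℝ} {σ : ℤ → X → X}

lemma Sys.qq_bdd (hS : Sys M μ J σ) {ℓ : ℕ} (m : ℕ) {f : X → ℝ} (hf : BM f) {v : X → ℝ} (hv : BM v)
    {K : ℤ → ℝ} (hK : Good M ℓ K) (t : ℤ) :
    Bdd (fun n => ∫ x, v x * kn J ℓ K n x * f (σ (t + m * n) x) ∂μ) := by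
  have := hS.prob
  obtain ⟨D, hD0, hD⟩ := hS.kn_bdd (ℓ := ℓ) hK.ap.bdd
  obtain ⟨C, hC⟩ := hv.2
  obtain ⟨C', hC'⟩ := hf.2
  refine bdd_int (C := |C| * D * C') fun n x => ?_
  rw [abs_mul, abs_mul]
  exact mul_le_mul (mul_le_mul ((hC x).trans (le_abs_self C)) (hD n x) (abs_nonneg _) (abs_nonneg _))
    (hC' _) (abs_nonneg _) (by positivity)

lemma Sys.qq_mono (hS : Sys M μ J σ) (hM : IsMean M) {ℓ : ℕ} (hℓ : 0 < ℓ) (m : ℕ) {f : X → ℝ}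
    (hf : BM f) (hf0 : ∀ x, 0 ≤ f x) {v v' : X → ℝ} (hv : BM v) (hv' : BM v') (h : ∀ x, v x ≤ v' x)
    {K : ℤ → ℝ} (hK : Good M ℓ K) (t : ℤ) :
    qq M μ J σ ℓ m K f t v ≤ qq M μ J σ ℓ m K f t v' := by
  have := hS.prob
  have hΛ := isMean_lamMean hM hℓ
  have knB := fun n => hS.kn_BM (ℓ := ℓ) hK.ap.bdd n
  have hknn := fun n x => hS.kn_nonneg (ℓ := ℓ) hK.ap.bdd hK.nn n x
  have fB : ∀ k, BM (fun x => f (σ k x)) := fun k => hf.comp (hS.mp _).measurable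
  refine hΛ.mono (hS.qq_bdd m hf hv hK t) (hS.qq_bdd m hf hv' hK t) fun n => ?_
  refine int_mono ((hv.mul (knB n)).mul (fB _)) ((hv'.mul (knB n)).mul (fB _)) fun x => ?_
  exact mul_le_mul_of_nonneg_right (mul_le_mul_of_nonneg_right (h x) (hknn n x)) (hf0 _)

lemma Sys.qq_add (hS : Sys M μ J σ) (hM : IsMean M) {ℓ : ℕ} (hℓ : 0 < ℓ) (m : ℕ) {f : X → ℝ}
    (hf : BM f) {v v' : X → ℝ} (hv : BM v) (hv' : BM v')
    {K : ℤ → ℝ} (hK : Good M ℓ K) (t : ℤ) :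
    qq M μ J σ ℓ m K f t (fun x => v x + v' x) =
      qq M μ J σ ℓ m K f t v + qq M μ J σ ℓ m K f t v' := by
  have := hS.prob
  have hΛ := isMean_lamMean hM hℓ
  have knB := fun n => hS.kn_BM (ℓ := ℓ) hK.ap.bdd n
  have fB : ∀ k, BM (fun x => f (σ k x)) := fun k => hf.comp (hS.mp _).measurable
  unfold qq
  rw [← hΛ.add (hS.qq_bdd m hf hv hK t) (hS.qq_bdd m hf hv' hK t)]
  congr 1; ext n
  rw [← integral_add ((hv.mul (knB n)).mul (fB _)).int ((hv'.mul (knB n)).mul (fB _)).int]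
  congr 1; ext x; ring

lemma Sys.qq_sum (hS : Sys M μ J σ) (hM : IsMean M) {ℓ : ℕ} (hℓ : 0 < ℓ) (m : ℕ) {f : X → ℝ}
    (hf : BM f) {v : ℕ → X → ℝ} (hv : ∀ i, BM (v i))
    {K : ℤ → ℝ} (hK : Good M ℓ K) (t : ℤ) (N : ℕ) :
    qq M μ J σ ℓ m K f t (fun x => ∑ i ∈ Finset.range N, v i x) =
      ∑ i ∈ Finset.range N, qq M μ J σ ℓ m K f t (v i) := by
  induction N with
  | zero =>
    have := (isMean_lamMean hM hℓ).const 0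
    simpa [qq] using this
  | succ N ih =>
    simp only [Finset.sum_range_succ]
    rw [hS.qq_add hM hℓ m hf (BM.sum _ hv) (hv N) hK, ih]

lemma Sys.null (hS : Sys M μ J σ) (hM : IsMean M) {ℓ : ℕ} (hℓ : 0 < ℓ) (m : ℕ) {e : X → ℝ}
    (he : BM e) (t : ℤ) {b : ℤ → ℝ} (hb : Bdd b)
    {v : X → ℝ} (hv : BM v)
    (hev : ∀ x, v x ≠ 0 → ∀ᶠ n : ℤ in atTop, b (ℓ * n) * e (σ (t + m * n) x) = 0)
    {K : ℤ → ℝ} (hK : Good M ℓ K) : lamMean M ℓ (fun n => b (ℓ * n) *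
      ∫ x, v x * kn J ℓ K n x * e (σ (t + m * n) x) ∂μ) = 0 := by
  have := hS.prob
  have hΛ := isMean_lamMean hM hℓ
  refine hΛ.vanish ((hb.comp _).mul (hS.qq_bdd m he hv hK t)) ?_
  have knB := fun n => hS.kn_BM (ℓ := ℓ) hK.ap.bdd n
  have eB : ∀ k, BM (fun x => e (σ k x)) := fun k => he.comp (hS.mp _).measurable
  simp only [← integral_const_mul]
  obtain ⟨D, hD0, hD⟩ := hS.kn_bdd (ℓ := ℓ) hK.ap.bdd
  obtain ⟨C, hC⟩ := hv.2
  obtain ⟨C', hC'⟩ := he.2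
  obtain ⟨B, hB⟩ := hb
  have key : Tendsto (fun n : ℤ => ∫ x, b (ℓ * n) * (v x * kn J ℓ K n x * e (σ (t + m * n) x)) ∂μ) atTop
      (𝓝 (∫ x, (0:ℝ) ∂μ)) := by
    refine tendsto_integral_filter_of_dominated_convergence (fun _ => B * (|C| * D * C'))
      (Eventually.of_forall fun n =>
        ((BM.const _).mul ((hv.mul (knB n)).mul (eB _))).1.aestronglyMeasurable)
      (Eventually.of_forall fun n => ae_of_all _ fun x => ?_) (BM.const _).int (ae_of_all _ fun x => ?_)
    · rw [Real.norm_eq_abs, abs_mul, abs_mul, abs_mul]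
      exact mul_le_mul (hB _) (mul_le_mul (mul_le_mul ((hC x).trans (le_abs_self C)) (hD n x)
        (abs_nonneg _) (abs_nonneg _)) (hC' _) (abs_nonneg _) (by positivity)) (by positivity)
        ((abs_nonneg _).trans (hB 0))
    · by_cases h : v x = 0
      · simp [h]
      · refine tendsto_const_nhds.congr' ?_
        filter_upwards [hev x h] with n hn
        rw [show b (ℓ * n) * (v x * kn J ℓ K n x * e (σ (t + m * n) x)) =
          (v x * kn J ℓ K n x) * (b (ℓ * n) * e (σ (t + m * n) x)) by ring, hn, mul_zero]
  rwa [integral_zero] at key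

lemma Sys.exists_point (hS : Sys M μ J σ) (hM : IsMean M) {ℓ : ℕ} (hℓ : 0 < ℓ) (m : ℕ) {a : ℤ → ℝ}
    (ha0 : ∀ z, 0 ≤ a z) (ha1 : ∀ z, a z ≤ 1)
    (hpos : 0 < M (fun z => a z * io ℓ (fun _ => 1) z)) :
    ∃ s : ℕ, ∃ x, J a (σ (ℓ * ((s:ℤ) + 1)) x) ≠ 0 ∧ ∀ S : Finset ℕ,
      (∀ i ∈ S, J a (σ (ℓ * ((s:ℤ) + 1) + i) x) ≠ 0) →
      ∃ᶠ n : ℤ in atTop, (∀ i ∈ S, a (ℓ * n + ℓ * ((s:ℤ) + 1) + i) ≠ 0) ∧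
        J a (σ (ℓ * ((s:ℤ) + 1) + m * n) x) ≠ 0 := by
  classical
  have := hS.prob
  have haB : Bdd a := Bdd.of_le ha0 ha1
  have he : BM (J a) := hS.BM_J haB
  have he0 := hS.nonneg haB ha0
  have he1 := hS.le_const haB ha1
  obtain ⟨f, hfm, hf0, hf1, hfc, hef⟩ := hS.exists_f m he he0 he1
  have hf : BM f := BM.of_le hfm hf0 hf1
  set e := J a with hedef
  have hLB : BM (J (io ℓ (fun _ => 1))) := hS.BM_J (Bdd.const 1).io
  have hpos' : 0 < ∫ x, e x * J (io ℓ (fun _ => 1)) x ∂μ := by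
    rw [← hS.int (haB.mul (Bdd.const 1).io)] at hpos
    simpa only [hS.mul haB (Bdd.const 1).io] using hpos
  obtain ⟨c, hc, N, hN, hlow⟩ := hS.lower hM hℓ m he he0 he1 hf hef hpos'
  by_contra hcon
  push Not at hcon
  have hsmall : ∀ s : ℕ, SmallK M ℓ (fun K => qq M μ J σ ℓ m K f (ℓ * ((s:ℤ) + 1))
        (fun x => e (σ (ℓ * ((s:ℤ) + 1)) x) * J (io ℓ (fun _ => 1)) x)) := by
    intro s
    have hcs := hcon s
    set t : ℤ := ℓ * ((s:ℤ) + 1) with ht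
    have eB : ∀ k, BM (fun x => e (σ k x)) := fun k => he.comp (hS.mp _).measurable
    obtain ⟨enum, henum⟩ := exists_surjective_nat (Finset ℕ)
    set b : ℕ → ℤ → ℝ := fun j z => ∏ i ∈ enum j, a (z + (t + i)) with hb
    have hb0 : ∀ j z, 0 ≤ b j z := fun j z => Finset.prod_nonneg fun i _ => ha0 _
    have hb1 : ∀ j z, b j z ≤ 1 := fun j z => Finset.prod_le_one (fun i _ => ha0 _) fun i _ => ha1 _
    have hbB : ∀ j, Bdd (b j) := fun j => Bdd.of_le (hb0 j) (hb1 j)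
    have hJb : ∀ j x, J (b j) x = ∏ i ∈ enum j, e (σ (t + i) x) := fun j x => by
      have h1 := (hS.prod (enum j) (f := fun (i:ℕ) z => a (z + (t + i))) (fun i => haB.comp _) x).2
      rw [hb]
      simp only
      rw [h1]
      exact Finset.prod_congr rfl fun i _ => (hS.Jσ haB _ x).symm
    set W : ℕ → Set X := fun j => {x | J (b j) x ≠ 0 ∧
      ∀ᶠ n : ℤ in atTop, b j (ℓ * n) * e (σ (t + m * n) x) = 0} with hW
    have hWm : ∀ j, MeasurableSet (W j) := by
      intro j
      have h1 : MeasurableSet {x | J (b j) x ≠ 0} :=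
        (hS.meas (hbB j)) (measurableSet_singleton (0:ℝ)).compl
      refine h1.inter ?_
      have : {x | ∀ᶠ n : ℤ in atTop, b j (ℓ * n) * e (σ (t + m * n) x) = 0} =
          ⋃ n₀ : ℤ, ⋂ n : ℤ, ⋂ _ : n₀ ≤ n, {x | b j (ℓ * n) * e (σ (t + m * n) x) = 0} := by
        ext x; simp [eventually_atTop]
      change MeasurableSet {x | ∀ᶠ n : ℤ in atTop, b j (ℓ * n) * e (σ (t + m * n) x) = 0}
      rw [this]
      refine MeasurableSet.iUnion fun n₀ => MeasurableSet.iInter fun n => MeasurableSet.iInter fun _ => ?_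
      exact ((eB (t + m * n)).1.const_mul _) (measurableSet_singleton (0:ℝ))
    set v : ℕ → X → ℝ := fun j => (W j).indicator (fun _ => (1:ℝ)) with hv
    have hvB : ∀ j, BM (v j) := fun j => BM.indicator (hWm j)
    have hv0 : ∀ j x, 0 ≤ v j x := fun j x => Set.indicator_nonneg (fun _ _ => zero_le_one) x
    have hv1 : ∀ j x, v j x ≤ 1 := fun j x => Set.indicator_le_self' (fun _ _ => zero_le_one) x
    have hvW : ∀ j x, v j x ≠ 0 → x ∈ W j := fun j x h => by
      by_contra h'; exact h (Set.indicator_of_notMem h' _)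
    have hvs : ∀ j, SmallK M ℓ (fun K => qq M μ J σ ℓ m K f t (v j)) := by
      intro j ε hε
      obtain ⟨w, δ, hw, hδ, hu⟩ := hS.upper hM hℓ m he he0 he1 hf hf0 hf1 hfc hef (hvB j) (hv0 j) (hv1 j)
        t (hb0 j) (hb1 j) (fun x hx => by
          by_contra h'; exact (hvW j x h').1 hx)
        (fun K hK => hS.null hM hℓ m he t (hbB j) (hvB j) (fun x hx => (hvW j x hx).2) hK) hε
      exact ⟨[(w, δ)], by simp [hw, hδ], fun K hK hp => hu K hK (hp (w, δ) (by simp))⟩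
    set E : X → ℝ := fun x => e (σ t x) * J (io ℓ (fun _ => 1)) x with hE
    have hEB : BM E := (eB t).mul hLB
    have hE0 : ∀ x, 0 ≤ E x := fun x => mul_nonneg (he0 _) (hS.L_le ℓ x).1
    have hE1 : ∀ x, E x ≤ 1 := fun x => mul_le_one₀ (he1 _) (hS.L_le ℓ x).1 (hS.L_le ℓ x).2
    set R : ℕ → Set X := fun k => {x | ∀ j < k, x ∉ W j} with hR
    have hRm : ∀ k, MeasurableSet (R k) := fun k => by
      have : R k = ⋂ j : ℕ, ⋂ _ : j < k, (W j)ᶜ := by ext x; simp [hR]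
      rw [this]
      exact MeasurableSet.iInter fun j => MeasurableSet.iInter fun _ => (hWm j).compl
    set r : ℕ → X → ℝ := fun k x => E x * (R k).indicator (fun _ => (1:ℝ)) x with hr
    have hrB : ∀ k, BM (r k) := fun k => hEB.mul (BM.indicator (hRm k))
    have hi01 : ∀ k x, 0 ≤ (R k).indicator (fun _ => (1:ℝ)) x ∧ (R k).indicator (fun _ => (1:ℝ)) x ≤ 1 :=
      fun k x => ⟨Set.indicator_nonneg (fun _ _ => zero_le_one) x,
        Set.indicator_le_self' (fun _ _ => zero_le_one) x⟩
    have hr0 : ∀ k x, 0 ≤ r k x := fun k x => mul_nonneg (hE0 x) (hi01 k x).1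
    have hr1 : ∀ k x, r k x ≤ 1 := fun k x => mul_le_one₀ (hE1 x) (hi01 k x).1 (hi01 k x).2
    have hcover : ∀ x, E x = 0 ∨ ∃ j, x ∈ W j := by
      intro x
      by_cases hx : e (σ t x) = 0
      · left; simp [hE, hx]
      · right
        obtain ⟨S, hS1, hS2⟩ := hcs x hx
        obtain ⟨j, rfl⟩ := henum S
        refine ⟨j, ?_, ?_⟩
        · rw [hJb, Finset.prod_ne_zero_iff]; exact hS1
        · filter_upwards [hS2] with n hn
          by_contra h
          apply right_ne_zero_of_mul h
          apply hn
          intro i hi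
          have := Finset.prod_ne_zero_iff.1 (left_ne_zero_of_mul h) i hi
          rwa [← add_assoc] at this
    have hlim : Tendsto (fun k => ∫ x, r k x ∂μ) atTop (𝓝 (∫ x, (0:ℝ) ∂μ)) := by
      refine tendsto_integral_of_dominated_convergence (fun _ => (1:ℝ))
        (fun k => (hrB k).1.aestronglyMeasurable) (BM.const 1).int
        (fun k => ae_of_all _ fun x => ?_) (ae_of_all _ fun x => ?_)
      · rw [Real.norm_eq_abs, abs_of_nonneg (hr0 k x)]; exact hr1 k x
      · rcases hcover x with h | ⟨j, hj⟩
        · simp [hr, h]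
        · refine tendsto_const_nhds.congr' ?_
          filter_upwards [eventually_gt_atTop j] with k hk
          have : x ∉ R k := fun h => h j hk hj
          simp [hr, this]
    rw [integral_zero] at hlim
    intro ε hε
    obtain ⟨k, hk⟩ := (hlim.eventually (ge_mem_nhds (show (0:ℝ) < ε / 2 by positivity))).exists
    obtain ⟨C, hC1, hC2⟩ := SmallK.sum hvs k (ε / 2) (by positivity)
    refine ⟨C, hC1, fun K hK hp => ?_⟩
    have h1 := hC2 K hK hp
    have h2 : qq M μ J σ ℓ m K f t E ≤ qq M μ J σ ℓ m K f t (fun x => r k x + ∑ j ∈ Finset.range k, v j x) := by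
      refine hS.qq_mono hM hℓ m hf hf0 hEB ((hrB k).add (BM.sum _ hvB)) (fun x => ?_) hK t
      by_cases h : x ∈ R k
      · have : 0 ≤ ∑ j ∈ Finset.range k, v j x := Finset.sum_nonneg fun j _ => hv0 j x
        have : r k x = E x := by simp [hr, h]
        linarith
      · have : ∃ j < k, x ∈ W j := by simpa [hR] using h
        obtain ⟨j, hj, hxj⟩ := this
        have h3 := Finset.single_le_sum (f := fun j => v j x) (fun j _ => hv0 j x) (Finset.mem_range.2 hj)
        have h4 : v j x = 1 := Set.indicator_of_mem hxj _
        simp only [h4] at h3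
        linarith [hE1 x, hr0 k x]
    rw [hS.qq_add hM hℓ m hf (hrB k) (BM.sum _ hvB) hK, hS.qq_sum hM hℓ m hf hvB hK] at h2
    have h3 : |qq M μ J σ ℓ m K f t (r k)| ≤ ∫ x, r k x ∂μ := by
      refine hS.um_le hM hℓ hK (hrB k) (hr0 k) fun n x => ?_
      have h5 := hS.kn_nonneg (ℓ := ℓ) hK.ap.bdd hK.nn n x
      rw [abs_mul, abs_mul, abs_of_nonneg h5, abs_of_nonneg (hr0 k x), abs_of_nonneg (hf0 _)]
      exact mul_le_of_le_one_right (mul_nonneg (hr0 k x) h5) (hf1 _)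
    have h4 := (le_abs_self _).trans h3
    linarith
  have hNp : (0:ℝ) < N := by exact_mod_cast hN
  obtain ⟨C, hC1, hC2⟩ := SmallK.sum hsmall N (N * (c / 2)) (by positivity)
  obtain ⟨K, hK, hp⟩ := exists_good hM hℓ C hC1
  have h1 := hlow K hK
  have h2 := hC2 K hK hp
  rw [inv_mul_eq_div, le_div_iff₀ hNp] at h1
  nlinarith

end Final

/-- **Strengthened main theorem.** For any `A ⊆ ℕ` with positive upper Banach density,
there exist an infinite `B ⊆ ℕ` and `t ∈ ℕ` such that
`ℓ·B ∪ {m b₁ + ℓ b₂ : b₁, b₂ ∈ B, b₁ < b₂} ⊆ A - t`. -/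
theorem lB_union_mB_add_lB_shifted (ℓ m : ℕ) (hℓ : 0 < ℓ) (hm : 0 < m)
    (A : Set ℕ) (hA : 0 < upperBanachDensity A) :
    ∃ B : Set ℕ, B.Infinite ∧ ∃ t : ℕ, 0 < t ∧
      (∀ b ∈ B, ℓ * b + t ∈ A) ∧
      (∀ b₁ ∈ B, ∀ b₂ ∈ B, b₁ < b₂ → m * b₁ + ℓ * b₂ + t ∈ A) := by
  classical
  obtain ⟨M, hM, hpos⟩ := exists_mean A (by
    unfold upperBanachDensity at hA
    convert hA)
  set g : ℤ → ℝ := fun z => if 0 ≤ z ∧ z.toNat ∈ A then 1 else 0 with hg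
  have hg0 : ∀ z, 0 ≤ g z := fun z => by simp only [hg]; split_ifs <;> norm_num
  have hg1 : ∀ z, g z ≤ 1 := fun z => by simp only [hg]; split_ifs <;> norm_num
  obtain ⟨r, hr⟩ := exists_residue hM hℓ (Bdd.of_le hg0 hg1) hpos
  set a : ℤ → ℝ := fun z => g (z + r) with ha
  have hmem : ∀ k : ℕ, a k ≠ 0 → k + r ∈ A := by
    intro k hk
    by_contra h
    apply hk
    simp only [ha, hg]
    rw [if_neg]
    rintro ⟨-, h2⟩
    apply h
    rwa [show ((k:ℤ) + r).toNat = k + r by omega] at h2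
  obtain ⟨X, _, μ, J, σ, hS⟩ := exists_sys hM
  obtain ⟨s, x, hx0, hx⟩ := hS.exists_point hM hℓ m (a := a) (fun z => hg0 _) (fun z => hg1 _) hr
  obtain ⟨f, hf1, hf2⟩ := exists_seq_of_forall_finset_exists
    (fun b : ℕ => J a (σ (ℓ * ((s:ℤ) + 1) + m * (b:ℤ)) x) ≠ 0 ∧ a ((ℓ * b + ℓ * (s + 1) : ℕ)) ≠ 0)
    (fun b b' : ℕ => b < b' ∧ a ((m * b + ℓ * b' + ℓ * (s + 1) : ℕ)) ≠ 0)
    (by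
      intro T hT
      have h1 := hx (insert 0 (T.image (m * ·))) (by
        intro i hi
        rcases Finset.mem_insert.1 hi with rfl | hi
        · simpa using hx0
        · obtain ⟨b, hb, rfl⟩ := Finset.mem_image.1 hi
          have := (hT b hb).1
          simpa using this)
      obtain ⟨n, ⟨hn1, hn2⟩, hn3⟩ := (h1.and_eventually
        (eventually_ge_atTop (((T.sup id : ℕ) : ℤ) + 1))).exists
      lift n to ℕ using (by omega)
      refine ⟨n, ⟨hn2, ?_⟩, fun b hb => ⟨?_, ?_⟩⟩
      · have := hn1 0 (Finset.mem_insert_self _ _)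
        push_cast
        simpa using this
      · have : b ≤ T.sup id := Finset.le_sup (f := id) hb
        omega
      · have := hn1 (m * b) (Finset.mem_insert_of_mem (Finset.mem_image_of_mem _ hb))
        convert this using 2
        push_cast
        ring)
  have hmono : StrictMono f := fun i j hij => (hf2 i j hij).1
  refine ⟨Set.range f, Set.infinite_range_of_injective hmono.injective, ℓ * (s + 1) + r, by positivity, ?_, ?_⟩
  · rintro _ ⟨i, rfl⟩
    rw [← add_assoc]
    exact hmem _ (hf1 i).2
  · rintro _ ⟨i, rfl⟩ _ ⟨j, rfl⟩ hij
    rw [← add_assoc]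
    exact hmem _ (hf2 i j (hmono.lt_iff_lt.1 hij)).2
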